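/- The Gray graph is the smallest cubic semisymmetric graph: every finite simple graph that is regular of degree 3, edge-transitive (for any two edges there is a graph automorphism carrying one onto the other as unordered pairs), and not vertex-transitive (some pair of vertices is not related by any automorphism) has at least 54 vertices. -/

import Mathlib

namespace CubicSearch

/-! ### A kernel-friendly search engine

The search enumerates cubic bipartite graphs with a prescribed group of automorphisms of order `m`.
Vertices are labelled by natural numbers: the label `m * o + i` stands for the image of the base
point of the orbit `o` under the group element `i`. A partial adjacency matrix is stored, row by row
in fields of width `W`, in the bits from `64` on of a single natural number.
-/

/-- The parameters of a search. -/
structure Cfg where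
  /-- width of a row of the adjacency matrix; all labels are smaller than `W - 1` -/
  W : Nat
  /-- the number with bits at the multiples of `W - 1` -/
  C1 : Nat
  /-- the number with bits at the multiples of `W` -/
  ONE : Nat
  /-- the mask of a row -/
  FM : Nat
  /-- order of the group -/
  m : Nat
  /-- number of orbit types -/
  nt : Nat
  /-- multiplication of the group -/
  mul : Nat → Nat → Nat
  /-- representative of the coset of `i` in an orbit of type `t` -/
  can : Nat → Nat → Nat
  /-- size of an orbit of type `t` -/
  sz : Nat → Nat
  /-- mask of the coset representatives for type `t` -/
  cm : Nat → Nat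
  /-- girth bound minus `4` -/
  G4 : Nat
  /-- lower bound for the number of vertices on each side -/
  lo : Nat
  /-- upper bound for the number of vertices on each side -/
  hi : Nat
  /-- radius used for pruning, `0` if there is no pruning -/
  PR : Nat
  /-- lower bound for the intersections of balls of radius `PR` -/
  PLO : Nat
  /-- radius used at the leaves -/
  LR : Nat
  /-- permutations of the labels which exchange the sides, packed with 7 bits per label -/
  certs : List Nat

/-- Evaluate `k x` after `x` has been reduced to a literal. -/
def frc (x : Nat) (k : Nat → Bool) : Bool := Nat.rec (k 0) (fun n _ => k (Nat.succ n)) x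

def andNot (x y : Nat) : Nat := Nat.xor x (Nat.land x y)
def tb (x i : Nat) : Bool := Nat.beq (Nat.land (Nat.shiftRight x i) 1) 1
def orsh (x s : Nat) : Nat := Nat.lor x (Nat.shiftRight x s)
/-- Remove the lowest bit. -/
def strip (x : Nat) : Nat := Nat.land x (Nat.sub x 1)
def pop2 (x : Nat) : Bool := Nat.blt 0 (strip x)
/-- At least three bits. -/
def pop3 (x : Nat) : Bool := frc (strip x) fun y => Nat.blt 0 (strip y)
def bit (i : Nat) : Nat := Nat.shiftLeft 1 i
/-- At least `n` bits. -/
def pge (n x : Nat) : Bool := Nat.rec (motive := fun _ => Nat → Bool) (fun _ => true)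
   (fun _ f x => cond (Nat.beq x 0) false (frc (strip x) f)) n x
/-- Apply `K` to the number of bits. -/
def pc (x : Nat) (K : Nat → Bool) : Bool :=
  Nat.rec (motive := fun _ => Nat → Nat → Bool) (fun _ _ => false)
   (fun _ f x n => cond (Nat.beq x 0) (K n)
     (frc (Nat.succ n) fun n => frc (strip x) fun x => f x n)) 64 x 0
def low (B : Nat) : Nat := Nat.log2 (Nat.xor B (strip B))

namespace Cfg
variable (c : Cfg)

/-- The neighbours of the set `S` of labels. -/
def nb (T S : Nat) : Nat := Nat.land c.FM
  (orsh (orsh (orsh (orsh (orsh (orsh (orsh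
    (Nat.land (Nat.shiftRight T 64) (Nat.mul (Nat.land (Nat.mul S c.C1) c.ONE) c.FM))
    c.W) (Nat.mul c.W 2)) (Nat.mul c.W 4)) (Nat.mul c.W 8)) (Nat.mul c.W 16)) (Nat.mul c.W 32))
    (Nat.mul c.W 64))
def step (M T S : Nat) : Nat := Nat.lor S (Nat.land (c.nb T S) M)
/-- The ball of radius `r` around `S`, within the mask `M`. -/
def ball (M T r S : Nat) : Nat := Nat.rec S (fun _ S' => c.step M T S') r
def row (T a : Nat) : Nat := Nat.land c.FM (Nat.shiftRight T (Nat.add 64 (Nat.mul c.W a)))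
/-- Store a matrix; the lowest 64 bits serve as a hash of it. -/
def salt (T : Nat) : Nat := Nat.lor (Nat.shiftLeft T 64) (Nat.mod T 2305843009213693951)
def avoid (v : Nat) : Nat := Nat.xor c.FM (bit v)
/-- The labels with a complete row. -/
def fullm (T : Nat) : Nat :=
  Nat.rec 0 (fun a acc => cond (pop3 (c.row T a)) (Nat.lor acc (bit a)) acc) c.W
def patt (t t' j : Nat) : Nat :=
  Nat.rec 0 (fun g acc => Nat.lor acc
    (bit (Nat.add (Nat.mul c.W (c.can t g)) (c.can t' (c.mul g j))))) c.m
def pattT (t t' j : Nat) : Nat :=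
  Nat.rec 0 (fun g acc => Nat.lor acc
    (bit (Nat.add (Nat.mul c.W (c.can t' (c.mul g j))) (c.can t g)))) c.m
/-- Insert the orbit of the edge between the base point of `o` and the image under `j` of the base
point of `o'`. -/
def edges (T o t o' t' j : Nat) : Nat :=
  Nat.lor (Nat.shiftRight T 64) (Nat.lor
    (Nat.shiftLeft (c.patt t t' j) (Nat.add (Nat.mul c.W (Nat.mul c.m o)) (Nat.mul c.m o')))
    (Nat.shiftLeft (c.pattT t t' j) (Nat.add (Nat.mul c.W (Nat.mul c.m o')) (Nat.mul c.m o))))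
/-- The type of the orbit `o`. -/
def ty (I o : Nat) : Nat := Nat.land 15 (Nat.shiftRight I (Nat.mul 4 o))

/-- The pairwise intersections of the balls around the three neighbours of `v`. -/
def pairs (T R v : Nat) (k : Nat → Nat → Nat → Bool) : Bool :=
  frc (c.row T v) fun r =>
  frc (Nat.log2 r) fun x =>
  frc (Nat.xor r (bit x)) fun r1 =>
  frc (Nat.log2 r1) fun y =>
  frc (Nat.xor r1 (bit y)) fun r2 =>
  frc (Nat.log2 r2) fun z =>
  frc (c.ball c.FM T R (bit x)) fun bx =>
  frc (c.ball c.FM T R (bit y)) fun bY =>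
  frc (c.ball c.FM T R (bit z)) fun bz =>
  frc (Nat.land bx bY) fun p => frc (Nat.land bx bz) fun q => frc (Nat.land bY bz) fun s => k p q s

def pairBad (T v : Nat) : Bool :=
  c.pairs T c.PR v fun a b d =>
    cond (pge c.PLO a) (cond (pge c.PLO b) (cond (pge c.PLO d) false true) true) true

def pruneL (T F : Nat) : Nat → Bool :=
  Nat.rec (fun _ => false) (fun _ ih S =>
    cond (Nat.beq S 0) false
     (frc (Nat.log2 S) fun u =>
      cond (cond (Nat.beq 0 (andNot (c.ball c.FM T c.PR (bit u)) F)) (c.pairBad T u) false) true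
       (frc (Nat.xor S (bit u)) ih))) 32

/-- Is there, near the edge `{v, l}`, a pair of balls with too small an intersection? -/
def prune (T v l : Nat) : Bool :=
  cond (Nat.beq c.PR 0) false
   (cond (cond (pop3 (c.row T v)) true (pop3 (c.row T l)))
    (frc (c.fullm T) fun F =>
     frc (c.ball c.FM T c.PR (Nat.lor (bit v) (bit l))) fun S => c.pruneL T F S) false)

/-- Are there two pairs of balls of radius `LR` around neighbours of vertices on the same side whose
intersections have different sizes? -/
def inhom (T LU k : Nat) : Nat → Nat → Bool :=
  Nat.rec (fun _ _ => false) (fun o ih ru rw =>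
    frc (Nat.mul c.m o) fun v =>
    c.pairs T c.LR v fun a b d =>
    pc a fun p => frc (Nat.succ p) fun p => pc b fun pb => pc d fun pd =>
     cond (Nat.beq p (Nat.succ pb))
      (cond (Nat.beq p (Nat.succ pd))
       (cond (tb LU v)
        (cond (Nat.beq ru 0) (ih p rw) (cond (Nat.beq ru p) (ih ru rw) true))
        (cond (Nat.beq rw 0) (ih ru p) (cond (Nat.beq rw p) (ih ru rw) true)))
       true) true) k

def pim (P a : Nat) : Nat := Nat.land 127 (Nat.shiftRight P (Nat.mul 7 a))
def drop (r : Nat) : Nat := Nat.xor r (bit (Nat.log2 r))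
def rowim (P r : Nat) : Nat := Nat.lor (bit (pim P (Nat.log2 r)))
   (Nat.lor (bit (pim P (Nat.log2 (drop r)))) (bit (pim P (Nat.log2 (drop (drop r))))))
/-- Is `P` an automorphism which exchanges the sides? -/
def swapOK (T LU LW P : Nat) : Bool :=
  Nat.rec (motive := fun _ => Nat → Bool) (fun _ => false) (fun _ ih S =>
    cond (Nat.beq S 0) true
     (frc (Nat.log2 S) fun a =>
      frc (pim P a) fun b =>
      frc (c.row T a) fun r =>
      cond (Nat.beq (pim P b) a)
       (cond (tb (cond (tb LU a) LW LU) b)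
       (cond (Nat.beq (c.row T b) (rowim P r))
        (frc (Nat.xor S (bit a)) ih) false) false) false)) 128 (Nat.lor LU LW)

/-- The test of a complete graph. -/
def leaf (T LU LW k cU : Nat) : Bool :=
   (frc (c.fullm T) fun F =>
    cond (Nat.beq 0 (andNot (Nat.lor LU LW) F))
     (cond (Nat.ble c.lo cU)
       (List.rec (c.inhom T LU k 0 0) (fun P _ ih => cond (c.swapOK T LU LW P) true ih) c.certs)
       true) false)

def hA (A o o' : Nat) (r r' : Nat) : Nat :=
  Nat.lor (andNot A (Nat.lor (bit o) (bit o')))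
   (Nat.lor (cond (pop2 r) 0 (bit o)) (cond (pop2 r') 0 (bit o')))
def hB (B o o' : Nat) (r r' : Nat) : Nat :=
  Nat.lor (andNot B (Nat.lor (bit o) (bit o')))
   (Nat.lor (cond (pop2 r) (cond (pop3 r) 0 (bit o)) 0)
     (cond (pop2 r') (cond (pop3 r') 0 (bit o')) 0))

/-- A state of the search consists of the matrix, the types of the orbits, the number of orbits, the
masks of the labels on the two sides, the numbers of vertices on the two sides, and two hints for
the choice of the next vertex. -/
abbrev Rec := Nat → Nat → Nat → Nat → Nat → Nat → Nat → Nat → Nat → Bool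

def child (rec : Rec) (T I k LU LW cU cW A B o v t o' t' j : Nat) : Bool :=
  frc t' fun t' => frc j fun j =>
  frc (c.edges T o t o' t' j) fun T' => frc (salt T') fun T' =>
  frc (c.row T' v) fun r' =>
  frc (Nat.add (Nat.mul c.m o') (c.can t' j)) fun l =>
  cond (tb (c.ball (c.avoid v) T' c.G4 (andNot r' (bit l))) l) true
    (cond (c.prune T' v l) true (frc (c.row T' l) fun rl =>
     frc (hA A o o' r' rl) fun A' =>
     frc (hB B o o' r' rl) fun B' => rec T' I k LU LW cU cW A' B'))

/-- The children which join the base point of `o` to a known vertex. -/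
def cands (rec : Rec) (T I k LU LW cU cW A B o v t : Nat) : Nat → Nat → Bool :=
  Nat.rec (fun _ => false) (fun _ ih S =>
    cond (Nat.beq S 0) true
     (frc (Nat.log2 S) fun l =>
      cond (cond (pop3 (c.row T l)) true
        (frc (Nat.div l c.m) fun o' =>
          c.child rec T I k LU LW cU cW A B o v t o' (ty I o') (Nat.mod l c.m)))
       (frc (Nat.xor S (bit l)) ih) false))

/-- The children which join the base point of `o` to a new orbit. -/
def news (rec : Rec) (T I k LU LW cU cW A B o v t : Nat) (su : Bool) : Nat → Bool :=
  Nat.rec true (fun t' ih =>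
   cond (cond (Nat.beq t' 0) false (Nat.beq t' t)) ih
    (cond (Nat.ble (Nat.add (cond su cW cU) (c.sz t')) c.hi)
      (cond (Nat.blt (Nat.mul c.m (Nat.succ k)) c.W)
       (cond (frc (Nat.add I (Nat.shiftLeft t' (Nat.mul 4 k))) fun I' =>
        cond su
         (frc (Nat.lor LW (Nat.shiftLeft (c.cm t') (Nat.mul c.m k))) fun LW' =>
          frc (Nat.add cW (c.sz t')) fun cW' =>
          c.child rec T I' (Nat.succ k) LU LW' cU cW' A B o v t k t' 0)
         (frc (Nat.lor LU (Nat.shiftLeft (c.cm t') (Nat.mul c.m k))) fun LU' =>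
          frc (Nat.add cU (c.sz t')) fun cU' =>
          c.child rec T I' (Nat.succ k) LU' LW cU' cW A B o v t k t' 0))
       ih false) false) ih))

def body (rec : Rec) (T I k LU LW cU cW A B : Nat) : Bool :=
   cond (Nat.beq (Nat.lor A B) 0) (c.leaf T LU LW k cU)
    (frc (low (cond (Nat.beq B 0) A B)) fun o =>
     frc (Nat.mul c.m o) fun v =>
     frc (ty I o) fun t =>
     frc (c.row T v) fun r =>
     cond (cond (pop3 r) true (Nat.ble k o)) false
      (frc (c.ball (c.avoid v) T c.G4 r) fun Bl =>
        frc (andNot (cond (tb LU v) LW LU) Bl) fun S =>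
        cond (c.cands rec T I k LU LW cU cW A B o v t 128 S)
         (c.news rec T I k LU LW cU cW A B o v t (tb LU v) c.nt) false))

def dfs (f : Nat) : Rec :=
  Nat.rec (fun _ _ _ _ _ _ _ _ _ => false) (fun _ ih => c.body ih) f

/-- The search which starts with a single orbit of type `t`. -/
def start (t : Nat) : Bool := c.dfs 64 0 t 1 (c.cm t) 0 (c.sz t) 0 1 0
end Cfg

/-! ### Specification of the bit operations -/

theorem frc_eq (x : ℕ) (k : ℕ → Bool) : frc x k = k x := by cases x <;> rfl

theorem nbeq_eq (a b : ℕ) : Nat.beq a b = decide (a = b) := by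
  rw [Bool.eq_iff_iff, Nat.beq_eq, decide_eq_true_iff]
theorem nble_eq (a b : ℕ) : Nat.ble a b = decide (a ≤ b) := by
  rw [Bool.eq_iff_iff, Nat.ble_eq, decide_eq_true_iff]
theorem nblt_eq (a b : ℕ) : Nat.blt a b = decide (a < b) := by
  rw [Nat.blt, nble_eq]; rfl

section bitwise
variable (x y i : ℕ)
@[simp] theorem testBit_nlor : (Nat.lor x y).testBit i = (x.testBit i || y.testBit i) :=
  Nat.testBit_or x y i
@[simp] theorem testBit_nland : (Nat.land x y).testBit i = (x.testBit i && y.testBit i) :=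
  Nat.testBit_and x y i
@[simp] theorem testBit_nxor : (Nat.xor x y).testBit i = (x.testBit i ^^ y.testBit i) :=
  Nat.testBit_xor x y i
@[simp] theorem testBit_nshiftRight (s : ℕ) : (Nat.shiftRight x s).testBit i = x.testBit (s + i) :=
  Nat.testBit_shiftRight x
@[simp] theorem testBit_nshiftLeft (s : ℕ) :
    (Nat.shiftLeft x s).testBit i = (decide (s ≤ i) && x.testBit (i - s)) :=
  Nat.testBit_shiftLeft x
@[simp] theorem testBit_bit : (bit x).testBit i = decide (x = i) := by
  have : bit x = 2 ^ x := Nat.one_shiftLeft x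
  rw [this, Nat.testBit_two_pow]
@[simp] theorem testBit_andNot : (andNot x y).testBit i = (x.testBit i && !y.testBit i) := by
  simp [andNot]; cases x.testBit i <;> simp
@[simp] theorem testBit_orsh (s : ℕ) :
    (orsh x s).testBit i = (x.testBit i || x.testBit (s + i)) := by simp [orsh]
@[simp] theorem tb_eq : tb x i = x.testBit i := by
  rw [Bool.eq_iff_iff]
  have h : Nat.land (Nat.shiftRight x i) 1 = (x >>> i) % 2 := Nat.and_one_is_mod _
  unfold tb
  rw [Nat.beq_eq, h, Nat.shiftRight_eq_div_pow, Nat.testBit_eq_decide_div_mod_eq]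
  simp
end bitwise

theorem nland_eq_zero_iff (x y : ℕ) : Nat.beq 0 (andNot x y) = true ↔
    ∀ i, x.testBit i = true → y.testBit i = true := by
  rw [Nat.beq_eq]
  constructor
  · intro h i hi
    have := congrArg (·.testBit i) h
    simp [hi] at this
    exact this
  · intro h
    apply Nat.eq_of_testBit_eq
    intro i
    have := h i
    simp only [Nat.zero_testBit, testBit_andNot]
    revert this
    cases x.testBit i <;> cases y.testBit i <;> simp

/-- The set of positions of the ones in the binary expansion. -/
def bits (x : ℕ) : Finset ℕ := (Finset.range x).filter fun i => x.testBit i = true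

@[simp] theorem mem_bits {x i : ℕ} : i ∈ bits x ↔ x.testBit i = true := by
  simp only [bits, Finset.mem_filter, Finset.mem_range, and_iff_right_iff_imp]
  intro h
  exact Nat.lt_two_pow_self.trans_le (Nat.ge_two_pow_of_testBit h)

theorem bits_strip {x : ℕ} (hx : x ≠ 0) : ∃ i ∈ bits x, bits (strip x) = (bits x).erase i := by
  have hex := Nat.exists_testBit_of_ne_zero hx
  classical
  set i := Nat.find hex with hi
  have h1 : x.testBit i = true := Nat.find_spec hex
  have h2 : ∀ j < i, x.testBit j = false := fun j hj => by simpa using Nat.find_min hex hj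
  refine ⟨i, mem_bits.2 h1, ?_⟩
  set q := x / 2 ^ (i + 1) with hq
  have hmod : x % 2 ^ (i + 1) = 2 ^ i := by
    apply Nat.eq_of_testBit_eq
    intro j
    rw [Nat.testBit_mod_two_pow, Nat.testBit_two_pow]
    rcases lt_trichotomy j i with h | h | h
    · simp [h2 j h, h.ne']
    · subst h; simp [h1]
    · simp [h.ne, show ¬ j < i + 1 by omega]
  have hxe : x = 2 ^ (i + 1) * q + 2 ^ i := by
    rw [← hmod, hq]; exact (Nat.div_add_mod _ _).symm
  have hp : 0 < 2 ^ i := by positivity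
  have hx1 : x - 1 = 2 ^ (i + 1) * q + (2 ^ i - 1) := by omega
  have hlt : 2 ^ i < 2 ^ (i + 1) := Nat.pow_lt_pow_right (by norm_num) (by omega)
  ext j
  have hs : strip x = x &&& (x - 1) := rfl
  rw [mem_bits, Finset.mem_erase, mem_bits, hs, Nat.testBit_and, hx1,
    Nat.testBit_two_pow_mul_add _ (by omega), Nat.testBit_two_pow_sub_one]
  rcases lt_trichotomy j i with h | h | h
  · simp [h2 j h]
  · subst h; simp
  · have : x.testBit j = q.testBit (j - (i + 1)) := by
      conv_lhs => rw [hxe, Nat.testBit_two_pow_mul_add _ hlt]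
      simp [show ¬ j < i + 1 by omega]
    simp [this, show ¬ j < i + 1 by omega, h.ne']

theorem card_bits_strip {x : ℕ} (hx : x ≠ 0) : (bits (strip x)).card + 1 = (bits x).card := by
  obtain ⟨i, hi, h⟩ := bits_strip hx
  rw [h, Finset.card_erase_add_one hi]

theorem card_bits_eq_zero {x : ℕ} : (bits x).card = 0 ↔ x = 0 := by
  constructor
  · intro h
    by_contra hx
    have := card_bits_strip hx
    omega
  · rintro rfl; rfl

theorem card_bits_strip' (x : ℕ) : (bits (strip x)).card = (bits x).card - 1 := by
  by_cases hx : x = 0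
  · subst hx; rfl
  · have := card_bits_strip hx; omega

theorem pop3_iff (x : ℕ) : pop3 x = true ↔ 3 ≤ (bits x).card := by
  rw [pop3, frc_eq, nblt_eq, decide_eq_true_iff, Nat.pos_iff_ne_zero, Ne, ← card_bits_eq_zero, card_bits_strip',
    card_bits_strip']
  omega

theorem pge_iff (n x : ℕ) : pge n x = true ↔ n ≤ (bits x).card := by
  induction n generalizing x with
  | zero => simp [pge]
  | succ n ih =>
    have : pge (n + 1) x = cond (Nat.beq x 0) false (frc (strip x) (pge n)) := rfl
    rw [this, frc_eq]
    by_cases hx : x = 0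
    · subst hx; simp [bits]
    · have hb : Nat.beq x 0 = false := by simp [nbeq_eq, hx]
      have := card_bits_strip hx
      rw [hb, cond_false, ih]; omega

theorem pc_sound (x : ℕ) (K : ℕ → Bool) (h : pc x K = true) : K (bits x).card = true := by
  unfold pc at h
  simp only [frc_eq] at h
  suffices H : ∀ f x n, (Nat.rec (motive := fun _ => Nat → Nat → Bool) (fun _ _ => false)
      (fun _ f x n => cond (Nat.beq x 0) (K n)
        (f (strip x) (Nat.succ n))) f : ℕ → ℕ → Bool) x n = true →
      K (n + (bits x).card) = true by
    simpa using H 64 x 0 h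
  clear h x
  intro f
  induction f with
  | zero => intro x n h; simp at h
  | succ f ih =>
    intro x n h
    by_cases hx : x = 0
    · subst hx; simpa [bits] using h
    · have hb : Nat.beq x 0 = false := by simp [nbeq_eq, hx]
      simp only [hb, cond_false] at h
      have hc := card_bits_strip hx
      have e : n + (bits x).card = Nat.succ n + (bits (strip x)).card := by omega
      rw [e]
      exact ih _ _ h

theorem testBit_log2' {x : ℕ} (h : x ≠ 0) : x.testBit (Nat.log2 x) = true := Nat.testBit_log2 h

theorem bits_drop {x : ℕ} (h : x ≠ 0) :
    bits (Nat.xor x (bit (Nat.log2 x))) = (bits x).erase (Nat.log2 x) := by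
  ext i
  have := testBit_log2' h
  simp only [mem_bits, testBit_nxor, testBit_bit, Finset.mem_erase]
  by_cases hi : Nat.log2 x = i
  · subst hi; simp [this]
  · simp [hi, Ne.symm hi]

/-! ### Digits -/

theorem testBit_sum_digits (w : ℕ) (d : ℕ → ℕ) (hd : ∀ i, d i < 2 ^ w) (n i r : ℕ) (hr : r < w) :
    (∑ j ∈ Finset.range n, 2 ^ (w * j) * d j).testBit (w * i + r)
      = (decide (i < n) && (d i).testBit r) := by
  induction n generalizing d i with
  | zero => simp
  | succ n ih =>
    have h : ∑ j ∈ Finset.range (n + 1), 2 ^ (w * j) * d j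
        = 2 ^ w * (∑ j ∈ Finset.range n, 2 ^ (w * j) * d (j + 1)) + d 0 := by
      rw [Finset.sum_range_succ', Finset.mul_sum]
      congr 1
      · apply Finset.sum_congr rfl
        intro j _
        rw [mul_add, pow_add]; ring
      · simp
    rw [h, Nat.testBit_two_pow_mul_add _ (hd 0)]
    cases i with
    | zero => simp [hr]
    | succ i =>
      have h1 : ¬ (w * (i + 1) + r < w) := by rw [mul_add]; omega
      have h2 : w * (i + 1) + r - w = w * i + r := by rw [mul_add]; omega
      rw [if_neg h1, h2, ih (fun j => d (j + 1)) fun j => hd _]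
      simp

/-- The number with ones exactly at the multiples `0, w, …, (n - 1) w` of `w`. -/
def comb (w n : ℕ) : ℕ := ∑ j ∈ Finset.range n, 2 ^ (w * j)

theorem testBit_comb {w n i r : ℕ} (hr : r < w) :
    (comb w n).testBit (w * i + r) = (decide (i < n) && decide (r = 0)) := by
  have := testBit_sum_digits w (fun _ => 1) (fun _ => Nat.one_lt_two_pow (by omega)) n i r hr
  simp only [mul_one] at this
  rw [comb, this]
  congr 1
  rw [Bool.eq_iff_iff, Nat.testBit_one_eq_true_iff_self_eq_zero]; simp

theorem select_eq {W S : ℕ} (hW : 2 ≤ W) (hS : S < 2 ^ (W - 1)) :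
    Nat.land (Nat.mul S (comb (W - 1) W)) (comb W W)
      = ∑ j ∈ Finset.range W, 2 ^ (W * j) * (if S.testBit j then 1 else 0) := by
  apply Nat.eq_of_testBit_eq
  intro p
  have hp : p = W * (p / W) + p % W := (Nat.div_add_mod p W).symm
  have hr : p % W < W := Nat.mod_lt _ (by omega)
  generalize p / W = i at *
  generalize p % W = r at *
  subst hp
  rw [testBit_sum_digits _ _ (fun j => by split_ifs <;> simp; omega) _ _ _ hr, testBit_nland,
    testBit_comb hr]
  by_cases hi : i < W
  swap
  · simp [hi]
  by_cases hr0 : r = 0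
  swap
  · have : ∀ b : Prop, [Decidable b] → (if b then 1 else 0 : ℕ).testBit r = false := by
      intro b _
      split_ifs
      · rw [← Bool.not_eq_true, Nat.testBit_one_eq_true_iff_self_eq_zero]; exact hr0
      · simp
    simp [hr0, this]
  subst hr0
  have e : Nat.mul S (comb (W - 1) W) = ∑ j ∈ Finset.range W, 2 ^ ((W - 1) * j) * S := by
    change S * comb (W - 1) W = _
    rw [comb, Finset.mul_sum]
    exact Finset.sum_congr rfl fun _ _ => mul_comm _ _
  have hw : W * i + 0 = (W - 1) * i + i := by
    obtain ⟨k, rfl⟩ : ∃ k, W = k + 1 := ⟨W - 1, by omega⟩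
    simp [add_mul]
  rw [e]
  simp only [hi, decide_true, Bool.true_and, Bool.and_true]
  rcases Nat.lt_or_ge i (W - 1) with h | h
  · rw [hw, testBit_sum_digits _ _ (fun _ => hS) _ _ _ h]
    cases S.testBit i <;> simp [hi]
  · have hi' : i = W - 1 := by omega
    have hw' : W * i + 0 = (W - 1) * W + 0 := by rw [hi', mul_comm]
    rw [hw', testBit_sum_digits _ _ (fun _ => hS) _ _ _ (by omega)]
    have : S.testBit i = false := Nat.testBit_lt_two_pow (by rw [hi']; exact hS)
    simp [this]

/-! ### Balls -/

/-- The points which can be reached from `S` in at most `r` steps along `R` through points with the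
property `p`. -/
def Reach {α : Type*} (R : α → α → Prop) (p : α → Prop) (S : Set α) : ℕ → Set α
  | 0 => S
  | r + 1 => Reach R p S r ∪ {b | p b ∧ ∃ a ∈ Reach R p S r, R a b}

theorem Reach.mono_radius {α : Type*} {R : α → α → Prop} {p : α → Prop} {S : Set α} {r s : ℕ}
    (h : r ≤ s) : Reach R p S r ⊆ Reach R p S s := by
  induction h with
  | refl => exact subset_rfl
  | step _ ih => exact ih.trans Set.subset_union_left

theorem Reach.subset_of_closed {α : Type*} {R : α → α → Prop} {p : α → Prop} {S L : Set α}
    (hS : S ⊆ L) (hL : ∀ a b, R a b → b ∈ L) (r : ℕ) : Reach R p S r ⊆ L := by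
  induction r with
  | zero => exact hS
  | succ r ih =>
    rintro b (hb | ⟨-, a, -, hab⟩)
    exacts [ih hb, hL _ _ hab]

theorem Reach.mono_set {α : Type*} {R : α → α → Prop} {p : α → Prop} {S S' : Set α}
    (h : S ⊆ S') (r : ℕ) : Reach R p S r ⊆ Reach R p S' r := by
  induction r with
  | zero => exact h
  | succ r ih =>
    rintro b (hb | ⟨h1, a, ha, hab⟩)
    exacts [Or.inl (ih hb), Or.inr ⟨h1, a, ih ha, hab⟩]

theorem Reach.map {α β : Type*} {R : α → α → Prop} {R' : β → β → Prop} {p : α → Prop}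
    {p' : β → Prop} {f : α → β} (hR : ∀ a b, R a b → R' (f a) (f b))
    (hp : ∀ a b, R a b → p b → p' (f b)) {S : Set α} {r : ℕ} {a : α} (ha : a ∈ Reach R p S r) :
    f a ∈ Reach R' p' (f '' S) r := by
  induction r generalizing a with
  | zero => exact ⟨a, ha, rfl⟩
  | succ r ih =>
    rcases ha with ha | ⟨h1, b, hb, hba⟩
    · exact Or.inl (ih ha)
    · exact Or.inr ⟨hp _ _ hba h1, f b, ih hb, hR _ _ hba⟩

theorem Reach.image_eq {α β : Type*} {R : α → α → Prop} {R' : β → β → Prop}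
    {f : α → β} (hR : ∀ a b, R a b → R' (f a) (f b)) {S : Set α} {r : ℕ}
    (hfull : ∀ i < r, ∀ a ∈ Reach R (fun _ => True) S i, ∀ y, R' (f a) y → ∃ b, R a b ∧ f b = y) :
    f '' Reach R (fun _ => True) S r = Reach R' (fun _ => True) (f '' S) r := by
  induction r with
  | zero => rfl
  | succ r ih =>
    apply subset_antisymm
    · rintro _ ⟨a, ha, rfl⟩
      exact Reach.map hR (fun _ _ _ h => h) ha
    · have ih' := ih fun i hi => hfull i (by omega)
      rintro y (hy | ⟨-, z, hz, hzy⟩)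
      · rw [← ih'] at hy
        exact Set.image_mono Set.subset_union_left hy
      · rw [← ih'] at hz
        obtain ⟨a, ha, rfl⟩ := hz
        obtain ⟨b, hb, rfl⟩ := hfull r (by omega) a ha y hzy
        exact ⟨b, Or.inr ⟨trivial, a, ha, hb⟩, rfl⟩

theorem Reach.congr_prop {α : Type*} {R : α → α → Prop} {p q : α → Prop}
    (h : ∀ a b, R a b → (p b ↔ q b)) (S : Set α) (r : ℕ) : Reach R p S r = Reach R q S r := by
  induction r with
  | zero => rfl
  | succ r ih =>
    ext b
    simp only [Reach, ih, Set.mem_union, Set.mem_ofPred_eq]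
    constructor
    · rintro (hb | ⟨h1, a, h2, h3⟩)
      exacts [Or.inl hb, Or.inr ⟨(h a b h3).1 h1, a, h2, h3⟩]
    · rintro (hb | ⟨h1, a, h2, h3⟩)
      exacts [Or.inl hb, Or.inr ⟨(h a b h3).2 h1, a, h2, h3⟩]

theorem Reach.singleton_subset {α : Type*} {R : α → α → Prop} {a b : α} (hab : R a b) (r : ℕ) :
    Reach R (fun _ => True) {b} r ⊆ Reach R (fun _ => True) {a} (r + 1) := by
  induction r with
  | zero => rintro _ rfl; exact Or.inr ⟨trivial, a, rfl, hab⟩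
  | succ r ih =>
    rintro y (hy | ⟨-, z, hz, hzy⟩)
    · exact Or.inl (ih hy)
    · exact Or.inr ⟨trivial, z, ih hz, hzy⟩

namespace Cfg

/-- The consistency conditions for the parameters which do not depend on the graph. -/
structure Wf (c : Cfg) : Prop where
  two_le : 2 ≤ c.W
  le_128 : c.W ≤ 128
  C1_eq : c.C1 = comb (c.W - 1) c.W
  ONE_eq : c.ONE = comb c.W c.W
  FM_eq : c.FM = 2 ^ c.W - 1
  m_pos : 0 < c.m
  m_lt : c.m < c.W
  nt_le : c.nt ≤ 16
  can_lt : ∀ t < c.nt, ∀ i < c.m, c.can t i < c.m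
  can_can : ∀ t < c.nt, ∀ i < c.m, c.can t (c.can t i) = c.can t i
  can_zero : ∀ t < c.nt, c.can t 0 = 0
  cm_lt : ∀ t < c.nt, c.cm t < 2 ^ c.m
  cm_eq : ∀ t < c.nt, ∀ i < c.m, (c.cm t).testBit i = decide (c.can t i = i)
  sz_eq : ∀ t < c.nt, c.sz t = ((Finset.range c.m).filter fun i => c.can t i = i).card
  mul_lt : ∀ i < c.m, ∀ j < c.m, c.mul i j < c.m
  inv : ∀ i < c.m, ∃ j < c.m, c.mul j i = 0
  stab : ∀ t < c.nt, t ≠ 0 → ∃ i < c.m, i ≠ 0 ∧ c.can t i = 0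

/-- The relation stored in the matrix `T`. -/
def E (c : Cfg) (T a b : ℕ) : Prop := b < c.W ∧ T.testBit (64 + (c.W * a + b)) = true

variable {c : Cfg}

theorem Wf.testBit_FM (hc : c.Wf) (i : ℕ) : c.FM.testBit i = decide (i < c.W) := by
  rw [hc.FM_eq, Nat.testBit_two_pow_sub_one]

theorem Wf.testBit_row (hc : c.Wf) (T a b : ℕ) : (c.row T a).testBit b = true ↔ c.E T a b := by
  simp [row, hc.testBit_FM, E, add_assoc]

theorem Wf.testBit_avoid (hc : c.Wf) {v : ℕ} (hv : v < c.W) (i : ℕ) :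
    (c.avoid v).testBit i = true → i ≠ v := by
  rintro h rfl
  rw [avoid, testBit_nxor, hc.testBit_FM, testBit_bit] at h
  simp [hv] at h

theorem orsh_double {X y n W : ℕ}
    (h : ∀ p, y.testBit p = true ↔ ∃ j < n, X.testBit (W * j + p) = true) (p : ℕ) :
    (orsh y (W * n)).testBit p = true ↔ ∃ j < 2 * n, X.testBit (W * j + p) = true := by
  rw [testBit_orsh, Bool.or_eq_true, h, h]
  constructor
  · rintro (⟨j, hj, hx⟩ | ⟨j, hj, hx⟩)
    · exact ⟨j, by omega, hx⟩
    · refine ⟨n + j, by omega, ?_⟩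
      rw [← hx]; congr 1; ring
  · rintro ⟨j, hj, hx⟩
    rcases Nat.lt_or_ge j n with h | h
    · exact Or.inl ⟨j, h, hx⟩
    · refine Or.inr ⟨j - n, by omega, ?_⟩
      rw [← hx]; congr 1
      obtain ⟨k, rfl⟩ := Nat.exists_eq_add_of_le h
      rw [Nat.add_sub_cancel_left]; ring

theorem Wf.testBit_nb (hc : c.Wf) {T S : ℕ} (hS : S < 2 ^ (c.W - 1)) (b : ℕ) :
    (c.nb T S).testBit b = true ↔ ∃ a, S.testBit a = true ∧ c.E T a b := by
  unfold nb
  rw [hc.C1_eq, hc.ONE_eq, select_eq hc.two_le hS]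
  set X := Nat.land (Nat.shiftRight T 64) (Nat.mul (∑ j ∈ Finset.range c.W,
    2 ^ (c.W * j) * (if S.testBit j then 1 else 0)) c.FM) with hX
  have hW := hc.two_le
  have hXb : ∀ j b, b < c.W → (X.testBit (c.W * j + b) = true ↔
      j < c.W ∧ S.testBit j = true ∧ c.E T j b) := by
    intro j b hb
    have e : Nat.mul (∑ j ∈ Finset.range c.W,
        2 ^ (c.W * j) * (if S.testBit j then 1 else 0)) c.FM = ∑ j ∈ Finset.range c.W,
        2 ^ (c.W * j) * (if S.testBit j then c.FM else 0) := by
      change (∑ j ∈ Finset.range c.W, _) * c.FM = _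
      rw [Finset.sum_mul]
      apply Finset.sum_congr rfl
      intro j _
      split_ifs <;> simp
    rw [hX, testBit_nland, testBit_nshiftRight, e, testBit_sum_digits _ _ _ _ _ _ hb]
    · cases hs : S.testBit j <;> simp [hc.testBit_FM, hb, E]
      tauto
    · intro i
      have : 0 < 2 ^ c.W := by positivity
      have := hc.FM_eq
      split_ifs <;> omega
  have h1 : ∀ p, X.testBit p = true ↔ ∃ j < 1, X.testBit (c.W * j + p) = true := by simp
  have h2 := orsh_double h1
  rw [mul_one] at h2
  have h := orsh_double (orsh_double (orsh_double (orsh_double (orsh_double (orsh_double h2)))))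
  norm_num only at h
  rw [testBit_nland, hc.testBit_FM, Bool.and_eq_true, decide_eq_true_iff]
  constructor
  · rintro ⟨hb, hx⟩
    obtain ⟨j, -, hj⟩ := (h b).1 hx
    obtain ⟨-, h2, h3⟩ := (hXb j b hb).1 hj
    exact ⟨j, h2, h3⟩
  · rintro ⟨a, ha, hE⟩
    have hlt : a < c.W - 1 := by
      by_contra hcon
      have := Nat.testBit_lt_two_pow (hS.trans_le (Nat.pow_le_pow_right (by norm_num)
        (not_lt.1 hcon)))
      simp [this] at ha
    have := hc.le_128
    exact ⟨hE.1, (h b).2 ⟨a, by omega, (hXb a b hE.1).2 ⟨by omega, ha, hE⟩⟩⟩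

theorem lt_two_pow_of_bits {S n : ℕ} (h : ∀ a, S.testBit a = true → a < n) : S < 2 ^ n := by
  apply Nat.lt_pow_two_of_testBit
  intro i hi
  by_contra hcon
  have := h i (by simpa using hcon)
  omega

/-- `T` only relates labels which are smaller than `W - 1`. -/
def Small (c : Cfg) (T : ℕ) : Prop := ∀ a b, c.E T a b → b < c.W - 1

theorem Wf.testBit_ball (hc : c.Wf) {M T S : ℕ} (hT : c.Small T)
    (hS : ∀ a, S.testBit a = true → a < c.W - 1) (r : ℕ) (b : ℕ) :
    (c.ball M T r S).testBit b = true ↔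
      b ∈ Reach (c.E T) (fun b => M.testBit b = true) {a | S.testBit a = true} r := by
  induction r generalizing b with
  | zero => rfl
  | succ r ih =>
    have e : c.ball M T (r + 1) S = c.step M T (c.ball M T r S) := rfl
    have hlt : c.ball M T r S < 2 ^ (c.W - 1) := by
      apply lt_two_pow_of_bits
      intro a ha
      exact Reach.subset_of_closed (L := {a | a < c.W - 1}) (fun a ha => hS a ha) hT r ((ih a).1 ha)
    rw [e, step, testBit_nlor, testBit_nland, Bool.or_eq_true, Bool.and_eq_true,
      hc.testBit_nb hlt, Reach, Set.mem_union, ih]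
    simp only [Set.mem_ofPred_eq, ih]
    tauto

theorem Wf.testBit_ball_FM (hc : c.Wf) {T S : ℕ} (hT : c.Small T)
    (hS : ∀ a, S.testBit a = true → a < c.W - 1) (r : ℕ) (b : ℕ) :
    (c.ball c.FM T r S).testBit b = true ↔
      b ∈ Reach (c.E T) (fun _ => True) {a | S.testBit a = true} r := by
  rw [hc.testBit_ball hT hS, Reach.congr_prop]
  intro a b h
  simp [hc.testBit_FM, h.1]

theorem testBit_fullm (T a : ℕ) :
    (c.fullm T).testBit a = true → pop3 (c.row T a) = true := by
  unfold fullm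
  generalize c.W = n
  induction n with
  | zero => simp
  | succ n ih =>
    intro h
    simp only at h
    cases hp : pop3 (c.row T n)
    · rw [hp, cond_false] at h; exact ih h
    · rw [hp, cond_true, testBit_nlor, testBit_bit, Bool.or_eq_true, decide_eq_true_iff] at h
      rcases h with h | rfl
      exacts [ih h, hp]

end Cfg

variable {V : Type*}

/-- The size of the intersection of two balls of radius `R`. -/
noncomputable def inter (G : SimpleGraph V) (R : ℕ) (x y : V) : ℕ :=
  (Reach G.Adj (fun _ => True) {x} R ∩ Reach G.Adj (fun _ => True) {y} R).ncard

namespace Cfg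

/-- The graphs which are looked for in a search. -/
structure Target (c : Cfg) (G : SimpleGraph V) (side : V → Bool) (ρ : ℕ → G ≃g G) (n : ℕ) :
    Prop where
  finite : Finite V
  cubic : ∀ v, (G.neighborSet v).ncard = 3
  adj_side : ∀ v w, G.Adj v w → side w = !side v
  side_aut : ∀ (φ : G ≃g G) v, side (φ v) = side v
  conn : G.Preconnected
  rho_zero : ∀ v, ρ 0 v = v
  rho_mul : ∀ i < c.m, ∀ j < c.m, ∀ v, ρ i (ρ j v) = ρ (c.mul i j) v
  types : ∀ v, ∃ t < c.nt, ∀ i < c.m, ∀ j < c.m, ρ i v = ρ j v ↔ c.can t i = c.can t j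
  rigid : ∀ i < c.m, ∀ v w, G.Adj v w → ρ i v = v → ρ i w = w → i = 0
  girth : ∀ v l, G.Adj v l → l ∉ Reach G.Adj (fun w => w ≠ v) {s | G.Adj v s ∧ s ≠ l} c.G4
  card_side : ∀ b, {v | side v = b}.ncard = n
  lo_le : c.lo ≤ n
  le_hi : n ≤ c.hi
  hom : ∀ R u u' x y x' y', side u = side u' → G.Adj u x → G.Adj u y → x ≠ y →
    G.Adj u' x' → G.Adj u' y' → x' ≠ y' → inter G R x y = inter G R x' y'
  plo : c.PR ≠ 0 → ∀ u x y, G.Adj u x → G.Adj u y → x ≠ y → c.PLO ≤ inter G c.PR x y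

/-- `f` embeds the partial graph with labels `L` and matrix `T` into `G`. -/
structure Emb (c : Cfg) (G : SimpleGraph V) (T : ℕ) (L : Set ℕ) (f : ℕ → V) : Prop where
  lt : ∀ a ∈ L, a < c.W - 1
  inj : Set.InjOn f L
  left_mem : ∀ a b, c.E T a b → a ∈ L
  mem : ∀ a b, c.E T a b → b ∈ L
  adj : ∀ a b, c.E T a b → G.Adj (f a) (f b)
  symm : ∀ a b, c.E T a b → c.E T b a

variable {c : Cfg} {G : SimpleGraph V} {T : ℕ} {L : Set ℕ} {f : ℕ → V}

theorem Emb.small (h : c.Emb G T L f) : c.Small T := fun a b hab => h.lt b (h.mem a b hab)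

theorem Emb.injOn_row (h : c.Emb G T L f) (hc : c.Wf) (a : ℕ) :
    Set.InjOn f (bits (c.row T a) : Set ℕ) := by
  refine h.inj.mono fun b hb => ?_
  rw [Finset.mem_coe, mem_bits, hc.testBit_row] at hb
  exact h.mem a b hb

theorem Emb.image_row_subset (h : c.Emb G T L f) (hc : c.Wf) (a : ℕ) :
    f '' (bits (c.row T a) : Set ℕ) ⊆ G.neighborSet (f a) := by
  rintro _ ⟨b, hb, rfl⟩
  rw [Finset.mem_coe, mem_bits, hc.testBit_row] at hb
  exact h.adj a b hb

theorem Emb.ncard_image_row (h : c.Emb G T L f) (hc : c.Wf) (a : ℕ) :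
    (f '' (bits (c.row T a) : Set ℕ)).ncard = (bits (c.row T a)).card := by
  rw [(h.injOn_row hc a).ncard_image, Set.ncard_coe_finset]

theorem Emb.full (h : c.Emb G T L f) (hc : c.Wf) (hcub : ∀ v, (G.neighborSet v).ncard = 3)
    {a : ℕ} (ha : pop3 (c.row T a) = true) {y : V} (hy : G.Adj (f a) y) :
    ∃ b, c.E T a b ∧ f b = y := by
  have hfin : (G.neighborSet (f a)).Finite := Set.finite_of_ncard_pos (by rw [hcub]; norm_num)
  have heq := Set.eq_of_subset_of_ncard_le (h.image_row_subset hc a)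
    (by rw [h.ncard_image_row hc, hcub]; exact (pop3_iff _).1 ha) hfin
  have : y ∈ f '' (bits (c.row T a) : Set ℕ) := heq ▸ hy
  obtain ⟨b, hb, rfl⟩ := this
  rw [Finset.mem_coe, mem_bits, hc.testBit_row] at hb
  exact ⟨b, hb, rfl⟩

theorem Emb.card_row_le (h : c.Emb G T L f) (hc : c.Wf)
    (hcub : ∀ v, (G.neighborSet v).ncard = 3) (a : ℕ) : (bits (c.row T a)).card ≤ 3 := by
  have hfin : (G.neighborSet (f a)).Finite := Set.finite_of_ncard_pos (by rw [hcub]; norm_num)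
  rw [← h.ncard_image_row hc, ← hcub (f a)]
  exact Set.ncard_le_ncard (h.image_row_subset hc a) hfin

theorem Emb.exists_new (h : c.Emb G T L f) (hc : c.Wf) (hcub : ∀ v, (G.neighborSet v).ncard = 3)
    {a : ℕ} (ha : pop3 (c.row T a) ≠ true) :
    ∃ y, G.Adj (f a) y ∧ ∀ b, c.E T a b → f b ≠ y := by
  by_contra! hcon
  apply ha
  rw [pop3_iff, ← h.ncard_image_row hc, ← hcub (f a)]
  apply Set.ncard_le_ncard _ (Set.toFinite _)
  intro y hy
  obtain ⟨b, hb, rfl⟩ := hcon y hy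
  exact ⟨b, by rw [Finset.mem_coe, mem_bits, hc.testBit_row]; exact hb, rfl⟩

theorem Emb.card_ball_inter (h : c.Emb G T L f) (hc : c.Wf)
    (hcub : ∀ v, (G.neighborSet v).ncard = 3) {R x y : ℕ} (hx : x ∈ L) (hy : y ∈ L)
    (hfx : ∀ i < R, ∀ a ∈ Reach (c.E T) (fun _ => True) {x} i, pop3 (c.row T a) = true)
    (hfy : ∀ i < R, ∀ a ∈ Reach (c.E T) (fun _ => True) {y} i, pop3 (c.row T a) = true) :
    (bits (Nat.land (c.ball c.FM T R (bit x)) (c.ball c.FM T R (bit y)))).card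
      = inter G R (f x) (f y) := by
  have hs : ∀ z ∈ L, (∀ i < R, ∀ a ∈ Reach (c.E T) (fun _ => True) {z} i,
      pop3 (c.row T a) = true) → (∀ b, (c.ball c.FM T R (bit z)).testBit b = true ↔
        b ∈ Reach (c.E T) (fun _ => True) {z} R) ∧
      f '' Reach (c.E T) (fun _ => True) {z} R = Reach G.Adj (fun _ => True) {f z} R ∧
      Reach (c.E T) (fun _ => True) {z} R ⊆ L := by
    intro z hz hf
    refine ⟨fun b => ?_, ?_, ?_⟩
    · rw [hc.testBit_ball_FM h.small]
      · have : {a | (bit z).testBit a = true} = {z} := by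
          ext a; simp [eq_comm]
        rw [this]
      · intro a ha
        rw [testBit_bit, decide_eq_true_iff] at ha
        exact ha ▸ h.lt z hz
    · rw [Reach.image_eq h.adj fun i hi a ha y hy => h.full hc hcub (hf i hi a ha) hy,
        Set.image_singleton]
    · exact Reach.subset_of_closed (by simpa using hz) h.mem R
  obtain ⟨hx1, hx2, hx3⟩ := hs x hx hfx
  obtain ⟨hy1, hy2, hy3⟩ := hs y hy hfy
  rw [inter, ← hx2, ← hy2, ← h.inj.image_inter hx3 hy3,
    (h.inj.mono (Set.inter_subset_left.trans hx3)).ncard_image, ← Set.ncard_coe_finset]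
  congr 1
  ext b
  simp [hx1, hy1]

theorem Emb.pairs_spec (h : c.Emb G T L f) (hc : c.Wf)
    (hcub : ∀ v, (G.neighborSet v).ncard = 3) {R v : ℕ} (hv : pop3 (c.row T v) = true)
    (hf : ∀ b, c.E T v b → ∀ i < R, ∀ a ∈ Reach (c.E T) (fun _ => True) {b} i,
      pop3 (c.row T a) = true) :
    ∃ x y z p q s, G.Adj (f v) x ∧ G.Adj (f v) y ∧ G.Adj (f v) z ∧ x ≠ y ∧ x ≠ z ∧ y ≠ z ∧
      (∀ k, c.pairs T R v k = k p q s) ∧ (bits p).card = inter G R x y ∧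
      (bits q).card = inter G R x z ∧ (bits s).card = inter G R y z := by
  have hcard := (pop3_iff _).1 hv
  have hr0 : c.row T v ≠ 0 := by
    intro h0; rw [h0] at hcard; simp [bits] at hcard
  have h1 := bits_drop hr0
  have m1 : Nat.log2 (c.row T v) ∈ bits (c.row T v) := mem_bits.2 (testBit_log2' hr0)
  set x := Nat.log2 (c.row T v) with hx
  set r1 := Nat.xor (c.row T v) (bit x) with hr1
  have c1 := Finset.card_erase_add_one m1
  rw [← h1] at c1
  have hr10 : r1 ≠ 0 := by
    intro h0; rw [h0] at c1; simp [bits] at c1 hcard; omega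
  have h2 := bits_drop hr10
  have m2 : Nat.log2 r1 ∈ bits r1 := mem_bits.2 (testBit_log2' hr10)
  set y := Nat.log2 r1 with hy
  set r2 := Nat.xor r1 (bit y) with hr2
  have c2 := Finset.card_erase_add_one m2
  rw [← h2] at c2
  have hr20 : r2 ≠ 0 := by
    intro h0; rw [h0] at c2; simp [bits] at c2 c1 hcard; omega
  have m3 : Nat.log2 r2 ∈ bits r2 := mem_bits.2 (testBit_log2' hr20)
  set z := Nat.log2 r2 with hz
  rw [h2, Finset.mem_erase] at m3
  have m3' := m3.2
  rw [h1, Finset.mem_erase] at m2 m3'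
  have ex : c.E T v x := (hc.testBit_row T v x).1 (mem_bits.1 m1)
  have ey : c.E T v y := (hc.testBit_row T v y).1 (mem_bits.1 m2.2)
  have ez : c.E T v z := (hc.testBit_row T v z).1 (mem_bits.1 m3'.2)
  have lx := h.mem _ _ ex
  have ly := h.mem _ _ ey
  have lz := h.mem _ _ ez
  refine ⟨f x, f y, f z, _, _, _, h.adj _ _ ex, h.adj _ _ ey, h.adj _ _ ez,
    fun e => m2.1 (h.inj lx ly e).symm, fun e => m3'.1 (h.inj lx lz e).symm,
    fun e => m3.1 (h.inj ly lz e).symm, fun k => ?_,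
    h.card_ball_inter hc hcub lx ly (hf x ex) (hf y ey),
    h.card_ball_inter hc hcub lx lz (hf x ex) (hf z ez),
    h.card_ball_inter hc hcub ly lz (hf y ey) (hf z ez)⟩
  simp only [pairs, frc_eq]
  rfl

section target
variable {side : V → Bool} {ρ : ℕ → G ≃g G} {n : ℕ}

theorem Emb.pairBad_false (h : c.Emb G T L f) (hc : c.Wf) (ht : c.Target G side ρ n)
    (hPR : c.PR ≠ 0) {v : ℕ}
    (hf : ∀ a ∈ Reach (c.E T) (fun _ => True) {v} c.PR, pop3 (c.row T a) = true) :
    c.pairBad T v = false := by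
  obtain ⟨x, y, z, p, q, s, hx, hy, hz, hxy, hxz, hyz, hk, hp, hq, hs⟩ :=
    h.pairs_spec hc ht.cubic (R := c.PR) (v := v)
      (hf v (Reach.mono_radius (Nat.zero_le _) rfl))
      (fun b hb i hi a ha => hf a (Reach.mono_radius (show i + 1 ≤ c.PR by omega)
        (Reach.singleton_subset hb i ha)))
  rw [pairBad, hk, (pge_iff _ _).2 (hp ▸ ht.plo hPR _ _ _ hx hy hxy),
    (pge_iff _ _).2 (hq ▸ ht.plo hPR _ _ _ hx hz hxz),
    (pge_iff _ _).2 (hs ▸ ht.plo hPR _ _ _ hy hz hyz)]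
  rfl

theorem Emb.pruneL_false (h : c.Emb G T L f) (hc : c.Wf) (ht : c.Target G side ρ n)
    (hPR : c.PR ≠ 0) {F : ℕ} (hF : ∀ a, F.testBit a = true → pop3 (c.row T a) = true) {S : ℕ}
    (hS : ∀ a, S.testBit a = true → a ∈ L) : c.pruneL T F S = false := by
  unfold pruneL
  generalize 32 = fuel
  induction fuel generalizing S with
  | zero => rfl
  | succ fuel ih =>
    simp only [frc_eq]
    by_cases hS0 : S = 0
    · subst hS0; rfl
    have hb : Nat.beq S 0 = false := by simp [nbeq_eq, hS0]
    rw [hb, cond_false]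
    have hu := testBit_log2' hS0
    set u := Nat.log2 S
    have hrec := ih (S := Nat.xor S (bit u)) (fun a ha => by
      have : a ∈ bits (Nat.xor S (bit (Nat.log2 S))) := mem_bits.2 ha
      rw [bits_drop hS0, Finset.mem_erase] at this
      exact hS a (mem_bits.1 this.2))
    simp only [frc_eq] at hrec
    rw [hrec]
    cases hball : Nat.beq 0 (andNot (c.ball c.FM T c.PR (bit u)) F)
    · rfl
    rw [cond_true, h.pairBad_false hc ht hPR, cond_false]
    intro a ha
    apply hF
    refine (nland_eq_zero_iff _ _).1 hball a ?_
    have : {a | (bit u).testBit a = true} = {u} := by ext a; simp [eq_comm]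
    rw [hc.testBit_ball_FM h.small, this]
    · exact ha
    · intro b hb
      rw [testBit_bit, decide_eq_true_iff] at hb
      exact hb ▸ h.lt u (hS u hu)

theorem Emb.prune_false (h : c.Emb G T L f) (hc : c.Wf) (ht : c.Target G side ρ n) {v l : ℕ}
    (hv : v ∈ L) (hl : l ∈ L) : c.prune T v l = false := by
  unfold prune
  by_cases hPR : c.PR = 0
  · rw [hPR]; rfl
  have hb : Nat.beq c.PR 0 = false := by simp [nbeq_eq, hPR]
  rw [hb, cond_false, frc_eq, frc_eq, h.pruneL_false hc ht hPR (testBit_fullm T)]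
  · cases (bif pop3 (c.row T v) then true else pop3 (c.row T l)) <;> rfl
  · intro a ha
    have hsub : ∀ b, (Nat.lor (bit v) (bit l)).testBit b = true → b ∈ L := by
      intro b hb
      simp only [testBit_nlor, testBit_bit, Bool.or_eq_true, decide_eq_true_iff] at hb
      rcases hb with rfl | rfl <;> assumption
    rw [hc.testBit_ball_FM h.small fun b hb => h.lt b (hsub b hb)] at ha
    exact Reach.subset_of_closed hsub h.mem _ ha

theorem Emb.inhom_false (h : c.Emb G T L f) (hc : c.Wf) (ht : c.Target G side ρ n)
    (hfull : ∀ a ∈ L, pop3 (c.row T a) = true) {LU k : ℕ}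
    (hk : ∀ o < k, c.m * o ∈ L ∧ LU.testBit (c.m * o) = side (f (c.m * o))) (ru rw : ℕ)
    (hru : ru = 0 ∨ ∀ u x y, side u = true → G.Adj u x → G.Adj u y → x ≠ y →
      ru = inter G c.LR x y + 1)
    (hrw : rw = 0 ∨ ∀ u x y, side u = false → G.Adj u x → G.Adj u y → x ≠ y →
      rw = inter G c.LR x y + 1) : c.inhom T LU k ru rw ≠ true := by
  induction k generalizing ru rw with
  | zero => simp [inhom]
  | succ k ih =>
    obtain ⟨hkL, hkU⟩ := hk k (by omega)
    obtain ⟨x, y, z, p, q, s, hx, hy, hz, hxy, hxz, hyz, hpk, hp, hq, hs⟩ :=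
      h.pairs_spec hc ht.cubic (R := c.LR) (v := c.m * k) (hfull _ hkL)
        (fun b hb i _ a ha => hfull a (Reach.subset_of_closed
          (by simpa using h.mem _ _ hb) h.mem i ha))
    have e : c.inhom T LU (k + 1) ru rw = pc p fun p' => pc q fun pb => pc s fun pd =>
      cond (Nat.beq (Nat.succ p') (Nat.succ pb))
      (cond (Nat.beq (Nat.succ p') (Nat.succ pd))
       (cond (tb LU (c.m * k))
        (cond (Nat.beq ru 0) (c.inhom T LU k (Nat.succ p') rw)
          (cond (Nat.beq ru (Nat.succ p')) (c.inhom T LU k ru rw) true))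
        (cond (Nat.beq rw 0) (c.inhom T LU k ru (Nat.succ p'))
          (cond (Nat.beq rw (Nat.succ p')) (c.inhom T LU k ru rw) true)))
       true) true := by
      exact Eq.trans (by simp only [inhom, frc_eq]; rfl) (hpk fun p q s => pc p fun p' =>
        pc q fun pb => pc s fun pd => cond (Nat.beq (Nat.succ p') (Nat.succ pb))
        (cond (Nat.beq (Nat.succ p') (Nat.succ pd))
         (cond (tb LU (c.m * k))
          (cond (Nat.beq ru 0) (c.inhom T LU k (Nat.succ p') rw)
            (cond (Nat.beq ru (Nat.succ p')) (c.inhom T LU k ru rw) true))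
          (cond (Nat.beq rw 0) (c.inhom T LU k ru (Nat.succ p'))
            (cond (Nat.beq rw (Nat.succ p')) (c.inhom T LU k ru rw) true)))
         true) true)
    rw [e]
    intro hcon
    have hcon := pc_sound _ _ (pc_sound _ _ (pc_sound _ _ hcon))
    have hpq : (bits p).card = (bits q).card := by
      rw [hp, hq]; exact ht.hom _ _ _ _ _ _ _ rfl hx hy hxy hx hz hxz
    have hps : (bits p).card = (bits s).card := by
      rw [hp, hs]; exact ht.hom _ _ _ _ _ _ _ rfl hx hy hxy hy hz hyz
    have href : ∀ u x' y', side u = side (f (c.m * k)) → G.Adj u x' → G.Adj u y' → x' ≠ y' →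
        (bits p).card.succ = inter G c.LR x' y' + 1 := by
      intro u x' y' hu h1 h2 h3
      rw [hp, ht.hom _ _ _ _ _ _ _ hu.symm hx hy hxy h1 h2 h3]
    have ih := fun ru rw h1 h2 => ih (fun o ho => hk o (by omega)) ru rw h1 h2
    simp only [nbeq_eq, ← hpq, ← hps, decide_true, cond_true, tb_eq, hkU] at hcon
    cases hsd : side (f (c.m * k))
    · rw [hsd] at hcon href
      simp only [cond_false] at hcon
      rcases hrw with rfl | hrw
      · exact ih _ _ hru (Or.inr href) hcon
      · have e : rw = (bits p).card.succ := by rw [hrw _ _ _ hsd hx hy hxy, hp]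
        subst e
        simp only [decide_true, cond_true, Nat.succ_ne_zero, decide_false, cond_false] at hcon
        exact ih _ _ hru (Or.inr href) hcon
    · rw [hsd] at hcon href
      simp only [cond_true] at hcon
      rcases hru with rfl | hru
      · exact ih _ _ (Or.inr href) hrw hcon
      · have e : ru = (bits p).card.succ := by rw [hru _ _ _ hsd hx hy hxy, hp]
        subst e
        simp only [decide_true, cond_true, Nat.succ_ne_zero, decide_false, cond_false] at hcon
        exact ih _ _ (Or.inr href) hrw hcon

end target
end Cfg
variable {V : Type*}
namespace Cfg
variable {c : Cfg} {G : SimpleGraph V} {T : ℕ} {L : Set ℕ} {f : ℕ → V} {side : V → Bool}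
  {ρ : ℕ → G ≃g G} {n : ℕ}

theorem swapOK_spec {T LU LW P : ℕ} (h : c.swapOK T LU LW P = true) (a : ℕ)
    (ha : (Nat.lor LU LW).testBit a = true) :
    pim P (pim P a) = a ∧ (bif LU.testBit a then LW else LU).testBit (pim P a) = true ∧
      c.row T (pim P a) = rowim P (c.row T a) := by
  unfold swapOK at h
  revert h ha
  generalize Nat.lor LU LW = S
  generalize 128 = fuel
  intro h ha
  induction fuel generalizing S with
  | zero => cases h
  | succ fuel ih =>
    have hS0 : S ≠ 0 := by rintro rfl; simp at ha
    simp only [frc_eq, nbeq_eq, tb_eq, hS0, decide_false, cond_false] at h ih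
    generalize e1 : decide (pim P (pim P (Nat.log2 S)) = Nat.log2 S) = b1 at h
    cases b1
    · cases h
    generalize e2 : (bif LU.testBit (Nat.log2 S) then LW else LU).testBit (pim P (Nat.log2 S)) = b2
      at h
    cases b2
    · cases h
    generalize e3 : decide (c.row T (pim P (Nat.log2 S)) = rowim P (c.row T (Nat.log2 S))) = b3 at h
    cases b3
    · cases h
    simp only [cond_true] at h
    by_cases e : a = Nat.log2 S
    · rw [decide_eq_true_iff] at e1 e3
      rw [e]
      exact ⟨e1, e2, e3⟩
    · apply ih _ h
      have : a ∈ bits (Nat.xor S (bit (Nat.log2 S))) := by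
        rw [bits_drop hS0, Finset.mem_erase]
        exact ⟨e, mem_bits.2 ha⟩
      exact mem_bits.1 this

theorem card_bits_drop {r b : ℕ} (hb : r.testBit b = true) (hne : b ≠ Nat.log2 r) :
    (drop r).testBit b = true ∧ (bits (drop r)).card + 1 = (bits r).card := by
  have hr0 : r ≠ 0 := by rintro rfl; simp at hb
  have hd := bits_drop hr0
  refine ⟨?_, ?_⟩
  · rw [← mem_bits, drop, hd, Finset.mem_erase]
    exact ⟨hne, mem_bits.2 hb⟩
  · rw [drop, hd]
    exact Finset.card_erase_add_one (mem_bits.2 (testBit_log2' hr0))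

theorem testBit_rowim {P r b : ℕ} (hr : (bits r).card ≤ 3) (hb : r.testBit b = true) :
    (rowim P r).testBit (pim P b) = true := by
  by_contra hcon
  simp only [rowim, testBit_nlor, testBit_bit, Bool.or_eq_true, decide_eq_true_iff, not_or] at hcon
  obtain ⟨h1, h2, h3⟩ := hcon
  obtain ⟨b1, c1⟩ := card_bits_drop hb fun e => h1 (e ▸ rfl)
  obtain ⟨b2, c2⟩ := card_bits_drop b1 fun e => h2 (e ▸ rfl)
  obtain ⟨b3, c3⟩ := card_bits_drop b2 fun e => h3 (e ▸ rfl)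
  have := Finset.card_pos.2 ⟨b, mem_bits.2 b3⟩
  omega

theorem Emb.swapOK_false (h : c.Emb G T L f) (hc : c.Wf) (ht : c.Target G side ρ n)
    (hfull : ∀ a ∈ L, pop3 (c.row T a) = true) {LU LW P : ℕ}
    (hL : ∀ a, a ∈ L ↔ LU.testBit a = true ∨ LW.testBit a = true)
    (hU : ∀ a, LU.testBit a = true → side (f a) = true)
    (hW : ∀ a, LW.testBit a = true → side (f a) = false)
    (hne : L.Nonempty) (hsurj : ∀ v, ∃ a ∈ L, f a = v) : c.swapOK T LU LW P ≠ true := by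
  intro hs
  have hs := swapOK_spec hs
  simp only [testBit_nlor, Bool.or_eq_true, ← hL] at hs
  choose g hgL hg using hsurj
  have hgf : ∀ a ∈ L, g (f a) = a := fun a ha => h.inj (hgL _) ha (hg _)
  have hπ : ∀ a ∈ L, pim P a ∈ L := by
    intro a ha
    have := (hs a ha).2.1
    rw [hL]
    cases e : LU.testBit a <;> rw [e] at this
    exacts [Or.inl this, Or.inr this]
  have hinv : Function.Involutive fun v => f (pim P (g v)) := by
    intro v
    simp only
    rw [hgf _ (hπ _ (hgL v)), (hs _ (hgL v)).1, hg]
  have hadj : ∀ v w, G.Adj v w → G.Adj (f (pim P (g v))) (f (pim P (g w))) := by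
    intro v w hvw
    rw [← hg v] at hvw
    obtain ⟨b, hb, rfl⟩ := h.full hc ht.cubic (hfull _ (hgL v)) hvw
    rw [hgf b (h.mem _ _ hb)]
    apply h.adj
    rw [← hc.testBit_row, (hs _ (hgL v)).2.2]
    exact testBit_rowim (h.card_row_le hc ht.cubic _) ((hc.testBit_row _ _ _).2 hb)
  obtain ⟨a, ha⟩ := hne
  let φ : G ≃g G := ⟨hinv.toPerm _, fun {v w} => ⟨fun hvw => by
    have := hadj _ _ hvw
    have h1 := hinv v
    have h2 := hinv w
    simp only [Function.Involutive.coe_toPerm] at this h1 h2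
    rwa [h1, h2] at this, fun hvw => hadj _ _ hvw⟩⟩
  have hφ : φ (f a) = f (pim P a) := by
    change f (pim P (g (f a))) = _
    rw [hgf a ha]
  have hside := ht.side_aut φ (f a)
  rw [hφ] at hside
  have hb := (hs a ha).2.1
  cases e : LU.testBit a
  · rw [e] at hb
    rw [hU _ hb, hW a ((hL a).1 ha |>.resolve_left (by simp [e]))] at hside
    cases hside
  · rw [e] at hb
    rw [hW _ hb, hU a e] at hside
    cases hside

end Cfg
variable {V : Type*}
namespace Cfg

/-- The vertex with a given label. -/
def vert (c : Cfg) {G : SimpleGraph V} (ρ : ℕ → G ≃g G) (x : ℕ → V) (a : ℕ) : V :=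
  ρ (a % c.m) (x (a / c.m))

/-- The labels in the two masks `LU` and `LW`. -/
def labels (LU LW : ℕ) : Set ℕ := {a | LU.testBit a = true ∨ LW.testBit a = true}

/-- The numbers `I k LU LW cU cW` describe the orbits of the base points `x 0, …, x (k - 1)`. -/
structure Lab (c : Cfg) {G : SimpleGraph V} (side : V → Bool) (ρ : ℕ → G ≃g G)
    (I k LU LW cU cW : ℕ) (x : ℕ → V) : Prop where
  ty_lt : ∀ o < k, ty I o < c.nt
  ty_spec : ∀ o < k, ∀ i < c.m, ∀ j < c.m, ρ i (x o) = ρ j (x o) ↔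
    c.can (ty I o) i = c.can (ty I o) j
  I_lt : I < 2 ^ (4 * k)
  bitU : ∀ a, LU.testBit a = true ↔ a / c.m < k ∧ side (x (a / c.m)) = true ∧
    c.can (ty I (a / c.m)) (a % c.m) = a % c.m
  bitW : ∀ a, LW.testBit a = true ↔ a / c.m < k ∧ side (x (a / c.m)) = false ∧
    c.can (ty I (a / c.m)) (a % c.m) = a % c.m
  disj : ∀ o < k, ∀ o' < k, ∀ i < c.m, ∀ j < c.m, ρ i (x o) = ρ j (x o') → o = o'
  cU_eq : cU = (bits LU).card
  cW_eq : cW = (bits LW).card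

variable {c : Cfg} {G : SimpleGraph V} {T : ℕ} {L : Set ℕ} {f : ℕ → V} {side : V → Bool}
  {ρ : ℕ → G ≃g G} {n : ℕ} {I k LU LW cU cW : ℕ} {x : ℕ → V}

theorem Lab.mem (h : c.Lab side ρ I k LU LW cU cW x) (a : ℕ) : a ∈ labels LU LW ↔
    a / c.m < k ∧ c.can (ty I (a / c.m)) (a % c.m) = a % c.m := by
  change (_ ∨ _) ↔ _
  rw [h.bitU, h.bitW]
  cases side (x (a / c.m)) <;> simp

theorem Lab.inj (h : c.Lab side ρ I k LU LW cU cW x) (hc : c.Wf) :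
    Set.InjOn (c.vert ρ x) (labels LU LW) := by
  intro a ha b hb hab
  rw [h.mem] at ha hb
  have hma := Nat.mod_lt a hc.m_pos
  have hmb := Nat.mod_lt b hc.m_pos
  have e := h.disj _ ha.1 _ hb.1 _ hma _ hmb hab
  rw [vert, vert, ← e, h.ty_spec _ ha.1 _ hma _ hmb, ha.2, e, hb.2] at hab
  rw [← Nat.div_add_mod a c.m, ← Nat.div_add_mod b c.m, e, hab]

theorem Lab.sideU (h : c.Lab side ρ I k LU LW cU cW x) (ht : c.Target G side ρ n) {a : ℕ}
    (ha : LU.testBit a = true) : side (c.vert ρ x a) = true := by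
  rw [vert, ht.side_aut, ((h.bitU a).1 ha).2.1]

theorem Lab.sideW (h : c.Lab side ρ I k LU LW cU cW x) (ht : c.Target G side ρ n) {a : ℕ}
    (ha : LW.testBit a = true) : side (c.vert ρ x a) = false := by
  rw [vert, ht.side_aut, ((h.bitW a).1 ha).2.1]

theorem Lab.exists_label (h : c.Lab side ρ I k LU LW cU cW x) (hc : c.Wf) {o i : ℕ} (ho : o < k)
    (hi : i < c.m) : c.m * o + c.can (ty I o) i ∈ labels LU LW ∧
      c.vert ρ x (c.m * o + c.can (ty I o) i) = ρ i (x o) := by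
  have hlt := hc.can_lt _ (h.ty_lt o ho) i hi
  have e1 : (c.m * o + c.can (ty I o) i) / c.m = o := by
    rw [Nat.mul_add_div hc.m_pos, Nat.div_eq_of_lt hlt, add_zero]
  have e2 : (c.m * o + c.can (ty I o) i) % c.m = c.can (ty I o) i := by
    rw [Nat.mul_add_mod, Nat.mod_eq_of_lt hlt]
  have hcc := hc.can_can _ (h.ty_lt o ho) i hi
  refine ⟨?_, ?_⟩
  · rw [h.mem, e1, e2]
    exact ⟨ho, hcc⟩
  · rw [vert, e1, e2, h.ty_spec o ho _ hlt _ hi, hcc]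

theorem Lab.exists_base (h : c.Lab side ρ I k LU LW cU cW x) (hc : c.Wf)
    (ht : c.Target G side ρ n) {o : ℕ} (ho : o < k) :
    c.m * o ∈ labels LU LW ∧ c.vert ρ x (c.m * o) = x o := by
  have := h.exists_label hc ho hc.m_pos
  rwa [hc.can_zero _ (h.ty_lt o ho), add_zero, ht.rho_zero] at this

theorem Lab.bitU_iff (h : c.Lab side ρ I k LU LW cU cW x) (ht : c.Target G side ρ n) {a : ℕ}
    (ha : a ∈ labels LU LW) : LU.testBit a = side (c.vert ρ x a) := by
  cases e : LU.testBit a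
  · rw [h.sideW ht (ha.resolve_left (by simp [e]))]
  · rw [h.sideU ht e]

theorem Lab.card_le (h : c.Lab side ρ I k LU LW cU cW x) (hc : c.Wf) (ht : c.Target G side ρ n) :
    cU ≤ n ∧ cW ≤ n := by
  have := ht.finite
  rw [h.cU_eq, h.cW_eq]
  constructor
  · rw [← ht.card_side true, ← Set.ncard_coe_finset]
    apply Set.ncard_le_ncard_of_injOn (c.vert ρ x)
    · intro a ha
      exact h.sideU ht (by simpa using ha)
    · exact (h.inj hc).mono fun a ha => Or.inl (by simpa using ha)
  · rw [← ht.card_side false, ← Set.ncard_coe_finset]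
    apply Set.ncard_le_ncard_of_injOn (c.vert ρ x)
    · intro a ha
      exact h.sideW ht (by simpa using ha)
    · exact (h.inj hc).mono fun a ha => Or.inr (by simpa using ha)

theorem Emb.surj (h : c.Emb G T L f) (hc : c.Wf) (ht : c.Target G side ρ n)
    (hfull : ∀ a ∈ L, pop3 (c.row T a) = true) (hne : L.Nonempty) (v : V) : ∃ a ∈ L, f a = v := by
  obtain ⟨a, ha⟩ := hne
  obtain ⟨w⟩ := ht.conn (f a) v
  generalize hu : f a = u at w
  induction w generalizing a with
  | nil => exact ⟨a, ha, hu⟩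
  | cons huv _ ih =>
    subst hu
    obtain ⟨b, hb, rfl⟩ := h.full hc ht.cubic (hfull a ha) huv
    exact ih b (h.mem _ _ hb) rfl

/-- The invariant of the search. -/
structure Inv (c : Cfg) {G : SimpleGraph V} (side : V → Bool) (ρ : ℕ → G ≃g G)
    (T I k LU LW cU cW : ℕ) (x : ℕ → V) : Prop where
  lab : c.Lab side ρ I k LU LW cU cW x
  emb : c.Emb G T (labels LU LW) (c.vert ρ x)
  pos : 0 < k
  lt : c.m * k < c.W

theorem Inv.leaf_false (h : c.Inv side ρ T I k LU LW cU cW x) (hc : c.Wf)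
    (ht : c.Target G side ρ n) : c.leaf T LU LW k cU ≠ true := by
  unfold leaf
  rw [frc_eq]
  cases hF : Nat.beq 0 (andNot (Nat.lor LU LW) (c.fullm T))
  · simp
  rw [nland_eq_zero_iff] at hF
  have hfull : ∀ a ∈ labels LU LW, pop3 (c.row T a) = true := fun a ha =>
    testBit_fullm T a (hF a (by simpa [labels] using ha))
  have hne : (labels LU LW).Nonempty := ⟨_, (h.lab.exists_base hc ht h.pos).1⟩
  have hsurj := h.emb.surj hc ht hfull hne
  have hcU : cU = n := by
    have := ht.finite
    refine le_antisymm (h.lab.card_le hc ht).1 ?_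
    rw [h.lab.cU_eq, ← ht.card_side true, ← Set.ncard_coe_finset]
    refine (Set.ncard_le_ncard ?_ (Set.toFinite _)).trans (Set.ncard_image_le (f := c.vert ρ x)
      (Finset.finite_toSet _))
    intro v hv
    obtain ⟨a, ha, rfl⟩ := hsurj v
    exact ⟨a, by rw [Finset.mem_coe, mem_bits, h.lab.bitU_iff ht ha]; exact hv, rfl⟩
  have hble : Nat.ble c.lo cU = true := by rw [nble_eq, hcU]; simp [ht.lo_le]
  rw [cond_true, hble, cond_true]
  induction c.certs with
  | nil =>
    apply h.emb.inhom_false hc ht hfull _ _ _ (Or.inl rfl) (Or.inl rfl)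
    intro o ho
    have := (h.lab.exists_base hc ht ho).1
    exact ⟨this, h.lab.bitU_iff ht this⟩
  | cons P l ih =>
    have := h.emb.swapOK_false hc ht hfull (LU := LU) (LW := LW) (P := P) (fun _ => Iff.rfl)
      (fun a => h.lab.sideU ht) (fun a => h.lab.sideW ht) hne hsurj
    simp only [eq_false_of_ne_true this, cond_false]
    exact ih

end Cfg
variable {V : Type*}
namespace Cfg

variable {c : Cfg} {G : SimpleGraph V} {T : ℕ} {L : Set ℕ} {f : ℕ → V} {side : V → Bool}
  {ρ : ℕ → G ≃g G} {n : ℕ} {I k LU LW cU cW : ℕ} {x : ℕ → V}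

theorem testBit_rec_nlor (p : ℕ → ℕ) (N i : ℕ) :
    (Nat.rec (motive := fun _ => ℕ) 0 (fun g acc => Nat.lor acc (bit (p g))) N).testBit i = true ↔
      ∃ g < N, p g = i := by
  induction N with
  | zero => simp
  | succ N ih =>
    simp only [testBit_nlor, testBit_bit, Bool.or_eq_true, decide_eq_true_iff, ih]
    constructor
    · rintro (⟨g, hg, e⟩ | e)
      exacts [⟨g, by omega, e⟩, ⟨N, by omega, e⟩]
    · rintro ⟨g, hg, e⟩
      rcases Nat.lt_succ_iff_lt_or_eq.1 hg with h | rfl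
      exacts [Or.inl ⟨g, h, e⟩, Or.inr e]

theorem E_salt_edges (T o t o' t' j a b : ℕ) : c.E (salt (c.edges T o t o' t' j)) a b ↔
    c.E T a b ∨ b < c.W ∧ ((∃ g < c.m,
      c.W * (c.m * o) + c.m * o' + (c.W * c.can t g + c.can t' (c.mul g j)) = c.W * a + b) ∨
    ∃ g < c.m, c.W * (c.m * o') + c.m * o + (c.W * c.can t' (c.mul g j) + c.can t g)
      = c.W * a + b) := by
  have hs : ∀ X i, (salt X).testBit (64 + i) = X.testBit i := by
    intro X i
    have hlt : Nat.mod X 2305843009213693951 < 2 ^ 64 :=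
      (Nat.mod_lt X (by norm_num)).trans (by norm_num)
    have := Nat.testBit_lt_two_pow (hlt.trans_le (Nat.pow_le_pow_right (by norm_num)
      (Nat.le_add_right 64 i)))
    rw [salt, testBit_nlor, this, testBit_nshiftLeft]
    simp
  have key : ∀ p q i, (Nat.shiftLeft p q).testBit i = true ↔ q ≤ i ∧ p.testBit (i - q) = true := by
    intro p q i
    rw [testBit_nshiftLeft]; simp
  simp only [E, hs, edges, testBit_nlor, Bool.or_eq_true, testBit_nshiftRight, key, patt, pattT,
    testBit_rec_nlor]
  simp only [Nat.add_eq, Nat.mul_eq]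
  have e : ∀ (p : ℕ → ℕ) q, (q ≤ c.W * a + b ∧ ∃ g < c.m, p g = c.W * a + b - q) ↔
      ∃ g < c.m, q + p g = c.W * a + b := by
    intro p q
    constructor
    · rintro ⟨h, g, hg, e⟩; exact ⟨g, hg, by omega⟩
    · rintro ⟨g, hg, e⟩; exact ⟨by omega, g, hg, by omega⟩
  rw [e, e]
  exact and_or_left

theorem decode_add_mul {W a b a' b' : ℕ} (hb : b < W) (hb' : b' < W)
    (h : W * a + b = W * a' + b') : a = a' ∧ b = b' := by
  have h1 : (W * a + b) / W = a := by
    rw [Nat.mul_add_div (by omega), Nat.div_eq_of_lt hb, add_zero]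
  have h2 : (W * a' + b') / W = a' := by
    rw [Nat.mul_add_div (by omega), Nat.div_eq_of_lt hb', add_zero]
  have : a = a' := by rw [← h1, h, h2]
  subst this
  exact ⟨rfl, by omega⟩

/-- The effect of inserting an orbit of edges. -/
theorem Inv.edges (h : c.Inv side ρ T I k LU LW cU cW x) (hc : c.Wf) (ht : c.Target G side ρ n)
    {o o' j : ℕ} (ho : o < k) (ho' : o' < k) (hj : j < c.m) (hadj : G.Adj (x o) (ρ j (x o'))) :
    c.Inv side ρ (salt (c.edges T o (ty I o) o' (ty I o') j)) I k LU LW cU cW x ∧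
    c.E (salt (c.edges T o (ty I o) o' (ty I o') j)) (c.m * o)
      (c.m * o' + c.can (ty I o') j) := by
  set A := fun g => c.m * o + c.can (ty I o) g with hA
  set B := fun g => c.m * o' + c.can (ty I o') (c.mul g j) with hB
  have hAL : ∀ g < c.m, A g ∈ labels LU LW ∧ c.vert ρ x (A g) = ρ g (x o) := fun g hg =>
    h.lab.exists_label hc ho hg
  have hBL : ∀ g < c.m, B g ∈ labels LU LW ∧ c.vert ρ x (B g) = ρ g (ρ j (x o')) := by
    intro g hg
    rw [ht.rho_mul g hg j hj]
    exact h.lab.exists_label hc ho' (hc.mul_lt g hg j hj)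
  have hlt : ∀ a ∈ labels LU LW, a < c.W := fun a ha => by have := h.emb.lt a ha; omega
  have hE : ∀ a b, c.E (salt (c.edges T o (ty I o) o' (ty I o') j)) a b ↔
      c.E T a b ∨ (∃ g < c.m, a = A g ∧ b = B g) ∨ ∃ g < c.m, a = B g ∧ b = A g := by
    intro a b
    rw [E_salt_edges]
    refine or_congr_right ?_
    constructor
    · rintro ⟨hb, ⟨g, hg, e⟩ | ⟨g, hg, e⟩⟩
      · left
        refine ⟨g, hg, decode_add_mul hb (hlt _ (hBL g hg).1) ?_⟩
        rw [← e]; simp only [hA, hB]; ring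
      · right
        refine ⟨g, hg, decode_add_mul hb (hlt _ (hAL g hg).1) ?_⟩
        rw [← e]; simp only [hA, hB]; ring
    · rintro (⟨g, hg, rfl, rfl⟩ | ⟨g, hg, rfl, rfl⟩)
      · refine ⟨hlt _ (hBL g hg).1, Or.inl ⟨g, hg, ?_⟩⟩
        simp only [hA, hB]; ring
      · refine ⟨hlt _ (hAL g hg).1, Or.inr ⟨g, hg, ?_⟩⟩
        simp only [hA, hB]; ring
  have hadj' : ∀ g < c.m, G.Adj (c.vert ρ x (A g)) (c.vert ρ x (B g)) := by
    intro g hg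
    rw [(hAL g hg).2, (hBL g hg).2]
    exact (ρ g).map_adj_iff.2 hadj
  refine ⟨⟨h.lab, ⟨h.emb.lt, h.emb.inj, ?_, ?_, ?_, ?_⟩, h.pos, h.lt⟩, ?_⟩
  · intro a b hab
    rcases (hE a b).1 hab with h1 | ⟨g, hg, rfl, rfl⟩ | ⟨g, hg, rfl, rfl⟩
    exacts [h.emb.left_mem _ _ h1, (hAL g hg).1, (hBL g hg).1]
  · intro a b hab
    rcases (hE a b).1 hab with h1 | ⟨g, hg, rfl, rfl⟩ | ⟨g, hg, rfl, rfl⟩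
    exacts [h.emb.mem _ _ h1, (hBL g hg).1, (hAL g hg).1]
  · intro a b hab
    rcases (hE a b).1 hab with h1 | ⟨g, hg, rfl, rfl⟩ | ⟨g, hg, rfl, rfl⟩
    exacts [h.emb.adj _ _ h1, hadj' g hg, (hadj' g hg).symm]
  · intro a b hab
    rw [hE]
    rcases (hE a b).1 hab with h1 | ⟨g, hg, rfl, rfl⟩ | ⟨g, hg, rfl, rfl⟩
    exacts [Or.inl (h.emb.symm _ _ h1), Or.inr (Or.inr ⟨g, hg, rfl, rfl⟩),
      Or.inr (Or.inl ⟨g, hg, rfl, rfl⟩)]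
  · rw [hE]
    refine Or.inr (Or.inl ⟨0, hc.m_pos, ?_, ?_⟩)
    · simp [hA, hc.can_zero _ (h.lab.ty_lt o ho)]
    · have hz := ht.rho_mul 0 hc.m_pos j hj (x o')
      rw [ht.rho_zero, h.lab.ty_spec o' ho' j hj _ (hc.mul_lt _ hc.m_pos j hj)] at hz
      simp only [hB, hz]

/-- The labels reached from a vertex along known edges without returning to it violate the girth
bound for no neighbour of the vertex. -/
theorem Inv.not_mem_ball (h : c.Inv side ρ T I k LU LW cU cW x) (hc : c.Wf)
    (ht : c.Target G side ρ n) {v l S : ℕ} (hv : v ∈ labels LU LW) (hl : l ∈ labels LU LW)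
    (hadj : G.Adj (c.vert ρ x v) (c.vert ρ x l))
    (hS : ∀ s, S.testBit s = true → c.E T v s ∧ s ≠ l) :
    (c.ball (c.avoid v) T c.G4 S).testBit l ≠ true := by
  have hvW : v < c.W := by have := h.emb.lt v hv; omega
  rw [Ne, hc.testBit_ball h.emb.small fun a ha => h.emb.small _ _ (hS a ha).1]
  intro hmem
  have := Reach.map h.emb.adj (p' := fun w => w ≠ c.vert ρ x v) (fun a b hab hb e =>
    hc.testBit_avoid hvW b hb (h.emb.inj (h.emb.mem _ _ hab) hv e)) hmem
  refine ht.girth _ _ hadj ?_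
  refine Reach.mono_set ?_ _ this
  rintro _ ⟨s, hs, rfl⟩
  exact ⟨h.emb.adj _ _ (hS s hs).1, fun e =>
    (hS s hs).2 (h.emb.inj (h.emb.mem _ _ (hS s hs).1) hl e)⟩

theorem Inv.child_false (h : c.Inv side ρ T I k LU LW cU cW x) (hc : c.Wf)
    (ht : c.Target G side ρ n) {rec : Rec}
    (hrec : ∀ T A B, c.Inv side ρ T I k LU LW cU cW x → rec T I k LU LW cU cW A B ≠ true)
    {o o' j : ℕ} (ho : o < k) (ho' : o' < k) (hj : j < c.m) (hadj : G.Adj (x o) (ρ j (x o')))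
    (A B : ℕ) : c.child rec T I k LU LW cU cW A B o (c.m * o) (ty I o) o' (ty I o') j ≠ true := by
  simp only [child, frc_eq]
  obtain ⟨h', hE⟩ := h.edges hc ht ho ho' hj hadj
  obtain ⟨hv, hxv⟩ := h.lab.exists_base hc ht ho
  obtain ⟨hl, hxl⟩ := h.lab.exists_label hc ho' hj
  rw [← hxv, ← hxl] at hadj
  have hg := h'.not_mem_ball hc ht hv hl hadj
    (S := andNot (c.row (salt (c.edges T o (ty I o) o' (ty I o') j)) (c.m * o))
      (bit (c.m * o' + c.can (ty I o') j))) (fun s hs => by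
    rw [testBit_andNot, Bool.and_eq_true, hc.testBit_row, testBit_bit] at hs
    refine ⟨hs.1, fun e => ?_⟩
    simp [e] at hs)
  have hp := h'.emb.prune_false hc ht hv hl
  simp only [tb_eq, Nat.add_eq, Nat.mul_eq, eq_false_of_ne_true hg, hp, cond_false]
  exact hrec _ _ _ h'

theorem cands_spec {rec : Rec} {A B o v t S : ℕ}
    (h : c.cands rec T I k LU LW cU cW A B o v t 128 S = true) (l : ℕ) (hl : S.testBit l = true) :
    pop3 (c.row T l) = true ∨
      c.child rec T I k LU LW cU cW A B o v t (l / c.m) (ty I (l / c.m)) (l % c.m) = true := by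
  unfold cands at h
  revert h
  generalize 128 = fuel
  intro h
  induction fuel generalizing S with
  | zero => cases h
  | succ fuel ih =>
    have hS0 : S ≠ 0 := by rintro rfl; simp at hl
    simp only [frc_eq, nbeq_eq, hS0, decide_false, cond_false] at h ih
    generalize e1 : (bif pop3 (c.row T (Nat.log2 S)) then true else _) = b1 at h
    cases b1
    · cases h
    simp only [cond_true] at h
    by_cases e : l = Nat.log2 S
    · rw [← e] at e1
      cases e2 : pop3 (c.row T l)
      · rw [e2] at e1; exact Or.inr e1
      · exact Or.inl rfl
    · apply ih _ h
      have : l ∈ bits (Nat.xor S (bit (Nat.log2 S))) := by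
        rw [bits_drop hS0, Finset.mem_erase]
        exact ⟨e, mem_bits.2 hl⟩
      exact mem_bits.1 this

end Cfg
variable {V : Type*}
namespace Cfg

variable {c : Cfg} {G : SimpleGraph V} {T : ℕ} {L : Set ℕ} {f : ℕ → V} {side : V → Bool}
  {ρ : ℕ → G ≃g G} {n : ℕ} {I k LU LW cU cW : ℕ} {x : ℕ → V}

theorem ty_eq (I o : ℕ) : ty I o = I / 2 ^ (4 * o) % 2 ^ 4 := by
  change 15 &&& (I >>> (4 * o)) = _
  rw [Nat.and_comm, show 15 = 2 ^ 4 - 1 from rfl, Nat.and_two_pow_sub_one_eq_mod,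
    Nat.shiftRight_eq_div_pow]

theorem ty_add_lt {I k t' o : ℕ} (ho : o < k) : ty (I + Nat.shiftLeft t' (4 * k)) o = ty I o := by
  rw [ty_eq, ty_eq]
  change (I + t' <<< (4 * k)) / _ % _ = _
  obtain ⟨d, rfl⟩ := Nat.exists_eq_add_of_lt ho
  rw [Nat.shiftLeft_eq, show 2 ^ (4 * (o + d + 1)) = 2 ^ (4 * o) * (2 ^ 4 * 2 ^ (4 * d)) by ring,
    show I + t' * (2 ^ (4 * o) * (2 ^ 4 * 2 ^ (4 * d))) =
      I + 2 ^ (4 * o) * (2 ^ 4 * (t' * 2 ^ (4 * d))) by ring,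
    Nat.add_mul_div_left _ _ (by positivity), Nat.add_mul_mod_self_left]

theorem ty_add_self {I k t' : ℕ} (hI : I < 2 ^ (4 * k)) (ht : t' < 16) :
    ty (I + Nat.shiftLeft t' (4 * k)) k = t' := by
  rw [ty_eq]
  change (I + t' <<< (4 * k)) / _ % _ = _
  rw [Nat.shiftLeft_eq, Nat.add_mul_div_right _ _ (by positivity), Nat.div_eq_of_lt hI, zero_add,
    Nat.mod_eq_of_lt (by omega)]

theorem testBit_cm (hc : c.Wf) {t' k : ℕ} (ht' : t' < c.nt) (a : ℕ) :
    (Nat.shiftLeft (c.cm t') (c.m * k)).testBit a = true ↔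
      a / c.m = k ∧ c.can t' (a % c.m) = a % c.m := by
  rw [testBit_nshiftLeft, Bool.and_eq_true, decide_eq_true_iff]
  have hm := hc.m_pos
  constructor
  · rintro ⟨h1, h2⟩
    have hlt : a - c.m * k < c.m := by
      by_contra hcon
      have := Nat.testBit_lt_two_pow ((hc.cm_lt t' ht').trans_le
        (Nat.pow_le_pow_right (by norm_num) (not_lt.1 hcon)))
      rw [this] at h2
      cases h2
    rw [hc.cm_eq t' ht' _ hlt, decide_eq_true_iff] at h2
    obtain ⟨d, rfl⟩ := Nat.exists_eq_add_of_le h1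
    rw [Nat.add_sub_cancel_left] at h2 hlt
    rw [Nat.mul_add_div hm, Nat.div_eq_of_lt hlt, Nat.mul_add_mod, Nat.mod_eq_of_lt hlt]
    exact ⟨by simp, h2⟩
  · rintro ⟨rfl, h2⟩
    have := Nat.div_add_mod a c.m
    have e : a - c.m * (a / c.m) = a % c.m := by omega
    rw [e, hc.cm_eq t' ht' _ (Nat.mod_lt _ hm), decide_eq_true_iff]
    exact ⟨by omega, h2⟩

theorem card_bits_cm (hc : c.Wf) {t' : ℕ} (ht' : t' < c.nt) :
    (bits (c.cm t')).card = c.sz t' := by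
  rw [hc.sz_eq t' ht']
  congr 1
  ext i
  rw [mem_bits, Finset.mem_filter, Finset.mem_range]
  constructor
  · intro h
    have hi : i < c.m := by
      by_contra hcon
      have := Nat.testBit_lt_two_pow ((hc.cm_lt t' ht').trans_le
        (Nat.pow_le_pow_right (by norm_num) (not_lt.1 hcon)))
      rw [this] at h
      cases h
    rw [hc.cm_eq t' ht' i hi] at h
    exact ⟨hi, by simpa using h⟩
  · rintro ⟨hi, h⟩
    rw [hc.cm_eq t' ht' i hi]
    simpa using h

theorem card_bits_nlor_cm (hc : c.Wf) {t' M k : ℕ} (ht' : t' < c.nt)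
    (hM : ∀ a, M.testBit a = true → a / c.m < k) :
    (bits (Nat.lor M (Nat.shiftLeft (c.cm t') (c.m * k)))).card = (bits M).card + c.sz t' := by
  have e : bits (Nat.lor M (Nat.shiftLeft (c.cm t') (c.m * k))) =
      bits M ∪ (bits (c.cm t')).map (addRightEmbedding (c.m * k)) := by
    ext a
    rw [mem_bits, Finset.mem_union, mem_bits, Finset.mem_map, testBit_nlor, Bool.or_eq_true,
      testBit_nshiftLeft, Bool.and_eq_true, decide_eq_true_iff]
    refine or_congr_right ⟨fun ⟨h1, h2⟩ => ⟨a - c.m * k, mem_bits.2 h2, ?_⟩, ?_⟩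
    · simp only [addRightEmbedding_apply]; omega
    · rintro ⟨b, hb, rfl⟩
      rw [mem_bits] at hb
      simp [hb]
  rw [e, Finset.card_union_of_disjoint, Finset.card_map, card_bits_cm hc ht']
  rw [Finset.disjoint_left]
  rintro a ha hb
  obtain ⟨b, -, rfl⟩ := Finset.mem_map.1 hb
  have h1 := hM _ (mem_bits.1 ha)
  have hm := hc.m_pos
  rw [addRightEmbedding_apply, Nat.add_mul_div_left _ _ hm] at h1
  exact absurd h1 (Nat.not_lt.2 (Nat.le_add_left _ _))

theorem Lab.new (h : c.Lab side ρ I k LU LW cU cW x) (hc : c.Wf) (ht : c.Target G side ρ n)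
    {y : V} (hy : ∀ a ∈ labels LU LW, c.vert ρ x a ≠ y) {t' : ℕ} (ht' : t' < c.nt)
    (hty : ∀ i < c.m, ∀ j < c.m, ρ i y = ρ j y ↔ c.can t' i = c.can t' j) :
    c.Lab side ρ (I + Nat.shiftLeft t' (4 * k)) (k + 1)
      (bif side y then Nat.lor LU (Nat.shiftLeft (c.cm t') (c.m * k)) else LU)
      (bif side y then LW else Nat.lor LW (Nat.shiftLeft (c.cm t') (c.m * k)))
      (bif side y then cU + c.sz t' else cU) (bif side y then cW else cW + c.sz t')
      (Function.update x k y) := by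
  have h16 : t' < 16 := ht'.trans_le hc.nt_le
  have hx : ∀ o < k, Function.update x k y o = x o := fun o ho =>
    Function.update_of_ne (by omega) _ _
  have hself := ty_add_self h.I_lt h16
  have hUlt : ∀ a, LU.testBit a = true → a / c.m < k := fun a ha => ((h.bitU a).1 ha).1
  have hWlt : ∀ a, LW.testBit a = true → a / c.m < k := fun a ha => ((h.bitW a).1 ha).1
  have hd : ∀ o < k, ∀ i < c.m, ∀ j < c.m, ρ i y ≠ ρ j (x o) := by
    intro o ho i hi j hj e
    obtain ⟨i', hi', hii⟩ := hc.inv i hi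
    have e := congrArg (ρ i') e
    rw [ht.rho_mul _ hi' _ hi, ht.rho_mul _ hi' _ hj, hii, ht.rho_zero] at e
    obtain ⟨h1, h2⟩ := h.exists_label hc ho (hc.mul_lt _ hi' _ hj)
    exact hy _ h1 (h2.trans e.symm)
  refine ⟨?_, ?_, ?_, ?_, ?_, ?_, ?_, ?_⟩
  · intro o ho
    rcases Nat.lt_succ_iff_lt_or_eq.1 ho with ho | rfl
    · rw [ty_add_lt ho]; exact h.ty_lt o ho
    · rw [hself]; exact ht'
  · intro o ho
    rcases Nat.lt_succ_iff_lt_or_eq.1 ho with ho | rfl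
    · rw [ty_add_lt ho, hx o ho]; exact h.ty_spec o ho
    · rw [hself, Function.update_self]; exact hty
  · change I + t' <<< (4 * k) < _
    rw [Nat.shiftLeft_eq, show 2 ^ (4 * (k + 1)) = 16 * 2 ^ (4 * k) by ring]
    have := h.I_lt
    nlinarith
  · intro a
    have hold : LU.testBit a = true ↔ a / c.m < k ∧ side (Function.update x k y (a / c.m)) = true ∧
        c.can (ty (I + Nat.shiftLeft t' (4 * k)) (a / c.m)) (a % c.m) = a % c.m := by
      rw [h.bitU]
      refine and_congr_right fun ho => ?_
      rw [hx _ ho, ty_add_lt ho]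
    have hnew := testBit_cm hc (k := k) ht' a
    rw [Nat.lt_succ_iff_lt_or_eq, or_and_right, ← hold]
    cases e : side y
    · rw [cond_false]
      refine ⟨Or.inl, fun h1 => h1.resolve_right fun h2 => ?_⟩
      rw [h2.1, Function.update_self, e] at h2
      simp at h2
    · rw [cond_true, testBit_nlor, Bool.or_eq_true, hnew]
      refine or_congr_right (and_congr_right fun h1 => ?_)
      rw [h1, Function.update_self, e, hself]
      simp
  · intro a
    have hold : LW.testBit a = true ↔ a / c.m < k ∧ side (Function.update x k y (a / c.m)) = false ∧
        c.can (ty (I + Nat.shiftLeft t' (4 * k)) (a / c.m)) (a % c.m) = a % c.m := by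
      rw [h.bitW]
      refine and_congr_right fun ho => ?_
      rw [hx _ ho, ty_add_lt ho]
    have hnew := testBit_cm hc (k := k) ht' a
    rw [Nat.lt_succ_iff_lt_or_eq, or_and_right, ← hold]
    cases e : side y
    · rw [cond_false, testBit_nlor, Bool.or_eq_true, hnew]
      refine or_congr_right (and_congr_right fun h1 => ?_)
      rw [h1, Function.update_self, e, hself]
      simp
    · rw [cond_true]
      refine ⟨Or.inl, fun h1 => h1.resolve_right fun h2 => ?_⟩
      rw [h2.1, Function.update_self, e] at h2
      simp at h2
  · intro o ho o' ho' i hi j hj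
    rcases Nat.lt_succ_iff_lt_or_eq.1 ho with ho | rfl <;>
      rcases Nat.lt_succ_iff_lt_or_eq.1 ho' with ho' | rfl
    · rw [hx _ ho, hx _ ho']; exact h.disj o ho o' ho' i hi j hj
    · rw [hx _ ho, Function.update_self]
      exact fun e => absurd e.symm (hd o ho j hj i hi)
    · rw [hx _ ho', Function.update_self]
      exact fun e => absurd e (hd o' ho' i hi j hj)
    · exact fun _ => rfl
  · cases side y
    · exact h.cU_eq
    · rw [cond_true, cond_true, card_bits_nlor_cm hc ht' hUlt, h.cU_eq]
  · cases side y
    · rw [cond_false, cond_false, card_bits_nlor_cm hc ht' hWlt, h.cW_eq]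
    · exact h.cW_eq

theorem Inv.new (h : c.Inv side ρ T I k LU LW cU cW x) {I' LU' LW' cU' cW' : ℕ} {y : V}
    (hl : c.Lab side ρ I' (k + 1) LU' LW' cU' cW' (Function.update x k y)) (hc : c.Wf)
    (hsub : labels LU LW ⊆ labels LU' LW') (hlt : c.m * (k + 1) < c.W) :
    c.Inv side ρ T I' (k + 1) LU' LW' cU' cW' (Function.update x k y) := by
  have hv : ∀ a ∈ labels LU LW, c.vert ρ (Function.update x k y) a = c.vert ρ x a := by
    intro a ha
    have := ((h.lab.mem a).1 ha).1
    rw [vert, vert, Function.update_of_ne (by omega)]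
  refine ⟨hl, ⟨?_, hl.inj hc, ?_, ?_, ?_, h.emb.symm⟩, by omega, hlt⟩
  · intro a ha
    have h1 := (Nat.div_lt_iff_lt_mul hc.m_pos).1 ((hl.mem a).1 ha).1
    rw [mul_comm] at h1
    omega
  · exact fun a b hab => hsub (h.emb.left_mem a b hab)
  · exact fun a b hab => hsub (h.emb.mem a b hab)
  · intro a b hab
    rw [hv _ (h.emb.left_mem a b hab), hv _ (h.emb.mem a b hab)]
    exact h.emb.adj a b hab

theorem news_succ (c : Cfg) (rec : Rec) (T I k LU LW cU cW A B o v t : ℕ) (su : Bool) (N : ℕ) :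
    c.news rec T I k LU LW cU cW A B o v t su (N + 1) =
    cond (cond (decide (N = 0)) false (decide (N = t)))
      (c.news rec T I k LU LW cU cW A B o v t su N)
    (cond (decide ((cond su cW cU) + c.sz N ≤ c.hi))
      (cond (decide (c.m * (k + 1) < c.W))
       (cond (cond su
         (c.child rec T (I + Nat.shiftLeft N (4 * k)) (k + 1) LU
           (Nat.lor LW (Nat.shiftLeft (c.cm N) (c.m * k))) cU (cW + c.sz N) A B o v t k N 0)
         (c.child rec T (I + Nat.shiftLeft N (4 * k)) (k + 1)
           (Nat.lor LU (Nat.shiftLeft (c.cm N) (c.m * k))) LW (cU + c.sz N) cW A B o v t k N 0))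
       (c.news rec T I k LU LW cU cW A B o v t su N) false) false)
      (c.news rec T I k LU LW cU cW A B o v t su N)) := by
  simp only [news, frc_eq, nbeq_eq, nble_eq, nblt_eq, Nat.add_eq, Nat.mul_eq, Nat.succ_eq_add_one]

theorem news_spec {rec : Rec} {A B o v t : ℕ} {su : Bool} {N : ℕ}
    (h : c.news rec T I k LU LW cU cW A B o v t su N = true) (t' : ℕ) (ht' : t' < N)
    (htt : t' ≠ 0 → t' ≠ t) (hcount : (bif su then cW else cU) + c.sz t' ≤ c.hi) :
    c.m * (k + 1) < c.W ∧ c.child rec T (I + Nat.shiftLeft t' (4 * k)) (k + 1)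
      (bif !su then Nat.lor LU (Nat.shiftLeft (c.cm t') (c.m * k)) else LU)
      (bif !su then LW else Nat.lor LW (Nat.shiftLeft (c.cm t') (c.m * k)))
      (bif !su then cU + c.sz t' else cU) (bif !su then cW else cW + c.sz t') A B o v t k t' 0
      = true := by
  induction N with
  | zero => omega
  | succ N ih =>
    rw [news_succ] at h
    by_cases e : t' = N
    · subst e
      have e1 : (bif decide (t' = 0) then false else decide (t' = t)) = false := by
        by_cases h0 : t' = 0
        · simp [h0]
        · simp [h0, htt h0]
      rw [e1, cond_false, decide_eq_true hcount, cond_true] at h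
      by_cases e2 : c.m * (k + 1) < c.W
      · refine ⟨e2, ?_⟩
        rw [decide_eq_true e2, cond_true, Bool.cond_eq_true_distrib] at h
        cases su
        · simp only [cond_false, Bool.not_false, cond_true] at h ⊢
          exact (by simpa using h : _ ∧ _).1
        · simp only [cond_true, Bool.not_true, cond_false] at h ⊢
          exact (by simpa using h : _ ∧ _).1
      · rw [decide_eq_false e2, cond_false] at h
        cases h
    · apply ih _ (by omega)
      generalize c.news rec T I k LU LW cU cW A B o v t su N = b at h ⊢
      cases b
      · simp [Bool.cond_eq_ite] at h
      · rfl

end Cfg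
variable {V : Type*}
namespace Cfg

variable {c : Cfg} {G : SimpleGraph V} {T : ℕ} {side : V → Bool}
  {ρ : ℕ → G ≃g G} {n : ℕ} {I k LU LW cU cW : ℕ} {x : ℕ → V}

theorem Inv.body_false (h : c.Inv side ρ T I k LU LW cU cW x) (hc : c.Wf)
    (ht : c.Target G side ρ n) {rec : Rec}
    (hrec : ∀ T I k LU LW cU cW A B x, c.Inv side ρ T I k LU LW cU cW x →
      rec T I k LU LW cU cW A B ≠ true) (A B : ℕ) :
    c.body rec T I k LU LW cU cW A B ≠ true := by
  simp only [body, frc_eq, Nat.mul_eq, tb_eq]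
  cases hAB : Nat.beq (Nat.lor A B) 0
  swap
  · rw [cond_true]
    exact h.leaf_false hc ht
  rw [cond_false]
  generalize low (bif Nat.beq B 0 then A else B) = o
  intro hcon
  have hpo : pop3 (c.row T (c.m * o)) ≠ true ∧ o < k := by
    constructor
    · intro e
      rw [e] at hcon
      cases hcon
    · by_contra hle
      have e : Nat.ble k o = true := by rw [nble_eq]; simpa using hle
      rw [e] at hcon
      cases e2 : pop3 (c.row T (c.m * o)) <;> rw [e2] at hcon <;> cases hcon
  obtain ⟨hp, ho⟩ := hpo
  have e : Nat.ble k o = false := by rw [nble_eq]; simpa using ho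
  rw [eq_false_of_ne_true hp, e, cond_false, cond_false] at hcon
  obtain ⟨hvL, hxv⟩ := h.lab.exists_base hc ht ho
  obtain ⟨y, hy, hynew⟩ := h.emb.exists_new hc ht.cubic hp
  have hside : side y = !side (x o) := by rw [ht.adj_side _ _ hy, hxv]
  have hLU := h.lab.bitU_iff ht hvL
  rw [hxv] at hLU
  have hcands : c.cands rec T I k LU LW cU cW A B o (c.m * o) (ty I o) 128
      (andNot (bif LU.testBit (c.m * o) then LW else LU)
        (c.ball (c.avoid (c.m * o)) T c.G4 (c.row T (c.m * o)))) = true := by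
    generalize c.cands rec T I k LU LW cU cW A B o (c.m * o) (ty I o) 128 _ = b at hcon ⊢
    cases b
    exacts [hcon, rfl]
  rw [hcands, cond_true] at hcon
  by_cases hyL : ∃ l ∈ labels LU LW, c.vert ρ x l = y
  · obtain ⟨l, hl, rfl⟩ := hyL
    have hl' := (h.lab.mem l).1 hl
    have hm := Nat.mod_lt l hc.m_pos
    have hrow : c.E T (c.m * o) l → False := fun hE => hynew l hE rfl
    have hadj : G.Adj (x o) (ρ (l % c.m) (x (l / c.m))) := by rw [← hxv]; exact hy
    rcases cands_spec hcands l (by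
      rw [testBit_andNot, Bool.and_eq_true]
      constructor
      · rw [hLU]
        have := h.lab.bitU_iff ht hl
        rw [hside] at this
        cases e : side (x o)
        · rw [e] at this; exact this
        · rw [e] at this; exact hl.resolve_left (by simp [this])
      · rw [eq_false_of_ne_true (h.not_mem_ball hc ht hvL hl hy fun s hs => ?_)]
        · rfl
        · rw [hc.testBit_row] at hs
          exact ⟨hs, fun e => hrow (e ▸ hs)⟩) with h3 | h3
    · obtain ⟨b, hb, e⟩ := h.emb.full hc ht.cubic h3 hy.symm
      rw [h.emb.inj (h.emb.mem _ _ hb) hvL e] at hb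
      exact hrow (h.emb.symm _ _ hb)
    · exact h.child_false hc ht (fun T A B hI => hrec T I k LU LW cU cW A B x hI) ho hl'.1 hm hadj
        A B h3
  · push Not at hyL
    obtain ⟨t', ht', hty⟩ := ht.types y
    have hlab := h.lab.new hc ht hyL ht' hty
    have hle := hlab.card_le hc ht
    have hhi := ht.le_hi
    rw [hside, Bool.cond_not, Bool.cond_not, Bool.cond_not, Bool.cond_not] at hlab
    rw [hside, Bool.cond_not, Bool.cond_not] at hle
    rw [hLU] at hcon
    have htt : t' ≠ 0 → t' ≠ ty I o := by
      rintro h0 rfl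
      obtain ⟨i, hi, hi0, hci⟩ := hc.stab _ ht' h0
      have hz := hc.can_zero _ ht'
      have h1 := (hty i hi 0 hc.m_pos).2 (by rw [hci, hz])
      have h2 := (h.lab.ty_spec o ho i hi 0 hc.m_pos).2 (by rw [hci, hz])
      rw [ht.rho_zero] at h1 h2
      rw [hxv] at hy
      exact hi0 (ht.rigid i hi _ _ hy h2 h1)
    have hspec := news_spec hcon t' ht' htt (by
      cases e : side (x o) <;> simp only [e, cond_true, cond_false] at hle ⊢ <;> omega)
    rw [Bool.cond_not, Bool.cond_not, Bool.cond_not, Bool.cond_not] at hspec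
    obtain ⟨hlt, hchild⟩ := hspec
    have hinv := h.new hlab hc (by
      rintro a (ha | ha)
      · left
        cases side (x o)
        · simp [ha]
        · exact ha
      · right
        cases side (x o)
        · exact ha
        · simp [ha]) hlt
    have hto := ty_add_lt (I := I) (t' := t') ho
    have htk := ty_add_self (t' := t') h.lab.I_lt (ht'.trans_le hc.nt_le)
    have hno := hinv.child_false (o := o) hc ht
      (fun T A B hI => hrec T _ _ _ _ _ _ A B _ hI) (by omega) (Nat.lt_succ_self k) hc.m_pos (by
        rw [Function.update_self, Function.update_of_ne (by omega), ht.rho_zero, ← hxv]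
        exact hy) A B
    rw [hto, htk] at hno
    exact hno hchild

theorem Inv.dfs_false (hc : c.Wf) (ht : c.Target G side ρ n) (fuel : ℕ) :
    ∀ T I k LU LW cU cW A B x, c.Inv side ρ T I k LU LW cU cW x →
      c.dfs fuel T I k LU LW cU cW A B ≠ true := by
  induction fuel with
  | zero => intros; exact Bool.false_ne_true
  | succ fuel ih => exact fun T I k LU LW cU cW A B x h => h.body_false hc ht ih A B

/-- A successful search excludes the graphs with a vertex of the given type. -/
theorem Target.false_of_start (ht : c.Target G side ρ n) (hc : c.Wf) {t : ℕ} (ht' : t < c.nt)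
    (hs : c.start t = true) {v : V} (hv : side v = true)
    (hty : ∀ i < c.m, ∀ j < c.m, ρ i v = ρ j v ↔ c.can t i = c.can t j) : False := by
  have h0 : c.Lab side ρ 0 0 0 0 0 0 fun _ => v := by
    constructor <;> simp [bits]
  have h1 := h0.new hc ht (y := v) (by simp [labels]) ht' hty
  simp only [hv, cond_true] at h1
  refine Inv.dfs_false hc ht 64 0 t 1 (c.cm t) 0 (c.sz t) 0 1 0 (fun _ => v) ?_ hs
  have e1 : 0 + Nat.shiftLeft t (4 * 0) = t := by simp
  have e2 : Nat.lor 0 (Nat.shiftLeft (c.cm t) (c.m * 0)) = c.cm t := by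
    apply Nat.eq_of_testBit_eq; intro i; simp
  have e3 : Function.update (fun _ => v) 0 v = fun _ : ℕ => v := by simp
  rw [e1, e2, e3, zero_add, zero_add] at h1
  have hE : ∀ a b, ¬ c.E 0 a b := by simp [E]
  refine ⟨h1, ⟨?_, h1.inj hc, ?_, ?_, ?_, ?_⟩, one_pos, by simpa using hc.m_lt⟩
  · intro a ha
    have h2 := (Nat.div_lt_iff_lt_mul hc.m_pos).1 ((h1.mem a).1 ha).1
    have := hc.m_lt
    omega
  all_goals exact fun a b h => absurd h (hE a b)

end Cfg

/-! ### Cubic bipartite graphs whose automorphisms are transitive on the edges -/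

section Auts

variable {V : Type*} {G : SimpleGraph V}

theorem aut_pow_apply (g : G ≃g G) (k : ℕ) (v : V) : (g ^ k) v = g^[k] v := by
  induction k generalizing v with
  | zero => rfl
  | succ k ih => rw [pow_succ, RelIso.mul_apply, ih, Function.iterate_succ_apply]

theorem adj_apply (g : G ≃g G) {v w : V} (h : G.Adj v w) : G.Adj (g v) (g w) :=
  g.map_rel_iff.2 h

theorem pow_apply_of_fixed (g : G ≃g G) (k : ℕ) {v : V} (h : g v = v) : (g ^ k) v = v := by
  rw [aut_pow_apply]
  exact Function.iterate_fixed h k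

theorem inv_apply_of_apply (g : G ≃g G) {v w : V} (h : g v = w) : g⁻¹ w = v := by
  rw [← h, RelIso.inv_apply_self]

theorem mul_self_of_order {H : Type*} [Group H] {a : H} (ha : orderOf a = 3) : a * a = a⁻¹ := by
  rw [eq_inv_iff_mul_eq_one, ← pow_two, ← pow_succ]
  exact orderOf_dvd_iff_pow_eq_one.1 ha.dvd

theorem inter_apply (φ : G ≃g G) (R : ℕ) (x y : V) : inter G R (φ x) (φ y) = inter G R x y := by
  have key : ∀ z, φ '' Reach G.Adj (fun _ => True) {z} R
      = Reach G.Adj (fun _ => True) {φ z} R := by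
    intro z
    rw [Reach.image_eq (R' := G.Adj) (fun _ _ h => adj_apply φ h), Set.image_singleton]
    intro i _ a _ y hy
    refine ⟨φ⁻¹ y, ?_, φ.apply_inv_self y⟩
    have := adj_apply φ⁻¹ hy
    rwa [RelIso.inv_apply_self] at this
  rw [inter, inter, ← key, ← key, ← Set.image_inter φ.injective,
    Set.ncard_image_of_injective _ φ.injective]

/-- An automorphism whose order has no small divisors fixes the points of small invariant sets. -/
theorem fix_of_mem_small (g : G ≃g G) {N k : ℕ} (hN : g ^ N = 1)
    (hd : ∀ d ≤ k, d ∣ N → d = 1) {S : Set V} (hS : S.ncard ≤ k) (hfin : S.Finite)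
    (hg : ∀ x ∈ S, g x ∈ S) {x : V} (hx : x ∈ S) : g x = x := by
  have hper : Function.IsPeriodicPt g N x := by
    rw [Function.IsPeriodicPt, Function.IsFixedPt, ← aut_pow_apply, hN]
    rfl
  have h1 : Function.minimalPeriod g x = 1 := by
    refine hd _ ?_ hper.minimalPeriod_dvd
    refine le_trans ?_ hS
    have : (Set.Iio (Function.minimalPeriod g x)).ncard = Function.minimalPeriod g x := by
      rw [← Finset.coe_Iio, Set.ncard_coe_finset, Nat.card_Iio]
    rw [← this]
    refine Set.ncard_le_ncard_of_injOn (fun i => g^[i] x) ?_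
      Function.iterate_injOn_Iio_minimalPeriod hfin
    rintro i -
    induction i with
    | zero => exact hx
    | succ i ih => simpa only [Function.iterate_succ_apply'] using hg _ ih
  have h2 := Function.isPeriodicPt_minimalPeriod g x
  rw [h1] at h2
  exact h2

end Auts

/-- A connected cubic bipartite graph with sides `side` whose automorphisms preserve the sides and
are transitive on the edges. -/
structure Semi {V : Type*} (G : SimpleGraph V) (side : V → Bool) : Prop where
  finite : Finite V
  cubic : ∀ v, (G.neighborSet v).ncard = 3
  adj_side : ∀ v w, G.Adj v w → side w = !side v
  side_aut : ∀ (φ : G ≃g G) v, side (φ v) = side v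
  conn : G.Preconnected
  trans : ∀ u w u' w', G.Adj u w → G.Adj u' w' → side u = side u' →
    ∃ φ : G ≃g G, φ u = u' ∧ φ w = w'

namespace Semi

variable {V : Type*} {G : SimpleGraph V} {side : V → Bool}

/-- Three neighbours of `v` which are distinct are all the neighbours. -/
theorem nbr (hs : Semi G side) {v x y z : V} (hx : G.Adj v x) (hy : G.Adj v y) (hz : G.Adj v z)
    (hxy : x ≠ y) (hxz : x ≠ z) (hyz : y ≠ z) {w : V} (hw : G.Adj v w) :
    w = x ∨ w = y ∨ w = z := by
  have := hs.finite
  have h3 : ({x, y, z} : Set V).ncard = 3 := Set.ncard_eq_three.2 ⟨x, y, z, hxy, hxz, hyz, rfl⟩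
  have hsub : ({x, y, z} : Set V) ⊆ G.neighborSet v := by
    rintro a (rfl | rfl | rfl)
    exacts [hx, hy, hz]
  have := Set.eq_of_subset_of_ncard_le hsub (by rw [h3, hs.cubic]) (Set.toFinite _)
  have hw' : w ∈ ({x, y, z} : Set V) := by rw [this]; exact hw
  simpa using hw'

theorem exists_nbrs (hs : Semi G side) (v : V) : ∃ x y z, G.Adj v x ∧ G.Adj v y ∧ G.Adj v z ∧
    x ≠ y ∧ x ≠ z ∧ y ≠ z := by
  obtain ⟨x, y, z, hxy, hxz, hyz, h⟩ := Set.ncard_eq_three.1 (hs.cubic v)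
  refine ⟨x, y, z, ?_, ?_, ?_, hxy, hxz, hyz⟩ <;> rw [← SimpleGraph.mem_neighborSet, h] <;> simp

theorem exists_adj (hs : Semi G side) (v : V) : ∃ x, G.Adj v x :=
  let ⟨x, _, _, h, _⟩ := hs.exists_nbrs v
  ⟨x, h⟩

/-- Two neighbours of `v` have a third companion. -/
theorem exists_third (hs : Semi G side) (v : V) {x y : V} (hxy : x ≠ y) : ∃ z, G.Adj v z ∧ x ≠ z ∧ y ≠ z := by
  by_contra! h
  have : (G.neighborSet v) ⊆ {x, y} := by
    intro z hz
    by_cases h1 : x = z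
    · simp [h1]
    · simp [h z hz h1]
  have := Set.ncard_le_ncard this
  rw [hs.cubic, Set.ncard_pair hxy] at this
  omega

theorem apply_of_adj (hs : Semi G side) {v x y : V} (hx : G.Adj v x) (hy : G.Adj v y) :
    side x = side y := by
  rw [hs.adj_side _ _ hx, hs.adj_side _ _ hy]

/-- The automorphisms are transitive on the paths of length two with centre on a given side. -/
theorem trans_path (hs : Semi G side) {u u' x y x' y' : V} (hu : side u = side u')
    (hx : G.Adj u x) (hy : G.Adj u y) (hxy : x ≠ y) (hx' : G.Adj u' x') (hy' : G.Adj u' y')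
    (hxy' : x' ≠ y') : ∃ φ : G ≃g G, φ u = u' ∧ (φ x = x' ∧ φ y = y' ∨ φ x = y' ∧ φ y = x') := by
  obtain ⟨z, hz, hxz, hyz⟩ := hs.exists_third u hxy
  obtain ⟨z', hz', hxz', hyz'⟩ := hs.exists_third u' hxy'
  obtain ⟨φ, hφ, hφz⟩ := hs.trans _ _ _ _ hz hz' hu
  have h1 : ∀ a, G.Adj u a → a ≠ z → φ a = x' ∨ φ a = y' := by
    intro a ha haz
    have h2 := adj_apply φ ha
    rw [hφ] at h2
    rcases hs.nbr hx' hy' hz' hxy' hxz' hyz' h2 with h | h | h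
    · exact Or.inl h
    · exact Or.inr h
    · exact absurd (φ.injective (h.trans hφz.symm)) haz
  have hne : φ x ≠ φ y := fun h => hxy (φ.injective h)
  refine ⟨φ, hφ, ?_⟩
  rcases h1 x hx hxz with h3 | h3 <;> rcases h1 y hy hyz with h4 | h4
  · exact absurd (h3.trans h4.symm) hne
  · exact Or.inl ⟨h3, h4⟩
  · exact Or.inr ⟨h3, h4⟩
  · exact absurd (h3.trans h4.symm) hne

theorem hom (hs : Semi G side) (R : ℕ) (u u' x y x' y' : V) (hu : side u = side u')
    (hx : G.Adj u x) (hy : G.Adj u y) (hxy : x ≠ y) (hx' : G.Adj u' x') (hy' : G.Adj u' y')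
    (hxy' : x' ≠ y') : inter G R x y = inter G R x' y' := by
  obtain ⟨φ, -, ⟨h1, h2⟩ | ⟨h1, h2⟩⟩ := hs.trans_path hu hx hy hxy hx' hy' hxy'
  · rw [← h1, ← h2, inter_apply]
  · rw [← h1, ← h2, inter_apply, inter, inter, Set.inter_comm]

/-- A property which spreads to neighbours holds everywhere. -/
theorem spread (hs : Semi G side) {p : V → Prop} {v₀ : V} (h₀ : p v₀)
    (hp : ∀ v w, p v → G.Adj v w → p w) (v : V) : p v := by
  obtain ⟨W⟩ := hs.conn v₀ v
  induction W with
  | nil => exact h₀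
  | cons h _ ih => exact ih (hp _ _ h₀ h)

theorem eq_one_of_spread (hs : Semi G side) (g : G ≃g G) {p : V → Prop} {v₀ : V} (h₀ : p v₀)
    (hp : ∀ v w, p v → G.Adj v w → p w) (hfix : ∀ v, p v → g v = v) : g = 1 := by
  ext v
  exact hfix v (hs.spread h₀ hp v)

/-- An automorphism fixing a vertex whose order is coprime to `6` is trivial. -/
theorem eq_one_of_fixed (hs : Semi G side) (g : G ≃g G) {N : ℕ} (hN : g ^ N = 1)
    (hd : ∀ d ≤ 3, d ∣ N → d = 1) {v : V} (hv : g v = v) : g = 1 := by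
  have := hs.finite
  refine hs.eq_one_of_spread g (p := fun v => g v = v) hv (fun v w hv hw => ?_) fun _ => id
  refine fix_of_mem_small g hN hd (hs.cubic v).le (Set.toFinite _) (fun x hx => ?_) hw
  have := adj_apply g hx
  rwa [hv] at this

/-- An automorphism of odd order fixing two adjacent vertices is trivial. -/
theorem eq_one_of_fixed_adj (hs : Semi G side) (g : G ≃g G) {N : ℕ} (hN : g ^ N = 1)
    (hd : ∀ d ≤ 2, d ∣ N → d = 1) {v w : V} (hvw : G.Adj v w) (hv : g v = v) (hw : g w = w) :
    g = 1 := by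
  have := hs.finite
  have key : ∀ a b, G.Adj a b → g a = a → g b = b → ∀ c, G.Adj a c → g c = c := by
    intro a b hab ha hb c hc
    by_cases hcb : c = b
    · rw [hcb, hb]
    refine fix_of_mem_small g hN hd (S := G.neighborSet a \ {b}) ?_ (Set.toFinite _) ?_
      ⟨hc, hcb⟩
    · rw [Set.ncard_sdiff_singleton_of_mem (show b ∈ G.neighborSet a from hab), hs.cubic]
    · rintro x ⟨hx, hxb⟩
      have := adj_apply g hx
      rw [ha] at this
      exact ⟨this, fun h => hxb (g.injective (h.trans hb.symm))⟩
  refine hs.eq_one_of_spread g (p := fun v => g v = v ∧ ∀ w, G.Adj v w → g w = w) (v₀ := v)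
    ⟨hv, key v w hvw hv hw⟩ (fun a b ha hab => ?_) fun _ h => h.1
  exact ⟨ha.2 b hab, key b a hab.symm (ha.2 b hab) ha.1⟩

/-- The sides have the same size. -/
theorem card_side_eq (hs : Semi G side) (b : Bool) :
    {v | side v = b}.ncard = {v | side v = true}.ncard := by
  classical
  have := hs.finite
  have := Fintype.ofFinite V
  cases b
  swap
  · rfl
  have h1 : ∀ b, {v | side v = b}.ncard = (Finset.univ.filter fun v => side v = b).card := by
    intro b
    rw [← Set.ncard_coe_finset]
    congr 1
    ext v
    simp
  rw [h1, h1]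
  have := Finset.card_mul_eq_card_mul (m := 3) (n := 3) G.Adj
    (s := Finset.univ.filter fun v => side v = false)
    (t := Finset.univ.filter fun v => side v = true) ?_ ?_
  · omega
  · intro a ha
    rw [← hs.cubic a, ← Set.ncard_coe_finset]
    congr 1
    ext w
    simp only [Finset.mem_filter, Finset.mem_univ, true_and] at ha
    simp only [Finset.coe_bipartiteAbove, Finset.mem_filter, Finset.mem_univ, true_and,
      Set.mem_ofPred_eq, SimpleGraph.mem_neighborSet, and_iff_right_iff_imp]
    intro h
    rw [hs.adj_side _ _ h, ha]; rfl
  · intro a ha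
    rw [← hs.cubic a, ← Set.ncard_coe_finset]
    congr 1
    ext w
    simp only [Finset.mem_filter, Finset.mem_univ, true_and] at ha
    simp only [Finset.coe_bipartiteBelow, Finset.mem_filter, Finset.mem_univ, true_and,
      Set.mem_ofPred_eq, SimpleGraph.mem_neighborSet, G.adj_comm w a, and_iff_right_iff_imp]
    intro h
    rw [hs.adj_side _ _ h, ha]; rfl

/-- Three times the size of a side divides the number of automorphisms. -/
theorem dvd_card (hs : Semi G side) {u₀ : V} (h₀ : side u₀ = true) :
    3 * {v | side v = true}.ncard ∣ Nat.card (G ≃g G) := by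
  classical
  have := hs.finite
  have := Fintype.ofFinite V
  obtain ⟨w₀, hw₀⟩ := hs.exists_adj u₀
  have h1 := Nat.card_congr (MulAction.orbitProdStabilizerEquivGroup (G ≃g G) (u₀, w₀))
  rw [Nat.card_prod] at h1
  refine Dvd.intro (Nat.card (MulAction.stabilizer (G ≃g G) (u₀, w₀))) ?_
  rw [← h1]
  congr 1
  have h2 : ∀ p : V × V, p ∈ MulAction.orbit (G ≃g G) (u₀, w₀)
      ↔ p ∈ ((Finset.univ.filter fun v => side v = true).sigma
        (fun v => (G.neighborSet v).toFinset)).image fun q => (q.1, q.2) := by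
    rintro ⟨u, w⟩
    simp only [Finset.mem_image, Finset.mem_sigma, Finset.mem_filter, Finset.mem_univ, true_and,
      Set.mem_toFinset, SimpleGraph.mem_neighborSet, Prod.mk.injEq, Sigma.exists]
    constructor
    · rintro ⟨φ, hφ⟩
      have h3 : φ u₀ = u ∧ φ w₀ = w := by simpa using hφ
      exact ⟨u, w, ⟨by rw [← h3.1, hs.side_aut, h₀], by
        rw [← h3.1, ← h3.2]; exact adj_apply φ hw₀⟩, rfl, rfl⟩
    · rintro ⟨a, b, ⟨h3, h4⟩, rfl, rfl⟩
      obtain ⟨φ, hφ⟩ := hs.trans _ _ _ _ hw₀ h4 (h₀.trans h3.symm)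
      exact ⟨φ, by simpa using hφ⟩
  have h3 : (MulAction.orbit (G ≃g G) (u₀, w₀)) = (((Finset.univ.filter fun v => side v = true).sigma
        (fun v => (G.neighborSet v).toFinset)).image fun q => (q.1, q.2) : Finset (V × V)) := by
    ext p; rw [h2]; rfl
  rw [Nat.card_coe_set_eq, h3, Set.ncard_coe_finset,
    Finset.card_image_of_injective, Finset.card_sigma]
  · rw [Finset.sum_congr rfl fun v _ => show (G.neighborSet v).toFinset.card = 3 by
      rw [← hs.cubic v, Set.ncard_eq_toFinset_card'], Finset.sum_const, smul_eq_mul, mul_comm]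
    congr 1
    rw [← Set.ncard_coe_finset]
    congr 1
    ext v
    simp
  · rintro ⟨a, b⟩ ⟨a', b'⟩ h
    simp only [Prod.mk.injEq] at h
    obtain ⟨rfl, rfl⟩ := h
    rfl

/-- Every vertex is fixed by an automorphism of order `3`. -/
theorem exists_rot (hs : Semi G side) (u : V) : ∃ a : G ≃g G, orderOf a = 3 ∧ a u = u := by
  classical
  have := hs.finite
  have := Fintype.ofFinite V
  have : Finite (G ≃g G) := DFunLike.finite _
  obtain ⟨w, hw⟩ := hs.exists_adj u
  set A := MulAction.stabilizer (G ≃g G) u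
  have h1 := Nat.card_congr (MulAction.orbitProdStabilizerEquivGroup A w)
  have h2 : MulAction.orbit A w = G.neighborSet u := by
    ext x
    constructor
    · rintro ⟨⟨φ, hφ⟩, rfl⟩
      have hφ' : φ u = u := hφ
      have := adj_apply φ hw
      rwa [hφ'] at this
    · intro hx
      obtain ⟨φ, h3, h4⟩ := hs.trans _ _ _ _ hw hx rfl
      exact ⟨⟨φ, h3⟩, h4⟩
  rw [Nat.card_prod, Nat.card_congr (Equiv.setCongr h2), Nat.card_coe_set_eq, hs.cubic] at h1
  obtain ⟨⟨a, ha⟩, h3⟩ := exists_prime_orderOf_dvd_card' 3 (Dvd.intro _ h1)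
  exact ⟨a, by rw [← h3, ← Subgroup.orderOf_coe], ha⟩

/-- An automorphism of order `3` fixing `u` permutes the neighbours of `u` cyclically. -/
theorem rot_ne (hs : Semi G side) {a : G ≃g G} (ha : orderOf a = 3) {u w : V} (hu : a u = u)
    (hw : G.Adj u w) : a w ≠ w := by
  intro h
  have h1 := hs.eq_one_of_fixed_adj a (N := 3) (by rw [← ha]; exact pow_orderOf_eq_one a)
    (by decide) hw hu h
  rw [h1, orderOf_one] at ha
  omega

end Semi

/-! ### Short cycles -/

/-- There is no cycle of length four. -/
def NoSquare {V : Type*} (G : SimpleGraph V) : Prop :=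
  ∀ v w x y, G.Adj v x → G.Adj w x → G.Adj v y → G.Adj w y → v ≠ w → x = y

/-- `a`, `b`, `c`, `d`, `e` and `f` are the successive vertices of a closed path without
backtracking. -/
structure Hex {V : Type*} (G : SimpleGraph V) (a b c d e f : V) : Prop where
  ab : G.Adj a b
  bc : G.Adj b c
  cd : G.Adj c d
  de : G.Adj d e
  ef : G.Adj e f
  fa : G.Adj f a
  ac : a ≠ c
  bd : b ≠ d
  ce : c ≠ e
  df : d ≠ f
  ea : e ≠ a
  fb : f ≠ b

section

variable {V : Type*} {G : SimpleGraph V} {a b c d e f : V}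

theorem Hex.rot (h : Hex G a b c d e f) : Hex G b c d e f a :=
  ⟨h.bc, h.cd, h.de, h.ef, h.fa, h.ab, h.bd, h.ce, h.df, h.ea, h.fb, h.ac⟩

theorem Hex.rev (h : Hex G a b c d e f) : Hex G f e d c b a :=
  ⟨h.ef.symm, h.de.symm, h.cd.symm, h.bc.symm, h.ab.symm, h.fa.symm, h.df.symm, h.ce.symm,
    h.bd.symm, h.ac.symm, h.fb.symm, h.ea.symm⟩

theorem Hex.map (h : Hex G a b c d e f) (φ : G ≃g G) :
    Hex G (φ a) (φ b) (φ c) (φ d) (φ e) (φ f) :=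
  ⟨adj_apply φ h.ab, adj_apply φ h.bc, adj_apply φ h.cd, adj_apply φ h.de, adj_apply φ h.ef,
    adj_apply φ h.fa, φ.injective.ne h.ac, φ.injective.ne h.bd, φ.injective.ne h.ce,
    φ.injective.ne h.df, φ.injective.ne h.ea, φ.injective.ne h.fb⟩

end

theorem Reach.cases_head {α : Type*} {R : α → α → Prop} {p : α → Prop} {S : Set α} {r : ℕ} {x : α}
    (hx : x ∈ Reach R p S (r + 1)) : x ∈ S ∨ p x ∧ ∃ a ∈ Reach R p S r, R a x := by
  induction r with
  | zero => exact hx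
  | succ r ih =>
    rcases hx with hx | hx
    · rcases ih hx with h | ⟨h1, a, ha, hax⟩
      · exact Or.inl h
      · exact Or.inr ⟨h1, a, Or.inl ha, hax⟩
    · exact Or.inr hx

namespace Semi

variable {V : Type*} {G : SimpleGraph V} {side : V → Bool}

theorem not_adj (hs : Semi G side) {v w : V} (h : side v = side w) : ¬ G.Adj v w := by
  intro hvw
  have := hs.adj_side _ _ hvw
  rw [h] at this
  cases h' : side w <;> simp [h'] at this

/-- A commutative group of automorphisms which is transitive on both sides yields an automorphism
interchanging the sides. -/
theorem false_of_comm (hs : Semi G side) (h4 : NoSquare G) {T : Subgroup (G ≃g G)}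
    (hT : ∀ s ∈ T, ∀ t ∈ T, s * t = t * s) {u₀ w₀ : V} (h₀ : side w₀ = !side u₀)
    (htr : ∀ v, (∃ t ∈ T, t u₀ = v) ∨ ∃ t ∈ T, t w₀ = v) : False := by
  have := hs.finite
  have hex : ∀ v, ∃ x, ∃ t ∈ T, t u₀ = v ∧ t⁻¹ w₀ = x ∨ t w₀ = v ∧ t⁻¹ u₀ = x := by
    intro v
    rcases htr v with ⟨t, ht, h⟩ | ⟨t, ht, h⟩
    exacts [⟨_, t, ht, Or.inl ⟨h, rfl⟩⟩, ⟨_, t, ht, Or.inr ⟨h, rfl⟩⟩]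
  choose φ t ht hφ using hex
  have hside : ∀ v, side (φ v) = !side v := by
    intro v
    rcases hφ v with ⟨h1, h2⟩ | ⟨h1, h2⟩
    · rw [← h2, hs.side_aut, ← congrArg side h1, hs.side_aut, h₀]
    · rw [← h2, hs.side_aut, ← congrArg side h1, hs.side_aut, h₀, Bool.not_not]
  have hone : ∀ v x, t v u₀ = v → (t v)⁻¹ w₀ = φ v → t x w₀ = x → (t x)⁻¹ u₀ = φ x →
      (G.Adj (φ v) (φ x) ↔ G.Adj v x) := by
    intro v x h1 h2 h3 h4
    have e1 : (t v * t x) (φ v) = x := by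
      rw [← h2, hT _ (ht v) _ (ht x), RelIso.mul_apply, RelIso.apply_inv_self, h3]
    have e2 : (t v * t x) (φ x) = v := by
      rw [← h4, RelIso.mul_apply, RelIso.apply_inv_self, h1]
    have h5 := (t v * t x).map_rel_iff (a := φ v) (b := φ x)
    rw [e1, e2, G.adj_comm] at h5
    exact h5.symm
  have hadj : ∀ v x, G.Adj (φ v) (φ x) ↔ G.Adj v x := by
    intro v x
    have hno : ∀ y, t v y = v → t x y = x → (G.Adj (φ v) (φ x) ↔ G.Adj v x) := by
      intro y h1 h2
      have h3 : side v = side x := by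
        rw [← congrArg side h1, ← congrArg side h2, hs.side_aut, hs.side_aut]
      refine iff_of_false (hs.not_adj ?_) (hs.not_adj h3)
      rw [hside, hside, h3]
    rcases hφ v with ⟨h1, h2⟩ | ⟨h1, h2⟩ <;> rcases hφ x with ⟨h3, h4⟩ | ⟨h3, h4⟩
    · exact hno _ h1 h3
    · exact hone v x h1 h2 h3 h4
    · rw [G.adj_comm, G.adj_comm v, hone x v h3 h4 h1 h2]
    · exact hno _ h1 h3
  have hinj : Function.Injective φ := by
    intro v v' h
    by_contra hne
    obtain ⟨x, y, z, hx, hy, -, hxy, -, -⟩ := hs.exists_nbrs v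
    refine hxy (h4 v v' x y hx ?_ hy ?_ hne)
    · rwa [← hadj, ← h, hadj]
    · rwa [← hadj, ← h, hadj]
  let ψ : G ≃g G := ⟨Equiv.ofBijective φ (Finite.injective_iff_bijective.1 hinj), hadj _ _⟩
  have h1 := hs.side_aut ψ u₀
  exact absurd h1 (ne_of_eq_of_ne (hside u₀) (by simp))

theorem le_inter_one (hs : Semi G side) (h4 : ¬ NoSquare G) (u x y : V) (hx : G.Adj u x)
    (hy : G.Adj u y) (hxy : x ≠ y) : 2 ≤ inter G 1 x y := by
  have := hs.finite
  have key : ∀ v w x y, G.Adj v x → G.Adj w x → G.Adj v y → G.Adj w y → v ≠ w →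
      2 ≤ inter G 1 x y := by
    intro v w x y h1 h2 h3 h4 h5
    rw [← Set.ncard_pair h5]
    refine Set.ncard_le_ncard ?_ (Set.toFinite _)
    rintro a (rfl | rfl)
    exacts [⟨Or.inr ⟨trivial, x, rfl, h1.symm⟩, Or.inr ⟨trivial, y, rfl, h3.symm⟩⟩,
      ⟨Or.inr ⟨trivial, x, rfl, h2.symm⟩, Or.inr ⟨trivial, y, rfl, h4.symm⟩⟩]
  simp only [NoSquare] at h4
  push Not at h4
  obtain ⟨v, w, x', y', h1, h2, h3, h4, h5, h6⟩ := h4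
  by_cases hu : side u = side v
  · rw [hs.hom 1 u v x y x' y' hu hx hy hxy h1 h3 h6]
    exact key _ _ _ _ h1 h2 h3 h4 h5
  · have hu' : side u = side x' := by
      rw [hs.adj_side _ _ h1]
      cases h' : side u <;> cases h'' : side v <;> simp_all
    rw [hs.hom 1 u x' x y v w hu' hx hy hxy h1.symm h2.symm h5]
    exact key _ _ _ _ h1.symm h3.symm h2.symm h4.symm h6

theorem girth_six (hs : Semi G side) (h4 : NoSquare G) (v l : V) (hl : G.Adj v l) :
    l ∉ Reach G.Adj (fun w => w ≠ v) {s | G.Adj v s ∧ s ≠ l} 2 := by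
  intro h
  rcases Reach.cases_head h with h | ⟨-, a, ha, hal⟩
  · exact h.2 rfl
  rcases Reach.cases_head ha with ha | ⟨hav, s, hs', hsa⟩
  · exact hs.not_adj (hs.apply_of_adj ha.1 hl) hal
  · exact hs'.2 (h4 v a s l hs'.1 hsa.symm hl hal hav.symm)

theorem girth_eight (hs : Semi G side) (h4 : NoSquare G) (h6 : ∀ a b c d e f, ¬ Hex G a b c d e f)
    (v l : V) (hl : G.Adj v l) :
    l ∉ Reach G.Adj (fun w => w ≠ v) {s | G.Adj v s ∧ s ≠ l} 4 := by
  intro h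
  rcases Reach.cases_head h with h | ⟨-, a, ha, hal⟩
  · exact h.2 rfl
  rcases Reach.cases_head ha with ha | ⟨hav, b, hb, hba⟩
  · exact hs.not_adj (hs.apply_of_adj ha.1 hl) hal
  have h6' := hs.girth_six h4 v l hl
  rcases Reach.cases_head hb with hb' | ⟨hbv, c, hc, hcb⟩
  · exact hb'.2 (h4 v a b l hb'.1 hba.symm hl hal hav.symm)
  have hbl : b ≠ l := by
    rintro rfl
    exact h6' hb
  rcases Reach.cases_head hc with hc | ⟨hcv, d, hd, hdc⟩
  · have h1 := hs.apply_of_adj hc.1 hl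
    have h2 := hs.adj_side _ _ hcb
    have h3 := hs.adj_side _ _ hba
    have h4 := hs.adj_side _ _ hal
    rw [h3, h2, h1] at h4
    cases h' : side l <;> simp [h'] at h4
  · refine h6 v d c b a l ⟨hd.1, hdc, hcb, hba, hal, hl.symm, hcv.symm, ?_, ?_, hbl, hav,
      hd.2.symm⟩
    · rintro rfl
      exact hd.2 (h4 v a d l hd.1 hba.symm hl hal hav.symm)
    · rintro rfl
      exact hd.2 (h4 v c d l hd.1 hdc.symm hl hal hav.symm)

/-- Two paths of length two with centres on the same side are simultaneously part of hexagons. -/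
theorem exists_hex (hs : Semi G side) {u u' x y x' y' a b c : V} (hu : side u = side u')
    (h : Hex G x u y a b c) (hx' : G.Adj u' x') (hy' : G.Adj u' y') (hxy' : x' ≠ y') :
    ∃ a b c, Hex G x' u' y' a b c := by
  obtain ⟨φ, h0, ⟨h1, h2⟩ | ⟨h1, h2⟩⟩ := hs.trans_path hu h.ab.symm h.bc h.ac hx' hy' hxy'
  · have := h.map φ
    rw [h0, h1, h2] at this
    exact ⟨_, _, _, this⟩
  · have := (h.map φ).rev.rot.rot.rot
    rw [h0, h1, h2] at this
    exact ⟨_, _, _, this⟩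

/-- A path of length two with centre on the side `s` is part of at most one hexagon. -/
def Uniq (G : SimpleGraph V) (side : V → Bool) (s : Bool) : Prop :=
  ∀ x u y a b c a' b' c', side u = s → Hex G x u y a b c → Hex G x u y a' b' c' →
    a = a' ∧ b = b' ∧ c = c'

theorem Uniq.swap (hs : Semi G side) {s : Bool} (h : Uniq G side s) : Uniq G side (!s) := by
  intro u w y b c x b' c' x' hw hh hh'
  have hu : side u = s := by
    rw [hs.adj_side _ _ hh.ab.symm, hw, Bool.not_not]
  have h1 := hh.rot.rot.rot.rot.rot
  have h2 := hh'.rot.rot.rot.rot.rot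
  obtain rfl | hxx := eq_or_ne x x'
  · obtain ⟨-, h3, h4⟩ := h _ _ _ _ _ _ _ _ _ hu h1 h2
    exact ⟨h3, h4, rfl⟩
  exfalso
  obtain ⟨z, hz, huz, hyz⟩ := hs.exists_third w hh.ac
  obtain ⟨a₁, a₂, a₃, h3⟩ := hs.exists_hex rfl hh hh.ab.symm hz huz
  rcases hs.nbr hh.ab h1.ab.symm h2.ab.symm h1.ac.symm h2.ac.symm hxx h3.fa.symm with h4 | rfl | rfl
  · exact h3.fb h4
  · exact hyz (h _ _ _ _ _ _ _ _ _ hu h1 h3.rot.rot.rot.rot.rot).1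
  · exact hyz (h _ _ _ _ _ _ _ _ _ hu h2 h3.rot.rot.rot.rot.rot).1

theorem le_inter_two (hs : Semi G side) (h4 : NoSquare G) {s : Bool} (hun : ¬ Uniq G side s)
    (u x y : V) (hu : side u = s) (hx : G.Adj u x) (hy : G.Adj u y) (hxy : x ≠ y) :
    6 ≤ inter G 2 x y := by
  have := hs.finite
  simp only [Uniq] at hun
  push Not at hun
  obtain ⟨x', u', y', a, b, c, a', b', c', hu', h1, h2, h3⟩ := hun
  rw [hs.hom 2 u u' x y x' y' (hu.trans hu'.symm) hx hy hxy h1.ab.symm h1.bc h1.ac]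
  obtain ⟨z, hz, hxz, hyz⟩ := hs.exists_third u' h1.ac
  have hb : b ≠ b' := by
    rintro rfl
    have e1 := h4 y' b a a' h1.cd h1.de.symm h2.cd h2.de.symm h1.ce
    exact h3 e1 rfl (h4 x' b c c' h1.fa.symm h1.ef h2.fa.symm h2.ef h1.ea.symm)
  have hmem : ∀ v w : V, ∀ p, G.Adj v p → G.Adj p w →
      w ∈ Reach G.Adj (fun _ => True) {v} 2 := fun v w p h1 h2 =>
    Or.inr ⟨trivial, p, Or.inr ⟨trivial, v, rfl, h1⟩, h2⟩
  have hself : ∀ v w, G.Adj v w → v ∈ Reach G.Adj (fun _ => True) {v} 2 :=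
    fun v w h => hmem v v w h h.symm
  have hmid : ∀ v w, G.Adj v w → w ∈ Reach G.Adj (fun _ => True) {v} 2 :=
    fun v w h => Or.inl (Or.inr ⟨trivial, v, rfl, h⟩)
  have hzb : ∀ {a b c}, Hex G x' u' y' a b c → z ≠ b := by
    rintro a b c h rfl
    exact h.bd (h4 y' z u' a h.bc.symm hz.symm h.cd h.de.symm hyz)
  have hub : ∀ {a b c}, Hex G x' u' y' a b c → u' ≠ b := by
    rintro a b c h rfl
    have e1 := hs.apply_of_adj h.cd h.bc.symm
    exact hs.not_adj e1 h.de
  have h6 : ({x', y', u', z, b, b'} : Set V).ncard = 6 := by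
    rw [Set.ncard_insert_of_notMem, Set.ncard_insert_of_notMem, Set.ncard_insert_of_notMem,
      Set.ncard_insert_of_notMem, Set.ncard_pair hb]
    · simp [hzb h1, hzb h2]
    · simp [hz.ne, hub h1, hub h2]
    · simp [h1.bc.ne', hyz, h1.ce, h2.ce]
    · simp [h1.ac, h1.ab.ne, hxz, h1.ea.symm, h2.ea.symm]
  rw [← h6]
  refine Set.ncard_le_ncard ?_ (Set.toFinite _)
  rintro p (rfl | rfl | rfl | rfl | rfl | rfl)
  · exact ⟨hself _ _ h1.ab, hmem _ _ _ h1.bc.symm h1.ab.symm⟩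
  · exact ⟨hmem _ _ _ h1.ab h1.bc, hself _ _ h1.cd⟩
  · exact ⟨hmid _ _ h1.ab, hmid _ _ h1.bc.symm⟩
  · exact ⟨hmem _ _ _ h1.ab hz, hmem _ _ _ h1.bc.symm hz⟩
  · exact ⟨hmem _ _ _ h1.fa.symm h1.ef.symm, hmem _ _ _ h1.cd h1.de⟩
  · exact ⟨hmem _ _ _ h2.fa.symm h2.ef.symm, hmem _ _ _ h2.cd h2.de⟩

/-- An automorphism fixing a path of length two is trivial if there is just one hexagon through
each such path. -/
theorem eq_one_of_uniq (hs : Semi G side) (hun : ∀ s, Uniq G side s)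
    (hex : ∀ x u y, G.Adj u x → G.Adj u y → x ≠ y → ∃ a b c, Hex G x u y a b c) (g : G ≃g G)
    {x u y : V} (hx : G.Adj u x) (hy : G.Adj u y) (hxy : x ≠ y) (gu : g u = u) (gx : g x = x)
    (gy : g y = y) : g = 1 := by
  have hfix : ∀ x u y, G.Adj u x → G.Adj u y → x ≠ y → g u = u → g x = x → g y = y →
      ∀ z, G.Adj u z → g z = z := by
    intro x u y hx hy hxy gu gx gy z hz
    by_cases hzx : z = x
    · rw [hzx, gx]
    by_cases hzy : z = y
    · rw [hzy, gy]
    have h1 := adj_apply g hz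
    rw [gu] at h1
    rcases hs.nbr hx hy hz hxy (Ne.symm hzx) (Ne.symm hzy) h1 with h | h | h
    · exact absurd (g.injective (h.trans gx.symm)) hzx
    · exact absurd (g.injective (h.trans gy.symm)) hzy
    · exact h
  refine hs.eq_one_of_spread g (p := fun v => g v = v ∧ ∀ w, G.Adj v w → g w = w) (v₀ := u)
    ⟨gu, hfix x u y hx hy hxy gu gx gy⟩ ?_ fun _ h => h.1
  rintro v w ⟨gv, hv⟩ hvw
  refine ⟨hv w hvw, ?_⟩
  obtain ⟨p, hp, hwp⟩ : ∃ p, G.Adj v p ∧ p ≠ w := by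
    obtain ⟨p, q, r, hp, hq, -, hpq, -, -⟩ := hs.exists_nbrs v
    by_cases h : p = w
    · exact ⟨q, hq, fun h' => hpq (h.trans h'.symm)⟩
    · exact ⟨p, hp, h⟩
  obtain ⟨a, b, c, h⟩ := hex p v w hp hvw hwp
  have h' := h.map g
  rw [gv, hv p hp, hv w hvw] at h'
  obtain ⟨h1, -, -⟩ := hun _ _ _ _ _ _ _ _ _ _ rfl h' h
  exact hfix v w a hvw.symm h.cd h.bd (hv w hvw) gv h1

/-- If there is exactly one hexagon through each path of length two, there is a commutative
group of automorphisms which is transitive on both sides. -/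
theorem false_of_uniq [Nonempty V] (hs : Semi G side) (h4 : NoSquare G)
    (hun : ∀ s, Uniq G side s)
    (hex : ∀ x u y, G.Adj u x → G.Adj u y → x ≠ y → ∃ a b c, Hex G x u y a b c) : False := by
  obtain ⟨u₀⟩ := ‹Nonempty V›
  obtain ⟨w₀, h₀⟩ := hs.exists_adj u₀
  have h0side := hs.adj_side _ _ h₀
  obtain ⟨a, ha, hau⟩ := hs.exists_rot u₀
  obtain ⟨b', hb', hbw'⟩ := hs.exists_rot w₀
  have haw := hs.rot_ne ha hau h₀
  have cube : ∀ {a : G ≃g G}, orderOf a = 3 → ∀ x, a (a (a x)) = x := by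
    intro a ha x
    rw [← RelIso.mul_apply a a, mul_self_of_order ha, RelIso.inv_apply_self]
  have rot3 : ∀ {a : G ≃g G}, orderOf a = 3 → ∀ {u w}, a u = u → G.Adj u w →
      ∀ x, G.Adj u x → x = w ∨ x = a w ∨ x = a⁻¹ w := by
    intro a ha u w hu hw x hx
    have h1 := hs.rot_ne ha hu hw
    have h2 := adj_apply a hw
    have h3 := adj_apply a⁻¹ hw
    rw [hu] at h2
    rw [inv_apply_of_apply a hu] at h3
    refine hs.nbr hw h2 h3 h1.symm ?_ ?_ hx
    · intro h
      exact h1 (by conv_lhs => rw [h, RelIso.apply_inv_self])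
    · intro h
      have h4 := cube ha w
      rw [h, RelIso.apply_inv_self] at h4
      exact h1 h4
  have hw1 : G.Adj u₀ (a w₀) := by
    have := adj_apply a h₀
    rwa [hau] at this
  obtain ⟨u1, β, γ, H⟩ := hex (a w₀) u₀ w₀ hw1 h₀ haw
  obtain ⟨b, hb, hbw, hbu⟩ : ∃ b : G ≃g G, orderOf b = 3 ∧ b w₀ = w₀ ∧ b u₀ = u1 := by
    rcases rot3 hb' hbw' h₀.symm u1 H.cd with h | h | h
    · exact absurd h H.bd.symm
    · exact ⟨b', hb', hbw', h.symm⟩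
    · exact ⟨b'⁻¹, by rw [orderOf_inv, hb'], inv_apply_of_apply b' hbw', h.symm⟩
  have hau' := inv_apply_of_apply a hau
  have hbw2 := inv_apply_of_apply b hbw
  have hbu' := inv_apply_of_apply b hbu
  have H1 := H.map a⁻¹
  rw [RelIso.inv_apply_self, hau'] at H1
  have H2 := H.map b⁻¹
  rw [hbw2, hbu'] at H2
  have h5 : b⁻¹ β = a⁻¹ w₀ := by
    rcases rot3 ha hau h₀ _ H2.de with h | h | h
    · exact absurd h H2.ce.symm
    · exfalso
      rw [h] at H2
      obtain ⟨-, -, h6⟩ := hun _ _ _ _ _ _ _ _ _ _ rfl H2.rot.rot H.rev.rot.rot.rot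
      have h7 := hs.rot_ne hb hbw h₀.symm
      have h8 : b (b (b u₀)) = u₀ := cube hb u₀
      rw [hbu, ← h6, RelIso.apply_inv_self] at h8
      exact h7 h8
    · exact h
  rw [h5] at H2
  obtain ⟨e1, e2, e3⟩ := hun _ _ _ _ _ _ _ _ _ _ rfl H2.rot.rot H1
  have g1 : (b * a⁻¹) u₀ = u1 := by rw [RelIso.mul_apply, hau', hbu]
  have g2 : (b * a⁻¹) u1 = γ := by rw [RelIso.mul_apply, ← e1, RelIso.apply_inv_self]
  have g3 : (b * a⁻¹) γ = u₀ := by rw [RelIso.mul_apply, ← e3, RelIso.apply_inv_self]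
  have g4 : (b * a⁻¹) w₀ = β := by rw [RelIso.mul_apply, ← h5, RelIso.apply_inv_self]
  have g5 : (b * a⁻¹) β = a w₀ := by rw [RelIso.mul_apply, ← e2, RelIso.apply_inv_self]
  have g6 : (b * a⁻¹) (a w₀) = w₀ := by rw [RelIso.mul_apply, RelIso.inv_apply_self, hbw]
  have g7 : b * a⁻¹ * (b * a⁻¹) * (b * a⁻¹) = 1 := by
    refine hs.eq_one_of_uniq hun hex _ hw1 h₀ haw ?_ ?_ ?_
    · rw [RelIso.mul_apply, RelIso.mul_apply, g1, g2, g3]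
    · rw [RelIso.mul_apply, RelIso.mul_apply, g6, g4, g5]
    · rw [RelIso.mul_apply, RelIso.mul_apply, g4, g5, g6]
  have hcomm : b * a * (a * b) = a * b * (b * a) := by
    have e4 : b * a⁻¹ * b = a * b⁻¹ * a := by
      rw [← mul_inv_eq_one, ← g7]
      group
    calc b * a * (a * b) = b * (a * a) * b := by group
      _ = a * (b * b) * a := by rw [mul_self_of_order ha, mul_self_of_order hb, e4]
      _ = a * b * (b * a) := by group
  have hc : ∀ s ∈ Subgroup.closure {b * a, a * b}, ∀ t ∈ Subgroup.closure {b * a, a * b},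
      s * t = t * s := by
    intro s h1 t h2
    induction h1, h2 using Subgroup.closure_induction₂ with
    | mem x y hx hy =>
      rcases hx with rfl | rfl <;> rcases hy with rfl | rfl
      exacts [rfl, hcomm, hcomm.symm, rfl]
    | one_left x hx => simp
    | one_right x hx => simp
    | mul_left x y z hx hy hz h1 h2 => exact Commute.mul_left h1 h2
    | mul_right x y z hx hy hz h1 h2 => exact Commute.mul_right h1 h2
    | inv_left x y hx hy h => exact Commute.inv_left h
    | inv_right x y hx hy h => exact Commute.inv_right h
  have m1 : b * a ∈ Subgroup.closure {b * a, a * b} := Subgroup.subset_closure (by simp)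
  have m2 : a * b ∈ Subgroup.closure {b * a, a * b} := Subgroup.subset_closure (by simp)
  have n1 : ∀ x, G.Adj u₀ x → ∃ t ∈ Subgroup.closure {b * a, a * b}, t w₀ = x := by
    intro x hx
    rcases rot3 ha hau h₀ x hx with rfl | rfl | rfl
    · exact ⟨1, one_mem _, rfl⟩
    · exact ⟨_, m2, by rw [RelIso.mul_apply, hbw]⟩
    · exact ⟨_, inv_mem m1, by rw [mul_inv_rev, RelIso.mul_apply, hbw2]⟩
  have n2 : ∀ x, G.Adj w₀ x → ∃ t ∈ Subgroup.closure {b * a, a * b}, t u₀ = x := by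
    intro x hx
    rcases rot3 hb hbw h₀.symm x hx with rfl | rfl | rfl
    · exact ⟨1, one_mem _, rfl⟩
    · exact ⟨_, m1, by rw [RelIso.mul_apply, hau]⟩
    · exact ⟨_, inv_mem m2, by rw [mul_inv_rev, RelIso.mul_apply, hau']⟩
  refine hs.false_of_comm h4 hc h0side fun v => ?_
  refine hs.spread (p := fun v => (∃ t ∈ Subgroup.closure {b * a, a * b}, t u₀ = v) ∨
    ∃ t ∈ Subgroup.closure {b * a, a * b}, t w₀ = v)
    (Or.inl ⟨1, one_mem _, rfl⟩) ?_ v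
  rintro v x (⟨t, ht, rfl⟩ | ⟨t, ht, rfl⟩) h
  · have h1 := adj_apply t⁻¹ h
    rw [RelIso.inv_apply_self] at h1
    obtain ⟨s, hs', h2⟩ := n1 _ h1
    exact Or.inr ⟨t * s, mul_mem ht hs', by rw [RelIso.mul_apply, h2, RelIso.apply_inv_self]⟩
  · have h1 := adj_apply t⁻¹ h
    rw [RelIso.inv_apply_self] at h1
    obtain ⟨s, hs', h2⟩ := n2 _ h1
    exact Or.inl ⟨t * s, mul_mem ht hs', by rw [RelIso.mul_apply, h2, RelIso.apply_inv_self]⟩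

end Semi

/-! ### Groups of automorphisms -/

namespace Cfg

/-- The conditions on a graph in a search which do not concern the group. -/
structure Fits {V : Type*} (c : Cfg) (G : SimpleGraph V) (side : V → Bool) : Prop where
  girth : ∀ v l, G.Adj v l → l ∉ Reach G.Adj (fun w => w ≠ v) {s | G.Adj v s ∧ s ≠ l} c.G4
  lo_le : c.lo ≤ {v | side v = true}.ncard
  le_hi : {v | side v = true}.ncard ≤ c.hi
  plo : c.PR ≠ 0 → ∀ u x y, G.Adj u x → G.Adj u y → x ≠ y → c.PLO ≤ inter G c.PR x y

/-- The orbit types of a search account for all subgroups with at most three elements, and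
type `1` is the one of the subgroups containing `e`. -/
structure Subgroups (c : Cfg) (e : ℕ) : Prop where
  cancel : ∀ i < c.m, ∀ k < c.m, c.mul k i = 0 → ∀ j < c.m, c.mul k j = 0 → i = j
  coset : ∀ i < c.m, ∀ k < c.m, c.mul k i = 0 → ∀ j < c.m, ∀ t < c.nt,
    (c.can t (c.mul k j) = 0 ↔ c.can t i = c.can t j)
  subgroup : ∀ S < 2 ^ c.m, S.testBit 0 = true →
    (∀ i < c.m, S.testBit i = true → ∀ j < c.m, S.testBit j = true →
      S.testBit (c.mul i j) = true) →
    ((Finset.range c.m).filter fun i => S.testBit i = true).card ≤ 3 →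
    ∃ t < c.nt, ∀ i < c.m, S.testBit i = decide (c.can t i = 0)
  lt : e < c.m
  type_one : ∀ t < c.nt, c.can t e = 0 → t = 1

end Cfg

namespace Semi

open Cfg

variable {V : Type*} {G : SimpleGraph V} {side : V → Bool} {c : Cfg} {ρ : ℕ → G ≃g G}

theorem target (hs : Semi G side) (hf : c.Fits G side) (h0 : ρ 0 = 1)
    (hmul : ∀ i < c.m, ∀ j < c.m, ρ i * ρ j = ρ (c.mul i j))
    (types : ∀ v, ∃ t < c.nt, ∀ i < c.m, ∀ j < c.m, ρ i v = ρ j v ↔ c.can t i = c.can t j)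
    (rigid : ∀ i < c.m, ∀ v w, G.Adj v w → ρ i v = v → ρ i w = w → i = 0) :
    c.Target G side ρ {v | side v = true}.ncard where
  finite := hs.finite
  cubic := hs.cubic
  adj_side := hs.adj_side
  side_aut := hs.side_aut
  conn := hs.conn
  rho_zero v := by rw [h0]; rfl
  rho_mul i hi j hj v := by rw [← hmul i hi j hj, RelIso.mul_apply]
  types := types
  rigid := rigid
  girth := hf.girth
  card_side := hs.card_side_eq
  lo_le := hf.lo_le
  le_hi := hf.le_hi
  hom := hs.hom
  plo := hf.plo

/-- There is no graph with an automorphism whose order is a prime larger than `3` if the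
corresponding search succeeds. -/
theorem false_of_prime (hs : Semi G side) (hf : c.Fits G side) (hc : c.Wf) (hp : c.m.Prime) (hnt : 0 < c.nt)
    (h3 : 3 < c.m) (hmul : ∀ i j, c.mul i j = (i + j) % c.m) (hcan : ∀ i, c.can 0 i = i)
    (hstart : c.start 0 = true) (hdvd : c.m ∣ {v | side v = true}.ncard) {u : V}
    (hu : side u = true) : False := by
  have := hs.finite
  have : Finite (G ≃g G) := DFunLike.finite _
  have := Fact.mk hp
  obtain ⟨g, hg⟩ := exists_prime_orderOf_dvd_card' (G := G ≃g G) c.m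
    ((hdvd.mul_left 3).trans (hs.dvd_card hu))
  have hfree : ∀ k v, (g ^ k) v = v → c.m ∣ k := by
    intro k v hk
    rw [← hg, orderOf_dvd_iff_pow_eq_one]
    refine hs.eq_one_of_fixed (g ^ k) (N := c.m) ?_ ?_ hk
    · rw [pow_right_comm, ← hg, pow_orderOf_eq_one, one_pow]
    · intro d hd hdm
      rcases (Nat.dvd_prime hp).1 hdm with h | h <;> omega
  have hinj : ∀ i < c.m, ∀ j < c.m, ∀ v, (g ^ i) v = (g ^ j) v → i = j := by
    have : ∀ i j, i ≤ j → i < c.m → j < c.m → ∀ v, (g ^ i) v = (g ^ j) v → i = j := by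
      intro i j hij hi hj v h
      obtain ⟨k, rfl⟩ := Nat.exists_eq_add_of_le hij
      rw [pow_add, RelIso.mul_apply] at h
      have := Nat.eq_zero_of_dvd_of_lt (hfree k v ((g ^ i).injective h).symm) (by omega)
      omega
    intro i hi j hj v h
    rcases le_total i j with h' | h'
    exacts [this i j h' hi hj v h, (this j i h' hj hi v h.symm).symm]
  have hty : ∀ v, ∀ i < c.m, ∀ j < c.m, (g ^ i) v = (g ^ j) v ↔ c.can 0 i = c.can 0 j := by
    intro v i hi j hj
    rw [hcan, hcan]
    exact ⟨hinj i hi j hj v, fun h => by rw [h]⟩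
  refine (hs.target (ρ := fun i => g ^ i) hf (pow_zero g) (fun i _ j _ => ?_)
    (fun v => ⟨0, hnt, hty v⟩) fun i hi v w _ hv _ => ?_).false_of_start hc hnt hstart hu (hty u)
  · rw [hmul, ← pow_add, ← hg, pow_mod_orderOf]
  · exact Nat.eq_zero_of_dvd_of_lt (hfree i v hv) hi

/-- There is no graph with a `3`-group of automorphisms with given properties if the corresponding
search succeeds. -/
theorem false_of_three (hs : Semi G side) (hf : c.Fits G side) (hc : c.Wf) {e : ℕ}
    (he : c.Subgroups e) (hstart : c.start 1 = true) (h0 : ρ 0 = 1)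
    (hmul : ∀ i < c.m, ∀ j < c.m, ρ i * ρ j = ρ (c.mul i j)) (hinj : ∀ i < c.m, ρ i = 1 → i = 0)
    (h9 : ∀ i < c.m, ρ i ^ 9 = 1) {u : V} (hu : side u = true) (heu : ρ e u = u) : False := by
  classical
  have := hs.finite
  have rigid : ∀ i < c.m, ∀ v w, G.Adj v w → ρ i v = v → ρ i w = w → i = 0 :=
    fun i hi v w hvw hv hw => hinj i hi (hs.eq_one_of_fixed_adj (ρ i) (h9 i hi) (by decide) hvw hv hw)
  have hdiv : ∀ i < c.m, ∀ j < c.m, ∀ k < c.m, c.mul k i = 0 → ∀ v,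
      ρ i v = ρ j v ↔ ρ (c.mul k j) v = v := by
    intro i hi j hj k hk hki v
    rw [← hmul k hk j hj, ← (ρ k).injective.eq_iff, ← RelIso.mul_apply, hmul k hk i hi, hki, h0,
      RelIso.mul_apply, eq_comm]
    rfl
  have hty : ∀ v, ∃ t < c.nt, (∀ i < c.m, ρ i v = v ↔ c.can t i = 0) ∧
      ∀ i < c.m, ∀ j < c.m, ρ i v = ρ j v ↔ c.can t i = c.can t j := by
    intro v
    set S := Nat.ofBits fun i : Fin c.m => decide (ρ i v = v) with hS
    have hSb : ∀ i < c.m, S.testBit i = decide (ρ i v = v) :=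
      fun i hi => Nat.testBit_ofBits_lt _ i hi
    obtain ⟨w, hw⟩ := hs.exists_adj v
    have key : ∃ t < c.nt, ∀ i < c.m, S.testBit i = decide (c.can t i = 0) := by
      refine he.subgroup S (Nat.ofBits_lt_two_pow _) ?_ ?_ ?_
      · rw [hSb 0 hc.m_pos, h0, decide_eq_true_iff]
        rfl
      · intro i hi h1 j hj h2
        rw [hSb i hi, decide_eq_true_iff] at h1
        rw [hSb j hj, decide_eq_true_iff] at h2
        rw [hSb _ (hc.mul_lt i hi j hj), decide_eq_true_iff, ← hmul i hi j hj, RelIso.mul_apply, h2,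
          h1]
      · rw [← Set.ncard_coe_finset, ← hs.cubic v]
        refine Set.ncard_le_ncard_of_injOn (fun i => ρ i w) ?_ ?_ (Set.toFinite _)
        · intro i hi
          rw [Finset.mem_coe, Finset.mem_filter, Finset.mem_range] at hi
          obtain ⟨hi, h1⟩ := hi
          rw [hSb i hi, decide_eq_true_iff] at h1
          have h2 := adj_apply (ρ i) hw
          rwa [h1] at h2
        · intro i hi j hj hij
          rw [Finset.mem_coe, Finset.mem_filter, Finset.mem_range] at hi hj
          obtain ⟨hi, h1⟩ := hi
          obtain ⟨hj, h2⟩ := hj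
          rw [hSb i hi, decide_eq_true_iff] at h1
          rw [hSb j hj, decide_eq_true_iff] at h2
          obtain ⟨k, hk, hki⟩ := hc.inv i hi
          have h3 := (hdiv i hi j hj k hk hki w).1 hij
          have h4 := (hdiv i hi j hj k hk hki v).1 (h1.trans h2.symm)
          exact he.cancel i hi k hk hki j hj (rigid _ (hc.mul_lt k hk j hj) v w hw h4 h3)
    obtain ⟨t, ht, h⟩ := key
    have h1 : ∀ i < c.m, ρ i v = v ↔ c.can t i = 0 := by
      intro i hi
      have := h i hi
      rw [hSb i hi] at this
      exact decide_eq_decide.1 this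
    refine ⟨t, ht, h1, fun i hi j hj => ?_⟩
    obtain ⟨k, hk, hki⟩ := hc.inv i hi
    rw [hdiv i hi j hj k hk hki, ← he.coset i hi k hk hki j hj t ht,
      h1 _ (hc.mul_lt k hk j hj)]
  have htgt := hs.target hf h0 hmul (fun v => (hty v).imp fun t h => ⟨h.1, h.2.2⟩) rigid
  obtain ⟨t, ht, h1, h2⟩ := hty u
  obtain rfl := he.type_one t ht ((h1 e he.lt).1 heu)
  exact htgt.false_of_start hc ht hstart hu h2

/-- A group of automorphisms whose order has no small divisors and equals the size of the sides
is not commutative. -/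
theorem false_of_comm_card (hs : Semi G side) (h4 : NoSquare G) {K : Subgroup (G ≃g G)}
    (hK : ∀ s ∈ K, ∀ t ∈ K, s * t = t * s) (hcard : Nat.card K = {v | side v = true}.ncard)
    (hd : ∀ d ≤ 3, d ∣ Nat.card K → d = 1) (u : V) : False := by
  have := hs.finite
  have : Finite (G ≃g G) := DFunLike.finite _
  obtain ⟨w, hw⟩ := hs.exists_adj u
  have h0 := hs.adj_side _ _ hw
  have htr : ∀ u v, side v = side u → ∃ t ∈ K, t u = v := by
    intro u v h
    have hinj : Function.Injective fun k : K => (k : G ≃g G) u := by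
      rintro ⟨k, hk⟩ ⟨l, hl⟩ h
      have h1 : (l⁻¹ * k) u = u := by
        rw [RelIso.mul_apply]
        exact inv_apply_of_apply l h.symm
      have h2 : l⁻¹ * k ∈ K := mul_mem (inv_mem hl) hk
      have h3 := hs.eq_one_of_fixed _ (N := Nat.card K)
        (congrArg Subtype.val (pow_card_eq_one' (x := (⟨_, h2⟩ : K)))) hd h1
      exact Subtype.ext (inv_mul_eq_one.1 h3).symm
    have h1 : Set.range (fun k : K => (k : G ≃g G) u) = {v | side v = side u} := by
      refine Set.eq_of_subset_of_ncard_le ?_ ?_ (Set.toFinite _)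
      · rintro _ ⟨k, rfl⟩
        exact hs.side_aut _ _
      · rw [hs.card_side_eq, ← hcard, ← Set.image_univ, Set.ncard_image_of_injective _ hinj,
          Set.ncard_univ]
    have h2 : v ∈ {v | side v = side u} := h
    rw [← h1] at h2
    obtain ⟨⟨k, hk⟩, rfl⟩ := h2
    exact ⟨k, hk, rfl⟩
  refine hs.false_of_comm h4 hK h0 fun v => ?_
  by_cases h : side v = side u
  · exact Or.inl (htr u v h)
  · refine Or.inr (htr w v ?_)
    rw [h0]
    cases h1 : side v <;> cases h2 : side u <;> simp_all

end Semi
namespace Semi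

open Cfg

variable {V : Type*} {G : SimpleGraph V} {side : V → Bool} {c : Cfg}

/-- The search for graphs with a rotation of order `3` around a vertex. -/
theorem false_of_rot (hs : Semi G side) (hf : c.Fits G side) (hc : c.Wf) (he : c.Subgroups 1)
    (hstart : c.start 1 = true) (hm : c.m = 3) (hmul : ∀ i j, c.mul i j = (i + j) % 3) {u : V}
    (hu : side u = true) : False := by
  obtain ⟨a, ha, hau⟩ := hs.exists_rot u
  have ha3 : a ^ 3 = 1 := orderOf_dvd_iff_pow_eq_one.1 ha.dvd
  refine hs.false_of_three (ρ := fun i => a ^ i) hf hc he hstart (pow_zero a) (fun i _ j _ => ?_)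
    (fun i hi h => ?_) (fun i _ => ?_) hu (by rwa [pow_one])
  · rw [hmul, ← pow_add, ← ha, pow_mod_orderOf]
  · rw [← orderOf_dvd_iff_pow_eq_one, ha] at h
    exact Nat.eq_zero_of_dvd_of_lt h (by omega)
  · rw [← pow_mul, show i * 9 = 3 * (3 * i) by ring, pow_mul, ha3, one_pow]

/-- The search for graphs with a cyclic group of order `9` which contains a rotation. -/
theorem false_of_cyclic_nine (hs : Semi G side) (hf : c.Fits G side) (hc : c.Wf)
    (he : c.Subgroups 3) (hstart : c.start 1 = true) (hm : c.m = 9)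
    (hmul : ∀ i j, c.mul i j = (i + j) % 9) {u : V} (hu : side u = true) {g : G ≃g G}
    (hg : orderOf g = 9) (hgu : (g ^ 3) u = u) : False := by
  refine hs.false_of_three (ρ := fun i => g ^ i) hf hc he hstart (pow_zero g) (fun i _ j _ => ?_)
    (fun i hi h => ?_) (fun i _ => ?_) hu hgu
  · rw [hmul, ← pow_add, ← hg, pow_mod_orderOf]
  · rw [← orderOf_dvd_iff_pow_eq_one, hg] at h
    exact Nat.eq_zero_of_dvd_of_lt h (by omega)
  · rw [pow_right_comm, ← hg, pow_orderOf_eq_one, one_pow]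

/-- The search for graphs with an elementary abelian group of order `9` which contains a
rotation. -/
theorem false_of_elementary_nine (hs : Semi G side) (hf : c.Fits G side) (hc : c.Wf)
    (he : c.Subgroups 1) (hstart : c.start 1 = true) (hm : c.m = 9)
    (hmul : ∀ i j, c.mul i j = 3 * ((i / 3 + j / 3) % 3) + (i + j) % 3) {u : V}
    (hu : side u = true) {a g : G ≃g G} (ha : orderOf a = 3) (hg : g ^ 3 = 1)
    (hag : Commute g a) (hga : g ∉ Subgroup.zpowers a) (hau : a u = u) : False := by
  have ha3 : a ^ 3 = 1 := orderOf_dvd_iff_pow_eq_one.1 ha.dvd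
  refine hs.false_of_three (ρ := fun i => g ^ (i / 3) * a ^ (i % 3)) hf hc he hstart (by simp)
    (fun i _ j _ => ?_) (fun i hi h => ?_) (fun i _ => ?_) hu (by simpa using hau)
  · have e1 : c.mul i j / 3 = (i / 3 + j / 3) % 3 := by rw [hmul]; omega
    have e2 : c.mul i j % 3 = (i % 3 + j % 3) % 3 := by rw [hmul]; omega
    rw [e1, e2, ← pow_eq_pow_mod (i / 3 + j / 3) hg,
      ← pow_eq_pow_mod (i % 3 + j % 3) ha3, pow_add, pow_add, mul_assoc, mul_assoc,
      ← mul_assoc (a ^ (i % 3)), ← mul_assoc (g ^ (j / 3)), (hag.pow_pow _ _).eq]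
  · rw [hm] at hi
    have hmem : g ^ (i / 3) ∈ Subgroup.zpowers a := by
      rw [mul_eq_one_iff_eq_inv] at h
      rw [h]
      exact inv_mem (Subgroup.npow_mem_zpowers _ _)
    have h3 : i / 3 < 3 := by omega
    have h4 : i / 3 = 0 := by
      generalize i / 3 = k at hmem h3
      interval_cases k
      · rfl
      · exact absurd (by simpa using hmem) hga
      · refine absurd ?_ hga
        have := pow_mem hmem 2
        rwa [← pow_mul, show 2 * 2 = 3 + 1 from rfl, pow_succ, hg, one_mul] at this
    have h5 : i % 3 = 0 := by
      rw [h4, pow_zero, one_mul, ← orderOf_dvd_iff_pow_eq_one, ha] at h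
      omega
    omega
  · rw [(hag.pow_pow _ _).mul_pow, pow_right_comm, pow_right_comm a, show 9 = 3 * 3 from rfl,
      pow_mul, hg, pow_mul, ha3, one_pow, one_pow, one_mul, one_pow]

theorem exists_nine (hs : Semi G side) (h9 : 9 ∣ Nat.card (G ≃g G)) (u : V) :
    (∃ g : G ≃g G, orderOf g = 9 ∧ (g ^ 3) u = u) ∨
    ∃ a g : G ≃g G, orderOf a = 3 ∧ g ^ 3 = 1 ∧ Commute g a ∧ g ∉ Subgroup.zpowers a ∧
      a u = u := by
  have := hs.finite
  have : Finite (G ≃g G) := DFunLike.finite _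
  have : Fact (Nat.Prime 3) := ⟨Nat.prime_three⟩
  obtain ⟨a, ha, hau⟩ := hs.exists_rot u
  obtain ⟨K, hK, haK⟩ := Sylow.exists_subgroup_card_pow_prime_le (G := G ≃g G) 3 (n := 1) (m := 2)
    h9 (Subgroup.zpowers a) (by rw [Nat.card_zpowers, ha, pow_one]) one_le_two
  have hcomm := IsPGroup.isMulCommutative_of_card_eq_prime_sq hK
  have hord : ∀ g ∈ K, orderOf g ∣ 9 := by
    intro g hg
    have := orderOf_dvd_natCard (⟨g, hg⟩ : K)
    rwa [hK, ← Subgroup.orderOf_coe] at this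
  have haK' : a ∈ K := haK (Subgroup.mem_zpowers a)
  by_cases h : ∃ g ∈ K, orderOf g = 9
  · obtain ⟨g, hg, hg9⟩ := h
    refine Or.inl ⟨g, hg9, ?_⟩
    have h1 : Subgroup.zpowers g = K := by
      refine SetLike.coe_injective (Set.eq_of_subset_of_ncard_le ?_ ?_ (Set.toFinite _))
      · exact (Subgroup.zpowers_le.2 hg)
      · rw [← Nat.card_coe_set_eq, ← Nat.card_coe_set_eq]
        change Nat.card K ≤ Nat.card (Subgroup.zpowers g)
        rw [hK, Nat.card_zpowers, hg9]
        norm_num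
    rw [← h1, ← mem_powers_iff_mem_zpowers] at haK'
    obtain ⟨k, rfl⟩ := haK'
    beta_reduce at ha hau
    have h2 : 3 ∣ k := by
      have h3 : (g ^ k) ^ 3 = 1 := orderOf_dvd_iff_pow_eq_one.1 ha.dvd
      rw [← pow_mul, ← orderOf_dvd_iff_pow_eq_one, hg9] at h3
      omega
    obtain ⟨l, rfl⟩ := h2
    have h3 : ¬ 3 ∣ l := by
      rintro ⟨l, rfl⟩
      rw [← mul_assoc, pow_mul, show 3 * 3 = 9 from rfl, ← hg9, pow_orderOf_eq_one, one_pow,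
        orderOf_one] at ha
      omega
    have h4 : (g ^ (3 * l * l)) u = u := by
      rw [pow_mul]
      exact pow_apply_of_fixed _ _ hau
    have h5 : 3 * l * l % 9 = 3 := by
      have : l % 3 = 1 ∨ l % 3 = 2 := by omega
      obtain ⟨q, hq⟩ : ∃ q, l = 3 * q + 1 ∨ l = 3 * q + 2 := ⟨l / 3, by omega⟩
      rcases hq with rfl | rfl
      · ring_nf; omega
      · ring_nf; omega
    rwa [← pow_mod_orderOf, hg9, h5] at h4
  · obtain ⟨g, hg, hga⟩ : ∃ g ∈ K, g ∉ Subgroup.zpowers a := by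
      by_contra! h1
      have := Nat.card_le_card_of_injective (Subgroup.inclusion (K := Subgroup.zpowers a) h1)
        (Subgroup.inclusion_injective _)
      rw [hK, Nat.card_zpowers, ha] at this
      omega
    refine Or.inr ⟨a, g, ha, ?_, ?_, hga, hau⟩
    · obtain ⟨k, hk, h1⟩ := (Nat.dvd_prime_pow Nat.prime_three (m := 2)).1 (hord g hg)
      interval_cases k
      · exact orderOf_dvd_iff_pow_eq_one.1 (h1 ▸ one_dvd _)
      · exact orderOf_dvd_iff_pow_eq_one.1 h1.dvd
      · exact absurd ⟨g, hg, h1⟩ h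
    · exact congrArg Subtype.val (hcomm.is_comm.comm (⟨g, hg⟩ : K) ⟨a, haK'⟩)

/-- Sides of size `25` are permuted regularly by a commutative group. -/
theorem false_of_twentyfive (hs : Semi G side) (h4 : NoSquare G)
    (hn : {v | side v = true}.ncard = 25) {u : V} (hu : side u = true) : False := by
  have := hs.finite
  have : Finite (G ≃g G) := DFunLike.finite _
  have : Fact (Nat.Prime 5) := ⟨Nat.prime_five⟩
  have h1 := hs.dvd_card hu
  rw [hn] at h1
  obtain ⟨K, hK⟩ := Sylow.exists_subgroup_card_pow_prime (G := G ≃g G) 5 (n := 2)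
    ((by norm_num : 5 ^ 2 ∣ 3 * 25).trans h1)
  have hcomm := IsPGroup.isMulCommutative_of_card_eq_prime_sq hK
  refine hs.false_of_comm_card h4 (K := K) (fun s hs t ht => ?_) (by rw [hK, hn]; rfl) ?_ u
  · exact congrArg Subtype.val (hcomm.is_comm.comm (⟨s, hs⟩ : K) ⟨t, ht⟩)
  · rw [hK]
    decide

end Semi
namespace Cfg

/-! ### The searches -/

/-- The addition of the vector space of dimension `2` over the field with `3` elements, whose
elements are written with two digits in base `3`. -/
def elementaryMul (i j : Nat) : Nat :=
  Nat.add (Nat.mul 3 (Nat.mod (Nat.add (Nat.div i 3) (Nat.div j 3)) 3)) (Nat.mod (Nat.add i j) 3)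

/-- The coset representatives for the zero space and the four lines. -/
def elementaryCan (t i : Nat) : Nat :=
  cond (Nat.beq t 0) i
    (cond (Nat.beq t 1) (Nat.mul 3 (Nat.div i 3))
      (cond (Nat.beq t 2) (Nat.mod i 3)
        (cond (Nat.beq t 3) (Nat.mod (Nat.add i (Nat.mul 2 (Nat.div i 3))) 3)
          (Nat.mod (Nat.add i (Nat.div i 3)) 3))))

/-- The masks of the coset representatives for the zero space and the four lines. -/
def elementaryMask (t : Nat) : Nat := cond (Nat.beq t 0) 511 (cond (Nat.beq t 1) 73 7)

/-- The search for graphs with girth `4` and a group of order `3`. -/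
def threeGirthFour : Cfg where
  W := 20
  C1 := 4697094124543723095875808490881856431339101874362878379106802834640869620491401967268674678049059441776001025
  ONE := 2462627735819477471478834772908959182061088422696729859886664622502584576226632519972005200658167352298026533126145
  FM := 1048575
  m := 3
  nt := 2
  mul := fun i j => Nat.mod (Nat.add i j) 3
  can := fun t i => cond (Nat.beq t 0) i 0
  sz := fun t => cond (Nat.beq t 0) 3 1
  cm := fun t => cond (Nat.beq t 0) 7 1
  G4 := 0
  lo := 1
  hi := 26
  PR := 1
  PLO := 2
  LR := 3
  certs :=
    [74438327225261490179, 64928976646428426243, 46116878087308181507]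

theorem threeGirthFour_wf : threeGirthFour.Wf := by constructor <;> decide +kernel

set_option synthInstance.maxSize 1000 in
theorem threeGirthFour_subgroups : threeGirthFour.Subgroups 1 := by constructor <;> decide +kernel

set_option maxRecDepth 100000 in
theorem threeGirthFour_start : threeGirthFour.start 1 = true := by decide +kernel

/-- The search for graphs with girth `6` and a group of order `3`. -/
def threeGirthSix : Cfg where
  W := 38
  C1 := 12884395990036166661342725758887065676886032334477146239097862848374303031744001145634780704420481228146686941085286101942110406568191983880384187181286364727946311836179630489286261465378640700148586004121379569009239317844684525744330333668656558245563251998017364950573556448447875652642281260284932167388208186755053776515571002836013311330319720599383146211858997874823280139427971790013909144899899099185153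
  ONE := 1770817900982961887370478946710886897415191466764922105627525634914552892988910136810442847456464645657195703943330441493238529870148784339583559059865503542891808474722313883843564125811320785328221908317799763041204347205156910677595880978391462864531791845038330280496544476164422151921653417839134177070662438911880361811623221371945090222313267585443170794572113756167847012799391141925744778798253565105634624514555905
  FM := 274877906943
  m := 3
  nt := 2
  mul := fun i j => Nat.mod (Nat.add i j) 3
  can := fun t i => cond (Nat.beq t 0) i 0
  sz := fun t => cond (Nat.beq t 0) 3 1
  cm := fun t => cond (Nat.beq t 0) 7 1
  G4 := 2
  lo := 1
  hi := 26
  PR := 2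
  PLO := 6
  LR := 3
  certs :=
    [448773208963401447860357814026243, 408210865336306406110790638632963,
    327715052220633319552626611716099, 7352698000015375370722047054290354179,
    3032902296775511758769738060328881786514833411, 2497684828775683132928931737331661827827826691,
    2870012954645483140966196195147571143280427011, 2319278181212327834958880006406094076105457667,
    2878277988649648082962797940212886970310852611, 3048397139455372374454121976839904917339504643,
    3053896357716630495546442779984959696709615619, 2497684398012229453336080349367157695262490627,
    2319278958867697989441303806587467172847550467, 2854496073396729768770229983231049045452521475,
    58897192397801171610196642395091555545960455077900,
    58552333509602277565957816687995612433833391030284,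
    12126798423853152146006774680530351698477253132300,
    23544948374656416255883184952779704908314967015442,
    1081662374704498907093336535157805911864508434, 1080279460565920702446786717434179124568522770]

theorem threeGirthSix_wf : threeGirthSix.Wf := by constructor <;> decide +kernel

set_option synthInstance.maxSize 1000 in
theorem threeGirthSix_subgroups : threeGirthSix.Subgroups 1 := by constructor <;> decide +kernel

set_option maxRecDepth 100000 in
theorem threeGirthSix_start : threeGirthSix.start 1 = true := by decide +kernel

/-- The search for graphs with girth at least `8` and a group of order `3`. -/
def three : Cfg where
  W := 44
  C1 := 40221844503304507020037122075242482743932503656296563177606846717206072394766160266969052875768270259561965716297794577924746037878955252948802626768307915498682119268433192717060484850513339404434649780813987141272499149811941956422569270817066988016758167259680101330821120838986404794083815697785955557526876539074013482286045954226541531638281355314625255059735424144727236166032022823505675623955932386309562924559524448379632856107581436177341083205688825204911079835753488894180679632835654351243587150177508056308770504547851726853092785217794473985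
  ONE := 353795085775831862874534227730486687024594643969621097625132113943144224201594989850896949893784883175260583846643948576779906866729013252848836972543944855993799722742294665825084487177397307889788188876353641700183336426671505581927999254007309085204560154527334367074655301936543457859133740975614431729707173671512923855211590917410557901169522606985016649721642062120857999619143269403923850427411153497562055535687524469363801275186813780914576840102781504129457634965700162045766903983878412826606362131397526775916525716139271597100512140049649224243910339985409
  FM := 17592186044415
  m := 3
  nt := 2
  mul := fun i j => Nat.mod (Nat.add i j) 3
  can := fun t i => cond (Nat.beq t 0) i 0
  sz := fun t => cond (Nat.beq t 0) 3 1
  cm := fun t => cond (Nat.beq t 0) 7 1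
  G4 := 4
  lo := 1
  hi := 16
  PR := 0
  PLO := 0
  LR := 3
  certs :=
    [76381772961386319069475372096181172871720498356350733696652021271101443,
    970064605190125702783418291948148676500054726752113289254748202462395498499,
    48312262520113397160830827073681831353330948177367251373149443711827971,
    76381772664301435885113997938321985136911055503472966910580987155972099,
    970064605189828617900233930573990817312319917309260411487962131428280369155,
    79370106284485230524881614774843446145722970414104601902022151089684483,
    66029790212897643632851562623519712301548202204284144964284998574145539,
    971400093103254596691261097997403409566596308253947886896925283518441848835,
    48312257622166256505691899457338280288330396918299187926964054148513795,
    66029789954379255120768233693643910175547066278187397126127894115909635,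
    971400093102996078302749014668473533764470307118021790149087126413983612931,
    69017486802564615412581439093791701595178575041889029199848891037515779]

theorem three_wf : three.Wf := by constructor <;> decide +kernel

set_option synthInstance.maxSize 1000 in
theorem three_subgroups : three.Subgroups 1 := by constructor <;> decide +kernel

set_option maxRecDepth 100000 in
theorem three_start : three.start 1 = true := by decide +kernel

/-- The search for graphs with a group of order `5`. -/
def five : Cfg where
  W := 42
  C1 := 107503526563284708897985535789976112145774871471764993047718876890673680944432286571062201616944613476062788048137923445900009643869350073185580624905124892243214255431084030927558517280888895227592214475631231003695925425881945013745413205407152190902538620923986015719413484711066006012440606278938876248692268294530592446864065019794524355013079855954388424415802552615274931748777671679246386974871775903786580677466370278418180419075337738989620525202381601383126268074229440752236351452600068737073153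
  ONE := 236402754966461498952227120591295310586852910522416924498054086728544655167816178546054574530969760374602576293111715011432562006089584029671195385247523884230761259653076394131336614181547556707074058611610091050920060881678743980934389759560886492791263100924792641055906198824667364430695848810043122352285969094773370354442751598934130301579942044109761906664813240098860297416836224487598340312413309214156742788009888978029217284386170552032425555692644433296286264793260239990359390602719927900826171946727112705
  FM := 4398046511103
  m := 5
  nt := 1
  mul := fun i j => Nat.mod (Nat.add i j) 5
  can := fun _ i => i
  sz := fun _ => 5
  cm := fun _ => 31
  G4 := 4
  lo := 20
  hi := 20
  PR := 0
  PLO := 0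
  LR := 3
  certs :=
    [397832187140565580454714333098560555345285908620762900961621903204423090713967854725,
    413128756406133984637283983578008473408849072986927169748711846620719347334901793925,
    428420730173160649086737338123823078902528666600388961408358540150127950131831637125,
    443124480126844627697304813164573675451111203867933680755269248157916863456237192325,
    382535581972664818930479711557131127027270528858093144071973809398385524297533883525,
    92142011573227856008643548340017119644664250774753481539665548483383796681769716869,
    137315747877610320056021618690260108639150057076108298420144312532405792104291765381,
    201225389282377626974648847304489933209199821730643973387764182057283481047575039109,
    170873062055736136905890655144282834698699016998173791168060998992582655260972584069,
    138283631844686490632800682852448254166232048856135478061566924733814833073669787013,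
    517449901652122783827685204955679161950601076354134457490734806412568407333568793989,
    517689801036930982121769761711984828476117154365269927964978910450718102166046215685,
    92515202126687828885432222996723581207351624404447198613933681652465634718589144581,
    183103471498855374836059869540163671535713181601352834663284783045233040294830034693,
    110160064079307298471267626034552144109780370690268889413248599377221270040853565189,
    125336231283965544760827545443783658178116598211521479961687738289719325350777229189,
    516983056500638443029117996470660469861531983408326940267730643578926311478804303749,
    516863566358086685004627293182881433200438656882376421206016950309269691479485747205,
    183436199897585164293252976694931739074388937411230267620454108491965975442449911941,
    167807806971178952555779149534031564023820921981238334680697953978839179793875226885,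
    168378596555310704443242338179408770819595248704819283972354514890166238843299582213]

theorem five_wf : five.Wf := by constructor <;> decide +kernel

set_option maxRecDepth 100000 in
theorem five_start : five.start 0 = true := by decide +kernel

/-- The search for graphs with a group of order `7`. -/
def seven : Cfg where
  W := 44
  C1 := 40221844503304507020037122075242482743932503656296563177606846717206072394766160266969052875768270259561965716297794577924746037878955252948802626768307915498682119268433192717060484850513339404434649780813987141272499149811941956422569270817066988016758167259680101330821120838986404794083815697785955557526876539074013482286045954226541531638281355314625255059735424144727236166032022823505675623955932386309562924559524448379632856107581436177341083205688825204911079835753488894180679632835654351243587150177508056308770504547851726853092785217794473985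
  ONE := 353795085775831862874534227730486687024594643969621097625132113943144224201594989850896949893784883175260583846643948576779906866729013252848836972543944855993799722742294665825084487177397307889788188876353641700183336426671505581927999254007309085204560154527334367074655301936543457859133740975614431729707173671512923855211590917410557901169522606985016649721642062120857999619143269403923850427411153497562055535687524469363801275186813780914576840102781504129457634965700162045766903983878412826606362131397526775916525716139271597100512140049649224243910339985409
  FM := 17592186044415
  m := 7
  nt := 1
  mul := fun i j => Nat.mod (Nat.add i j) 7
  can := fun _ i => i
  sz := fun _ => 7
  cm := fun _ => 127
  G4 := 4
  lo := 21
  hi := 21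
  PR := 0
  PLO := 0
  LR := 4
  certs :=
    []

theorem seven_wf : seven.Wf := by constructor <;> decide +kernel

set_option maxRecDepth 100000 in
theorem seven_start : seven.start 0 = true := by decide +kernel

/-- The search for graphs with a group of order `11`. -/
def eleven : Cfg where
  W := 46
  C1 := 3852487334169378972681891455458975772187216096533874200360883441540202398727379046684385515624253640053185243687227447708208696635405456192115935418862639369917060153754560877012124137369463924025026847199025984444370514433048213739512425907207314939323330430588572588619459784376399453125551072426680527280169998696263168576682145830311685649473461985943538575596389709026265020210385392673000996025998078334513313590409039633072853907581716028895801520946057660484194804710847854600381656958241914577772741716182636182494188379985887132438674483257168539259485265222207208039080230812905492007520166354092033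
  ONE := 135547347832925969409084694816907906234207423817381982361662656650821866078572216921282342426715075738369931224048469443427040699810312967085179618439730526026991060471708656809649904442935596453641747988845276177411347199309453243450922198192023191378564846597325775430333758635569454595750959621761549711020597925936528236212570389927263039157226414449830213036440296175685670037450063679297945052688128065469069335202448828082332783789637154003058090174647532850810079856268643594678188603210342075695793848406917093390169678007563903543597516260397194869735909354930783393850002542522024852275036880269214061749751250945
  FM := 70368744177663
  m := 11
  nt := 1
  mul := fun i j => Nat.mod (Nat.add i j) 11
  can := fun _ i => i
  sz := fun _ => 11
  cm := fun _ => 2047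
  G4 := 4
  lo := 22
  hi := 22
  PR := 0
  PLO := 0
  LR := 3
  certs :=
    []

theorem eleven_wf : eleven.Wf := by constructor <;> decide +kernel

set_option maxRecDepth 100000 in
theorem eleven_start : eleven.start 0 = true := by decide +kernel

/-- The search for graphs with a group of order `13`. -/
def thirteen : Cfg where
  W := 54
  C1 := 391974504802360930049247722614290026662319811021942507517171784578849229812414285686475872711038569427611925685105916469058776136344887211466460622783833265103382101824652914514442336556425352860608313309246309676795448077256404284835616173848196011524634015338160898177958587664045673471691671285443863068689091909185349914411142799308511194500145576802874082235832904935571720684181109301243699231363940268833337295059534123416131425596628559076970384876877335023699024696787071713916799549920660305903394752934807524596518306604882342070628110326356425699857152782878192141271774613102603583301481148240088487395278891408939107104807932888258118502616325915978132356104887674469144194768366844919515514472861445453533690246580395653003068066125363437968248452544543129879771266343778580398702831405279879318473212536809419986977100676288479233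
  ONE := 3530592467533294562853588899491208322266026359409723568278643991099462218328056179567837778390753239995034795224478256339588131018906559765026886613737646619191595414113038199780478744928237458549520847064357243902299205537796916384488543240527974632698938483711195676510846082765689247937254080097354272045697134958368332096825485635735278103286619042387287759552554406357912437996058048151580160999098767884344903063923055467029558581794893719974938869410292750002215352878033930355698934814270331192074371688608041906676544475613152472454557151092903428792089433536723117855577538112946503672546079006917728206128736800598983221317230808252567371341505661439526767112892955108578919903375007886071994697421073757010270298132638428441757187810652148638149589245379383297124232736225054722267733754853362002345615081089545561899045708626429910802045819257094145
  FM := 18014398509481983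
  m := 13
  nt := 1
  mul := fun i j => Nat.mod (Nat.add i j) 13
  can := fun _ i => i
  sz := fun _ => 13
  cm := fun _ => 8191
  G4 := 4
  lo := 26
  hi := 26
  PR := 0
  PLO := 0
  LR := 3
  certs :=
    [7991073032588999165885962674034959903730334460242093865198197253543810948470911315715341761901379853046123661,
    4144641085998784115484293662013017223198892037380312507304455590234511400451225299272820469412875984255406874]

theorem thirteen_wf : thirteen.Wf := by constructor <;> decide +kernel

set_option maxRecDepth 100000 in
theorem thirteen_start : thirteen.start 0 = true := by decide +kernel

/-- The search for graphs with a group of order `17`. -/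
def seventeen : Cfg where
  W := 36
  C1 := 577756298079507556227515884528428268634031741833440245458357768505135406556371165389944031659091148240442636579037649460118489653152610708376045876508174731402236869058177476908719611008175128679621087713517757047767457731757744440538887881291225264781472747806662627197997534917819314262589141224903018652180884731431605589911451543741830080050024125367960856034279425
  ONE := 19851555242187222345212537366510921231876863377774401969808402587105376270259323897354182147014847981375070721923702381538982869487361110251034187223854998217747874169034356066989378364434123177372761133991291863918455863531590586143750982120470764276664896131437408159394177299578116739785612122874475918340226081475706602992244354963934902185065421301742417719684050690464808961
  FM := 68719476735
  m := 17
  nt := 1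
  mul := fun i j => Nat.mod (Nat.add i j) 17
  can := fun _ i => i
  sz := fun _ => 17
  cm := fun _ => 131071
  G4 := 4
  lo := 17
  hi := 17
  PR := 0
  PLO := 0
  LR := 3
  certs :=
    []

theorem seventeen_wf : seventeen.Wf := by constructor <;> decide +kernel

set_option maxRecDepth 100000 in
theorem seventeen_start : seventeen.start 0 = true := by decide +kernel

/-- The search for graphs with a group of order `19`. -/
def nineteen : Cfg where
  W := 40
  C1 := 73556897794354764445310328244830522301380202325577120078560872462339506868001273021917923406064928322587497287078007912754546770607821567499961405886549750249606182971795422436116053782079486687624825867789510009503342412234404235396279072378962332904607601223475132440870797982361741058069254681840957061710507608048735614830601272455048269594557767814258294554717665143790598726169999338588809164176223368011641314747226419934362648665359154866547194855425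
  ONE := 40438332213975157130544893536942171712649884906432352367414437545559028428501470686945398526277963188487984993416409787404084878510446346076510474674877805768335258912328528127221065211844968966259126073274585863454085649144755970430041808648937290672871294755095479202996077802550174501157316402344126205291837012016191827914443511663251534371430475732847436816909128252536523967976200974395888775674717352708572944424890539595161195105999550325481546778850727154417665
  FM := 1099511627775
  m := 19
  nt := 1
  mul := fun i j => Nat.mod (Nat.add i j) 19
  can := fun _ i => i
  sz := fun _ => 19
  cm := fun _ => 524287
  G4 := 4
  lo := 19
  hi := 19
  PR := 0
  PLO := 0
  LR := 3
  certs :=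
    []

theorem nineteen_wf : nineteen.Wf := by constructor <;> decide +kernel

set_option maxRecDepth 100000 in
theorem nineteen_start : nineteen.start 0 = true := by decide +kernel

/-- The search for graphs with a group of order `23`. -/
def twentyThree : Cfg where
  W := 48
  C1 := 94462714573708206243389917136341046013113648911335545299848917824192881427284642731706212915022869169886366824292025149519221149964415609857656503758135882004081316716577706204450666867847076753475708498192814799458711533476214979286542603086162819540781922200094650764378426805484387927387422717361753687878057406459141581571162425144233409427218478731400241437693286484188238796922524475443529829226089745771311417176471744384528225039479078415837022599648008511330685644749873060308739601032505831152592155623837261123439741107609201945935362944250678274540443077681992980887419253493654052520006071218801718321004325217685587880198834143783830222046841907707905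
  ONE := 13294445192329884004369916196077123619339932150222676942801345015225390454191353451770320651438981886007272120145056601914642249444588482671638502077773685698562067692620625609709753878756892850818640547747892399773804660526611176609101814986079646885096932354200497002247243720631475254306755471590725265724132259407729433800552874647321321929687572902710223953018399438546899573915147309433577537013250669970532012638467828450334512910061960230331284922356236318438746965852281763651582434019469413528733133079437293449774813421840103424980103087022004201778530044186310917410629674224039922475274433418143287450816945686802176073148679539722228556314299257544177863654650150913
  FM := 281474976710655
  m := 23
  nt := 1
  mul := fun i j => Nat.mod (Nat.add i j) 23
  can := fun _ i => i
  sz := fun _ => 23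
  cm := fun _ => 8388607
  G4 := 4
  lo := 23
  hi := 23
  PR := 0
  PLO := 0
  LR := 3
  certs :=
    []

theorem twentyThree_wf : twentyThree.Wf := by constructor <;> decide +kernel

set_option maxRecDepth 100000 in
theorem twentyThree_start : twentyThree.start 0 = true := by decide +kernel

/-- The search for graphs with a cyclic group of order `9`, with `18` vertices on each side. -/
def cyclicNine : Cfg where
  W := 74
  C1 := 1544709769889534698480399525225156576397871493490242290312846457520399679040156449226940464207583062281951088166650856218549889530371855000698758440674910322817291964308506490024025778067525506278817114886197835067763098533761440563576252707161179947502681563578157822081756175939191691598994727869614860424669325521907846577206731982211975704765760658950710964196029854909772335552715883351164868500912768641320776097813814037255137615698369544545963465527443020591279355976411767518251684590658622403414379727075126905872992189314045611666259904216115555176545571472263499464556253557341578196532652659799802037131297644211633884719924676488913997607405815828205495431827296824412816603524503070940429751114688468260246910988098791767972988810612919234060843531482596681685712045041723204243896830612362467305059120293018779152569098238084071415741074863320049506419265588193771334103955780292122463178691898731012194667400500886477152560067856240135626458524606253448797996062662672438486368209186128577502642411351924595490324914103241400658001707623788351075451213071687508460163836862304945926583713123549735570168542679548968749717163792503872157709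06418476196011304431508633036967323915165177743547431453827408114373752860995378630805111861722386958436340175253475546552182308186406668077609188835693438743281116587866641695910056205185514774032753095366644459772862899200467340536625635247138121519191536741712720635685931179189909781297604293445712101511732198401951898361846611401608508363352518316974473200333600390020529116216799034120452565540832198005881565338845357283919447681548924485633
  ONE := 1458937128617524192122662452724702901498089750014563644556424115948736310363138099355798575025723872478171633469908124490899664579835194779319678483334341106954851102000854173093561263165314932366305189666385454995374697970248371148607353356262410588969619176016718461274257402754372551081311575112039913242818618194880845884980461288393568447188537035525421524225476871447175626093326593494817925103668187189261192029880422744853135055852102989650200102886204543232956976624391081489796487954197889891118521945849680296562838725910475547987346307388496278590688163437950351568583869291755633071715003236845175309738406135832641970065122468225154624258249097588267461268429348153456517472260480221083626602102972657873059701047373979690037811881386921018251780313935075811655577060838376775082374053161805110071834568016585850282337211374068398844051761083403193981745725238576792805757690687484996834850368900214782523380333774352666747182464802358567807719484613843938730923514846867896736298741028932720541531021201528447191349546518788797131319197029653185964349130095159895883024246954085471529343934791468382038889835189400148163627700474104917907775421826214636271279079005876124393933726423831360892881514874479929302273761017796304909661286503348126892179508127128139335955926165793937393033761420667935133291258728568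282839146254899059064835995205645902205079025203730051578659043807456876306959800192792780455733518551200253749820893935106719673983771228615776227118024516394814328009277014901692382731067014145267113657597888769638024109864186558265124107517729838027877864557370591730622902620902822596152177721345
  FM := 18889465931478580854783
  m := 9
  nt := 2
  mul := fun i j => Nat.mod (Nat.add i j) 9
  can := fun t i => cond (Nat.beq t 0) i (Nat.mod i 3)
  sz := fun t => cond (Nat.beq t 0) 9 3
  cm := fun t => cond (Nat.beq t 0) 511 7
  G4 := 4
  lo := 18
  hi := 18
  PR := 0
  PLO := 0
  LR := 3
  certs :=
    []

theorem cyclicNine_wf : cyclicNine.Wf := by constructor <;> decide +kernel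

set_option synthInstance.maxSize 1000 in
theorem cyclicNine_subgroups : cyclicNine.Subgroups 3 := by constructor <;> decide +kernel

set_option maxRecDepth 100000 in
theorem cyclicNine_start : cyclicNine.start 1 = true := by decide +kernel

/-- The search for graphs with a cyclic group of order `9`, with `24` vertices on each side. -/
def cyclicNine24 : Cfg where
  W := 74
  C1 := 1544709769889534698480399525225156576397871493490242290312846457520399679040156449226940464207583062281951088166650856218549889530371855000698758440674910322817291964308506490024025778067525506278817114886197835067763098533761440563576252707161179947502681563578157822081756175939191691598994727869614860424669325521907846577206731982211975704765760658950710964196029854909772335552715883351164868500912768641320776097813814037255137615698369544545963465527443020591279355976411767518251684590658622403414379727075126905872992189314045611666259904216115555176545571472263499464556253557341578196532652659799802037131297644211633884719924676488913997607405815828205495431827296824412816603524503070940429751114688468260246910988098791767972988810612919234060843531482596681685712045041723204243896830612362467305059120293018779152569098238084071415741074863320049506419265588193771334103955780292122463178691898731012194667400500886477152560067856240135626458524606253448797996062662672438486368209186128577502642411351924595490324914103241400658001707623788351075451213071687508460163836862304945926583713123549735570168542679548968749717163792503872157709064184761960113044315086330369673239151651777435474314538274081143737528609953786308051118617223869584363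40175253475546552182308186406668077609188835693438743281116587866641695910056205185514774032753095366644459772862899200467340536625635247138121519191536741712720635685931179189909781297604293445712101511732198401951898361846611401608508363352518316974473200333600390020529116216799034120452565540832198005881565338845357283919447681548924485633
  ONE := 1458937128617524192122662452724702901498089750014563644556424115948736310363138099355798575025723872478171633469908124490899664579835194779319678483334341106954851102000854173093561263165314932366305189666385454995374697970248371148607353356262410588969619176016718461274257402754372551081311575112039913242818618194880845884980461288393568447188537035525421524225476871447175626093326593494817925103668187189261192029880422744853135055852102989650200102886204543232956976624391081489796487954197889891118521945849680296562838725910475547987346307388496278590688163437950351568583869291755633071715003236845175309738406135832641970065122468225154624258249097588267461268429348153456517472260480221083626602102972657873059701047373979690037811881386921018251780313935075811655577060838376775082374053161805110071834568016585850282337211374068398844051761083403193981745725238576792805757690687484996834850368900214782523380333774352666747182464802358567807719484613843938730923514846867896736298741028932720541531021201528447191349546518788797131319197029653185964349130095159895883024246954085471529343934791468382038889835189400148163627700474104917907775421826214636271279079005876124393933726423831360892881514874479929302273761017796304909661286503348126892179508127128139335955926165793937393033761420667935133291258728568282839146254899059064835995205645902205079025203730051578659043807456876306959800192792780455733518551200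253749820893935106719673983771228615776227118024516394814328009277014901692382731067014145267113657597888769638024109864186558265124107517729838027877864557370591730622902620902822596152177721345
  FM := 18889465931478580854783
  m := 9
  nt := 2
  mul := fun i j => Nat.mod (Nat.add i j) 9
  can := fun t i => cond (Nat.beq t 0) i (Nat.mod i 3)
  sz := fun t => cond (Nat.beq t 0) 9 3
  cm := fun t => cond (Nat.beq t 0) 511 7
  G4 := 4
  lo := 24
  hi := 24
  PR := 0
  PLO := 0
  LR := 3
  certs :=
    []

theorem cyclicNine24_wf : cyclicNine24.Wf := by constructor <;> decide +kernel

set_option synthInstance.maxSize 1000 in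
theorem cyclicNine24_subgroups : cyclicNine24.Subgroups 3 := by constructor <;> decide +kernel

set_option maxRecDepth 100000 in
theorem cyclicNine24_start : cyclicNine24.start 1 = true := by decide +kernel

/-- The search for graphs with an elementary abelian group of order `9`, with `18` vertices on each side. -/
def elementaryNine : Cfg where
  W := 74
  C1 := 1544709769889534698480399525225156576397871493490242290312846457520399679040156449226940464207583062281951088166650856218549889530371855000698758440674910322817291964308506490024025778067525506278817114886197835067763098533761440563576252707161179947502681563578157822081756175939191691598994727869614860424669325521907846577206731982211975704765760658950710964196029854909772335552715883351164868500912768641320776097813814037255137615698369544545963465527443020591279355976411767518251684590658622403414379727075126905872992189314045611666259904216115555176545571472263499464556253557341578196532652659799802037131297644211633884719924676488913997607405815828205495431827296824412816603524503070940429751114688468260246910988098791767972988810612919234060843531482596681685712045041723204243896830612362467305059120293018779152569098238084071415741074863320049506419265588193771334103955780292122463178691898731012194667400500886477152560067856240135626458524606253448797996062662672438486368209186128577502642411351924595490324914103241400658001707623788351075451213071687508460163836862304945926583713123549735570168542679548968749717163792503872157709064184761960113044315086330369673239151651777435474314538274081143737528609953786308051118617223869584363401752534755465521823081864066680776091888356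93438743281116587866641695910056205185514774032753095366644459772862899200467340536625635247138121519191536741712720635685931179189909781297604293445712101511732198401951898361846611401608508363352518316974473200333600390020529116216799034120452565540832198005881565338845357283919447681548924485633
  ONE := 1458937128617524192122662452724702901498089750014563644556424115948736310363138099355798575025723872478171633469908124490899664579835194779319678483334341106954851102000854173093561263165314932366305189666385454995374697970248371148607353356262410588969619176016718461274257402754372551081311575112039913242818618194880845884980461288393568447188537035525421524225476871447175626093326593494817925103668187189261192029880422744853135055852102989650200102886204543232956976624391081489796487954197889891118521945849680296562838725910475547987346307388496278590688163437950351568583869291755633071715003236845175309738406135832641970065122468225154624258249097588267461268429348153456517472260480221083626602102972657873059701047373979690037811881386921018251780313935075811655577060838376775082374053161805110071834568016585850282337211374068398844051761083403193981745725238576792805757690687484996834850368900214782523380333774352666747182464802358567807719484613843938730923514846867896736298741028932720541531021201528447191349546518788797131319197029653185964349130095159895883024246954085471529343934791468382038889835189400148163627700474104917907775421826214636271279079005876124393933726423831360892881514874479929302273761017796304909661286503348126892179508127128139335955926165793937393033761420667935133291258728568282839146254899059064835995205645902205079025203730051578659043807456876306959800192792780455733518551200253749820893935106719673983771228615776227118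024516394814328009277014901692382731067014145267113657597888769638024109864186558265124107517729838027877864557370591730622902620902822596152177721345
  FM := 18889465931478580854783
  m := 9
  nt := 5
  mul := elementaryMul
  can := elementaryCan
  sz := fun t => cond (Nat.beq t 0) 9 3
  cm := elementaryMask
  G4 := 4
  lo := 18
  hi := 18
  PR := 0
  PLO := 0
  LR := 3
  certs :=
    []

theorem elementaryNine_wf : elementaryNine.Wf := by constructor <;> decide +kernel

set_option synthInstance.maxSize 1000 in
theorem elementaryNine_subgroups : elementaryNine.Subgroups 1 := by constructor <;> decide +kernel

set_option maxRecDepth 100000 in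
theorem elementaryNine_start : elementaryNine.start 1 = true := by decide +kernel

/-- The search for graphs with an elementary abelian group of order `9`, with `24` vertices on each side. -/
def elementaryNine24 : Cfg where
  W := 74
  C1 := 1544709769889534698480399525225156576397871493490242290312846457520399679040156449226940464207583062281951088166650856218549889530371855000698758440674910322817291964308506490024025778067525506278817114886197835067763098533761440563576252707161179947502681563578157822081756175939191691598994727869614860424669325521907846577206731982211975704765760658950710964196029854909772335552715883351164868500912768641320776097813814037255137615698369544545963465527443020591279355976411767518251684590658622403414379727075126905872992189314045611666259904216115555176545571472263499464556253557341578196532652659799802037131297644211633884719924676488913997607405815828205495431827296824412816603524503070940429751114688468260246910988098791767972988810612919234060843531482596681685712045041723204243896830612362467305059120293018779152569098238084071415741074863320049506419265588193771334103955780292122463178691898731012194667400500886477152560067856240135626458524606253448797996062662672438486368209186128577502642411351924595490324914103241400658001707623788351075451213071687508460163836862304945926583713123549735570168542679548968749717163792503872157709064184761960113044315086330369673239151651777435474314538274081143737528609953786308051118617223869584363401752534755465521823081864066680776091888356934387432811165878666416959100562051855147740327530953666444597728628992004673405366256352471381215191915367417127206356859311791899097812976042934457121015117321984019518983618466114016085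08363352518316974473200333600390020529116216799034120452565540832198005881565338845357283919447681548924485633
  ONE := 1458937128617524192122662452724702901498089750014563644556424115948736310363138099355798575025723872478171633469908124490899664579835194779319678483334341106954851102000854173093561263165314932366305189666385454995374697970248371148607353356262410588969619176016718461274257402754372551081311575112039913242818618194880845884980461288393568447188537035525421524225476871447175626093326593494817925103668187189261192029880422744853135055852102989650200102886204543232956976624391081489796487954197889891118521945849680296562838725910475547987346307388496278590688163437950351568583869291755633071715003236845175309738406135832641970065122468225154624258249097588267461268429348153456517472260480221083626602102972657873059701047373979690037811881386921018251780313935075811655577060838376775082374053161805110071834568016585850282337211374068398844051761083403193981745725238576792805757690687484996834850368900214782523380333774352666747182464802358567807719484613843938730923514846867896736298741028932720541531021201528447191349546518788797131319197029653185964349130095159895883024246954085471529343934791468382038889835189400148163627700474104917907775421826214636271279079005876124393933726423831360892881514874479929302273761017796304909661286503348126892179508127128139335955926165793937393033761420667935133291258728568282839146254899059064835995205645902205079025203730051578659043807456876306959800192792780455733518551200253749820893935106719673983771228615776227118024516394814328009277014901692382731067014145267113657597888769638024109864186558265124107517729838027877864557370591730622902620902822596152177721345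
  FM := 18889465931478580854783
  m := 9
  nt := 5
  mul := elementaryMul
  can := elementaryCan
  sz := fun t => cond (Nat.beq t 0) 9 3
  cm := elementaryMask
  G4 := 4
  lo := 24
  hi := 24
  PR := 0
  PLO := 0
  LR := 3
  certs :=
    [1073881977649937783782942936584583919228559194382761788450623880957347538884424761002680716147631255419430775608496458899922463831259229962106830857,
    1073881977649937783782942936554559590506906601219749917216013118127838562502445683108395320171847152772409886025459958459260131504122255146930405385,
    1298647980449471260023229624830275200591149744795503198811601968663050227040551725493171876853330725285295167944314052607141109128907514115992322057,
    1298647980449471260023229624800250886298929019209762858066366174578100168273628080504702791001550688712119493696554026295330123695661072858811990025,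
    1048908001155935504791113453496115335608574135495224438135523722597221517988728828576983007566761062962717039515109100946844540717222874852976754697,
    1048908001155935504791113453456082897313037344614463851983604060526661584830242063297366366467587150153304694543671022481906599659273262556872966153,
    1273674003955468981031400141741806591432008699197527184956335372944217850767450001093786437742329460850467119177943140456568154347603526574151827465,
    1273674003955468981031400141701774153174048588946687281379823358916312875120154184953580638985614186327749391394338595549164871564595511283133972489,
    1098855954143940062774772419642555350052534926359995179643439115554298948784132463062625012003677432000982260731341757697398215114966238570464935945,
    1098855954143940062774772419622539130904766530914732020201390697735857112030556975627222086404906958838226049383404111192505912482845091901583917065,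
    1323621956943473539015059107888246822193078137832027792123310820295728233122977529944183879837600632662454732077939515929284813372543632820435681289,
    1323621956943473539015059107868230603045896806368238999094458508717576359997454151898901781860801816690168785685248054550524447103411862274419195913,
    1323621945034970593865970050925180521884135090196130346790048058416271745523152904497486859417059511911803209655303918681293049668589820994048229385,
    1173778050345396978619923946491993893933456809346300030307680110056620101765941675159582473094894589321872148130952298902750248302291486696890433545,
    1098855942235437117625683362679489049742908653497279183144565659279119438876656214945585479135682748270597160340753595328820009759105316825163890697,
    949012047545863502379637258246302450876574783468826511521496494322421809549344448774525347070536821338961707090005291950914180706208413963784290313,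
    1273673968229909039736330935809412706508560254963262766058604789621432430504304782122709567980564184230149890523202618686803234431109502577055629321,
    1173778038436859962905633532853954954689982150625608515481729966895224012456268932091184557513101025407277375365710117326790743358491419580641050633,
    1048907965430375563496044247563721450647619393582937351618248067686907206134244093346125007746927025863275934822818752923239096872039588983765729289,
    949012035637326486665346844608263718070063480233890814795050245019145251890935554020411234178203857012778610895195944841358059897418514983014105097,
    1298647956632431299159850154208917550719476046962665955356825480763756978058533145012280420094523734524914027003007815700423907986098839611598962697,
    1173778026528339982473943797532674271364206069988862764322523782429663101423284647775262890101946251761524921184503913020985224895565393756099182601,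
    1073881953832897822919563465963226254927474855971083773974384356330449342256342634889801136037023393836903641743663401611453297695628385280948437001,
    949012023728806506233657109286982975799130512137004118864949063790415339712982401247130948484421678585260228599615541951075095044540149734536380425]

theorem elementaryNine24_wf : elementaryNine24.Wf := by constructor <;> decide +kernel

set_option synthInstance.maxSize 1000 in
theorem elementaryNine24_subgroups : elementaryNine24.Subgroups 1 := by constructor <;> decide +kernel

set_option maxRecDepth 100000 in
theorem elementaryNine24_start : elementaryNine24.start 1 = true := by decide +kernel

end Cfg
namespace Semi

open Cfg

variable {V : Type*} {G : SimpleGraph V} {side : V → Bool}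

/-- A graph of girth `4` has more than `26` vertices on each side. -/
theorem false_of_girth_four (hs : Semi G side) (h4 : ¬ NoSquare G) {u : V} (hu : side u = true)
    (hn : {v | side v = true}.ncard ≤ 26) : False := by
  have := hs.finite
  refine hs.false_of_rot (c := threeGirthFour) ⟨fun v l _ h => ?_, ?_, hn, fun _ => ?_⟩
    threeGirthFour_wf threeGirthFour_subgroups threeGirthFour_start rfl (fun _ _ => rfl) hu
  · exact h.2 rfl
  · exact (Set.ncard_pos (Set.toFinite _)).2 ⟨u, hu⟩
  · exact hs.le_inter_one h4

/-- A graph of girth `6` has more than `26` vertices on each side. -/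
theorem false_of_hex (hs : Semi G side) (h4 : NoSquare G) {a b c d e f : V}
    (h : Hex G a b c d e f) {u : V} (hu : side u = true)
    (hn : {v | side v = true}.ncard ≤ 26) : False := by
  have := hs.finite
  by_cases hun : ∃ s, Uniq G side s
  · have : Nonempty V := ⟨u⟩
    obtain ⟨s, hun⟩ := hun
    refine hs.false_of_uniq h4 (fun t => ?_) fun x v y hx hy hxy => ?_
    · by_cases ht : t = s
      · rwa [ht]
      · rw [Bool.eq_not_of_ne ht]
        exact hun.swap hs
    · by_cases hb : side b = side v
      · exact hs.exists_hex hb h hx hy hxy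
      · refine hs.exists_hex ?_ h.rot hx hy hxy
        rw [hs.adj_side _ _ h.bc, Bool.eq_not_of_ne hb, Bool.not_not]
  · refine hs.false_of_rot (c := threeGirthSix) ⟨hs.girth_six h4, ?_, hn, fun _ v x y => ?_⟩
      threeGirthSix_wf threeGirthSix_subgroups threeGirthSix_start rfl (fun _ _ => rfl) hu
    · exact (Set.ncard_pos (Set.toFinite _)).2 ⟨u, hu⟩
    · exact hs.le_inter_two h4 (fun h => hun ⟨_, h⟩) v x y rfl

/-- A graph of girth at least `8` has more than `26` vertices on each side. -/
theorem false_of_girth_eight (hs : Semi G side) (h4 : NoSquare G)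
    (h6 : ∀ a b c d e f, ¬ Hex G a b c d e f) {u : V} (hu : side u = true)
    (hn : {v | side v = true}.ncard ≤ 26) : False := by
  have := hs.finite
  have h8 := hs.girth_eight h4 h6
  have hpos : 0 < {v | side v = true}.ncard := (Set.ncard_pos (Set.toFinite _)).2 ⟨u, hu⟩
  have hcard := hs.dvd_card hu
  have h9 (h : 3 ∣ {v | side v = true}.ncard) :=
    hs.exists_nine ((mul_dvd_mul_left 3 h).trans hcard) u
  have hfits (c : Cfg) (hG : c.G4 = 4) (h1 : c.lo ≤ {v | side v = true}.ncard)
      (h2 : {v | side v = true}.ncard ≤ c.hi) (h3 : c.PR = 0) : c.Fits G side :=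
    ⟨hG ▸ h8, h1, h2, fun h => absurd h3 h⟩
  have prime (c : Cfg) (hw : c.Wf) (hst : c.start 0 = true) (hG : c.G4 = 4) (h1 : c.lo = c.hi)
      (h3 : c.PR = 0) (hp : c.m.Prime) (hnt : 0 < c.nt) (hm : 3 < c.m)
      (hmul : ∀ i j, c.mul i j = (i + j) % c.m) (hcan : ∀ i, c.can 0 i = i) (hd : c.m ∣ c.hi)
      (h : {v | side v = true}.ncard = c.hi) : False :=
    hs.false_of_prime (hfits c hG (by omega) (by omega) h3) hw hp hnt hm hmul hcan hst (h ▸ hd) hu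
  by_cases hn16 : {v | side v = true}.ncard ≤ 16
  · exact hs.false_of_rot (hfits three rfl hpos hn16 rfl) three_wf three_subgroups three_start rfl
      (fun _ _ => rfl) hu
  · generalize hk : {v | side v = true}.ncard = k at *
    obtain h | h | h | h | h | h | h | h | h | h : k = 17 ∨ k = 18 ∨ k = 19 ∨ k = 20 ∨ k = 21 ∨
      k = 22 ∨ k = 23 ∨ k = 24 ∨ k = 25 ∨ k = 26 := by omega
    · exact prime seventeen seventeen_wf seventeen_start rfl rfl rfl (by decide +kernel) (by decide)
        (by decide) (fun _ _ => rfl) (fun _ => rfl) (by decide) h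
    · rcases h9 (by omega) with ⟨g, hg, hgu⟩ | ⟨a, g, ha, hg, hag, hga, hau⟩
      · exact hs.false_of_cyclic_nine (hfits cyclicNine rfl h.ge h.le rfl) cyclicNine_wf
          cyclicNine_subgroups cyclicNine_start rfl (fun _ _ => rfl) hu hg hgu
      · exact hs.false_of_elementary_nine (hfits elementaryNine rfl h.ge h.le rfl) elementaryNine_wf
          elementaryNine_subgroups elementaryNine_start rfl (fun _ _ => rfl) hu ha hg hag hga hau
    · exact prime nineteen nineteen_wf nineteen_start rfl rfl rfl (by decide +kernel) (by decide)
        (by decide) (fun _ _ => rfl) (fun _ => rfl) (by decide) h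
    · exact prime five five_wf five_start rfl rfl rfl (by decide +kernel) (by decide)
        (by decide) (fun _ _ => rfl) (fun _ => rfl) (by decide) h
    · exact prime seven seven_wf seven_start rfl rfl rfl (by decide +kernel) (by decide)
        (by decide) (fun _ _ => rfl) (fun _ => rfl) (by decide) h
    · exact prime eleven eleven_wf eleven_start rfl rfl rfl (by decide +kernel) (by decide)
        (by decide) (fun _ _ => rfl) (fun _ => rfl) (by decide) h
    · exact prime twentyThree twentyThree_wf twentyThree_start rfl rfl rfl (by decide +kernel)
        (by decide) (by decide) (fun _ _ => rfl) (fun _ => rfl) (by decide) h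
    · rcases h9 (by omega) with ⟨g, hg, hgu⟩ | ⟨a, g, ha, hg, hag, hga, hau⟩
      · exact hs.false_of_cyclic_nine (hfits cyclicNine24 rfl h.ge h.le rfl) cyclicNine24_wf
          cyclicNine24_subgroups cyclicNine24_start rfl (fun _ _ => rfl) hu hg hgu
      · exact hs.false_of_elementary_nine (hfits elementaryNine24 rfl h.ge h.le rfl)
          elementaryNine24_wf elementaryNine24_subgroups elementaryNine24_start rfl
          (fun _ _ => rfl) hu ha hg hag hga hau
    · exact hs.false_of_twentyfive h4 (hk.trans h) hu
    · exact prime thirteen thirteen_wf thirteen_start rfl rfl rfl (by decide +kernel) (by decide)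
        (by decide) (fun _ _ => rfl) (fun _ => rfl) (by decide) h

theorem twentySeven_le (hs : Semi G side) {u : V} (hu : side u = true) :
    27 ≤ {v | side v = true}.ncard := by
  by_contra! hn
  have hn : {v | side v = true}.ncard ≤ 26 := by omega
  by_cases h4 : NoSquare G
  · by_cases h6 : ∀ a b c d e f, ¬ Hex G a b c d e f
    · exact hs.false_of_girth_eight h4 h6 hu hn
    · push Not at h6
      obtain ⟨a, b, c, d, e, f, h⟩ := h6
      exact hs.false_of_hex h4 h hu hn
  · exact hs.false_of_girth_four h4 hu hn

end Semi

/-! ### Passing to a connected component -/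

section Component

variable {V : Type*} {G : SimpleGraph V} {S : Set V}

theorem exists_extension (hS : ∀ v w, G.Adj v w → (v ∈ S ↔ w ∈ S))
    (φ : G.induce S ≃g G.induce S) : ∃ ψ : G ≃g G, ∀ v : S, ψ v = φ v := by
  classical
  set f : Equiv.Perm V := Equiv.Perm.ofSubtype (φ.toEquiv : Equiv.Perm S) with hf
  have hin : ∀ v : S, f v = φ v := fun v =>
    Equiv.Perm.ofSubtype_apply_of_mem (p := (· ∈ S)) _ v.2
  have hout : ∀ v ∉ S, f v = v := fun v hv =>
    Equiv.Perm.ofSubtype_apply_of_not_mem (p := (· ∈ S)) _ hv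
  have hmem : ∀ v, f v ∈ S ↔ v ∈ S := by
    intro v
    by_cases hv : v ∈ S
    · simp only [hv, hin ⟨v, hv⟩, Subtype.coe_prop]
    · rw [hout v hv]
  refine ⟨⟨f, fun {a b} => ?_⟩, hin⟩
  by_cases h : a ∈ S ↔ b ∈ S
  · by_cases ha : a ∈ S
    · have hb := h.1 ha
      rw [hin ⟨a, ha⟩, hin ⟨b, hb⟩]
      exact φ.map_rel_iff (a := ⟨a, ha⟩) (b := ⟨b, hb⟩)
    · rw [hout a ha, hout b fun hb => ha (h.2 hb)]
  · refine iff_of_false (fun h' => h ?_) fun h' => h (hS _ _ h')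
    rw [← hmem a, ← hmem b]
    exact hS _ _ h'

theorem exists_restriction (ψ : G ≃g G) (h : ∀ v, v ∈ S ↔ ψ v ∈ S) :
    ∃ φ : G.induce S ≃g G.induce S, ∀ v, (φ v : V) = ψ v :=
  ⟨⟨ψ.toEquiv.subtypeEquiv h, ψ.map_rel_iff⟩, fun _ => rfl⟩

/-- The connected components of a graph whose automorphisms are transitive on the edges, but not on
the vertices. -/
theorem semi_component [Finite V] {side : V → Bool} (hcubic : ∀ v, (G.neighborSet v).ncard = 3)
    (hadj : ∀ v w, G.Adj v w → side w = !side v) (haut : ∀ (φ : G ≃g G) v, side (φ v) = side v)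
    (hedge : ∀ a b c d, G.Adj a b → G.Adj c d →
      ∃ φ : G ≃g G, (φ a = c ∧ φ b = d) ∨ (φ a = d ∧ φ b = c)) (C : G.ConnectedComponent) :
    Semi (G.induce C.supp) fun v => side v where
  finite := inferInstance
  cubic v := by
    rw [← Set.ncard_image_of_injective _ Subtype.val_injective, ← hcubic v]
    congr 1
    ext w
    constructor
    · rintro ⟨w, hw, rfl⟩
      exact hw
    · exact fun hw => ⟨⟨w, (C.mem_supp_congr_adj hw).1 v.2⟩, hw, rfl⟩
  adj_side v w h := hadj v w h
  side_aut φ v := by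
    obtain ⟨ψ, h⟩ := exists_extension (fun v w h => C.mem_supp_congr_adj h) φ
    rw [← h, haut]
  conn := C.connected_toSimpleGraph.preconnected
  trans u w u' w' h h' hu := by
    obtain ⟨ψ, h1⟩ := hedge u w u' w' h h'
    have h2 : ψ u = u' ∧ ψ w = w' := by
      refine h1.resolve_right fun h2 => ?_
      have h3 : side w' = !side u' := hadj _ _ h'
      rw [← h2.1, haut, ← hu] at h3
      simp at h3
    obtain ⟨φ, hφ⟩ := exists_restriction (S := C.supp) ψ fun v => by
      have e1 : G.connectedComponentMk u = C := u.2
      have e2 : G.connectedComponentMk (ψ u) = C := by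
        rw [h2.1]
        exact u'.2
      rw [C.mem_supp_iff, C.mem_supp_iff]
      refine Iff.trans (b := G.connectedComponentMk v = G.connectedComponentMk u) (by rw [e1])
        (Iff.trans ?_ (Iff.of_eq (congrArg _ e2)))
      rw [SimpleGraph.ConnectedComponent.eq, SimpleGraph.ConnectedComponent.eq,
        SimpleGraph.Iso.reachable_iff]
    exact ⟨φ, Subtype.ext ((hφ u).trans h2.1), Subtype.ext ((hφ w).trans h2.2)⟩

end Component
end CubicSearch

/-- Every finite simple graph that is cubic (every vertex has exactly 3 neighbours),
edge-transitive, and not vertex-transitive has at least 54 vertices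
(the Gray graph is the smallest cubic semisymmetric graph). -/
theorem smallest_cubic_semisymmetric (V : Type) [Fintype V] (G : SimpleGraph V)
    (hcubic : ∀ v : V, (G.neighborSet v).ncard = 3)
    (hedge : ∀ a b c d : V, G.Adj a b → G.Adj c d →
      ∃ φ : G ≃g G, (φ a = c ∧ φ b = d) ∨ (φ a = d ∧ φ b = c))
    (hnotvertex : ∃ u v : V, ∀ φ : G ≃g G, φ u ≠ v) :
    54 ≤ Fintype.card V := by
  classical
  obtain ⟨u, v, huv⟩ := hnotvertex
  have hnbr : ∀ v, ∃ w, G.Adj v w := fun v =>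
    Set.nonempty_of_ncard_ne_zero (s := G.neighborSet v) (by rw [hcubic]; decide)
  obtain ⟨w, hw⟩ := hnbr u
  set side : V → Bool := fun v => decide (∃ φ : G ≃g G, φ u = v) with hside
  have haut : ∀ (φ : G ≃g G) v, side (φ v) = side v := by
    intro φ v
    refine decide_eq_decide.2 ⟨?_, ?_⟩
    · rintro ⟨ψ, h⟩
      exact ⟨φ⁻¹ * ψ, by rw [RelIso.mul_apply, h, RelIso.inv_apply_self]⟩
    · rintro ⟨ψ, rfl⟩
      exact ⟨φ * ψ, rfl⟩
  have hu : side u = true := decide_eq_true ⟨1, rfl⟩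
  have hvs : side v = false := decide_eq_false fun ⟨φ, h⟩ => huv φ h
  have hws : side w = false := by
    obtain ⟨x, hx⟩ := hnbr v
    obtain ⟨φ, h | h⟩ := hedge _ _ _ _ hw hx
    · exact absurd h.1 (huv φ)
    · rw [← haut φ, h.2, hvs]
  have hadj : ∀ v w, G.Adj v w → side w = !side v := by
    intro x y hxy
    obtain ⟨φ, ⟨rfl, rfl⟩ | ⟨rfl, rfl⟩⟩ := hedge _ _ _ _ hw hxy
    all_goals rw [haut, haut, hu, hws]; rfl
  have hs := CubicSearch.semi_component hcubic hadj haut hedge (G.connectedComponentMk u)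
  have h1 := hs.twentySeven_le (u := ⟨u, rfl⟩) hu
  have h2 := hs.card_side_eq false
  have h3 := Set.ncard_add_ncard_compl
    {x : (G.connectedComponentMk u).supp | side x = true} (Set.toFinite _) (Set.toFinite _)
  have h4 : {x : (G.connectedComponentMk u).supp | side x = true}ᶜ =
      {x : (G.connectedComponentMk u).supp | side x = false} := by
    ext x
    exact Bool.not_eq_true _ |>.to_iff
  have h5 := Nat.card_le_card_of_injective _
    (Subtype.val_injective (p := (· ∈ (G.connectedComponentMk u).supp)))
  rw [Nat.card_eq_fintype_card (α := V)] at h5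
  rw [h4] at h3
  refine le_trans ?_ h5
  rw [← h3]
  omega
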